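/- arXiv:0903.4914 — 5 statements merged into one kernel-verified Lean document; each statement's English description precedes it below -/
import Mathlib

section
/- Let A be a (possibly non-unital) C*-algebra and let a, b, a', b' ∈ A be positive elements of norm at most one satisfying a ≤ b and a' ≤ b'. Then ‖a·a'‖² ≤ ‖b·b'‖. -/
/-- A positive contraction `x` satisfies `‖x * y‖ ^ 2 ≤ ‖star y * x * y‖`. -/
lemma norm_mul_sq_le_norm_star_conjugate {A : Type*} [NonUnitalCStarAlgebra A]
    [PartialOrder A] [StarOrderedRing A] {x : A} (hx : 0 ≤ x) (hnx : ‖x‖ ≤ 1) (y : A) :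
    ‖x * y‖ ^ 2 ≤ ‖star y * x * y‖ := by
  obtain ⟨t, ht, rfl⟩ : ∃ t : A, IsSelfAdjoint t ∧ t * t = x :=
    ⟨CFC.sqrt x, (CFC.sqrt_nonneg x).isSelfAdjoint, CFC.sqrt_mul_sqrt_self x hx⟩
  have hnt : ‖t‖ ≤ 1 := by
    rw [ht.norm_mul_self] at hnx
    exact (sq_le_one_iff₀ (norm_nonneg t)).mp hnx
  have hle : ‖t * t * y‖ ≤ ‖t * y‖ := by
    rw [mul_assoc]
    exact (norm_mul_le t (t * y)).trans (mul_le_of_le_one_left (norm_nonneg _) hnt)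
  calc ‖t * t * y‖ ^ 2 ≤ ‖t * y‖ ^ 2 := by gcongr
    _ = ‖star (t * y) * (t * y)‖ := by rw [CStarRing.norm_star_mul_self, sq]
    _ = ‖star y * (t * t) * y‖ := by rw [star_mul, ht.star_eq]; simp only [mul_assoc]

/-- The norm of a positive product `x * y` is its spectral radius, hence at most `‖y * x‖`. -/
lemma norm_mul_le_norm_mul_swap_of_nonneg {A : Type*} [NonUnitalCStarAlgebra A]
    [PartialOrder A] [StarOrderedRing A] {x y : A} (h : 0 ≤ x * y) :
    ‖x * y‖ ≤ ‖y * x‖ := by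
  rcases eq_or_ne ‖x * y‖ 0 with h0 | h0
  · rw [h0]
    exact norm_nonneg _
  have hmem : ‖x * y‖ ∈ spectrum ℝ ((x : Unitization ℂ A) * (y : Unitization ℂ A)) := by
    rw [← Unitization.inr_mul, ← Unitization.norm_inr (𝕜 := ℂ) (x * y)]
    exact CStarAlgebra.norm_mem_spectrum_of_nonneg (Unitization.inr_nonneg_iff.mpr h)
  have hmem' : ‖x * y‖ ∈ spectrum ℝ ((y : Unitization ℂ A) * (x : Unitization ℂ A)) := by
    have hdiff := spectrum.nonzero_mul_comm (𝕜 := ℝ) (x : Unitization ℂ A) (y : Unitization ℂ A)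
    exact (hdiff.subset ⟨hmem, h0⟩).1
  have hle := spectrum.norm_le_norm_of_mem hmem'
  rwa [norm_norm, ← Unitization.inr_mul, Unitization.norm_inr] at hle

/-- Winter–Zacharias, Proposition on product domination.
If `a, b, a', b'` are positive elements of norm at most one in a C*-algebra `A`
with `a ≤ b` and `a' ≤ b'`, then `‖a * a'‖ ^ 2 ≤ ‖b * b'‖`. -/
theorem product_domination {A : Type*} [NonUnitalCStarAlgebra A]
    [PartialOrder A] [StarOrderedRing A]
    (a b a' b' : A) (ha : 0 ≤ a) (hb : 0 ≤ b) (ha' : 0 ≤ a') (hb' : 0 ≤ b')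
    (hna : ‖a‖ ≤ 1) (hnb : ‖b‖ ≤ 1) (hna' : ‖a'‖ ≤ 1) (hnb' : ‖b'‖ ≤ 1)
    (hab : a ≤ b) (hab' : a' ≤ b') :
    ‖a * a'‖ ^ 2 ≤ ‖b * b'‖ := by
  obtain ⟨s, hs, rfl⟩ : ∃ s : A, IsSelfAdjoint s ∧ s * s = b :=
    ⟨CFC.sqrt b, (CFC.sqrt_nonneg b).isSelfAdjoint, CFC.sqrt_mul_sqrt_self b hb⟩
  have hconj {x : A} (hx : 0 ≤ x) : 0 ≤ s * x * s := by
    simpa only [hs.star_eq] using star_left_conjugate_nonneg hx s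
  calc ‖a * a'‖ ^ 2 ≤ ‖star a' * a * a'‖ := norm_mul_sq_le_norm_star_conjugate ha hna a'
    _ ≤ ‖star a' * (s * s) * a'‖ :=
      CStarAlgebra.norm_le_norm_of_nonneg_of_le (star_left_conjugate_nonneg ha a')
        (star_left_conjugate_le_conjugate hab a')
    _ = ‖star (s * a') * (s * a')‖ := by rw [star_mul, hs.star_eq]; simp only [mul_assoc]
    _ = ‖a' * s‖ ^ 2 := by
      rw [CStarRing.norm_star_mul_self, ← norm_star (s * a'), star_mul, hs.star_eq,
        ha'.isSelfAdjoint.star_eq, sq]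
    _ ≤ ‖s * a' * s‖ := by
      simpa only [hs.star_eq] using norm_mul_sq_le_norm_star_conjugate ha' hna' s
    _ ≤ ‖s * b' * s‖ :=
      CStarAlgebra.norm_le_norm_of_nonneg_of_le (hconj ha') (by
        simpa only [hs.star_eq] using star_left_conjugate_le_conjugate hab' s)
    _ ≤ ‖s * (s * b')‖ := norm_mul_le_norm_mul_swap_of_nonneg (hconj hb')
    _ = ‖s * s * b'‖ := by rw [mul_assoc]
end

section
/- Let A and B be C*-algebras and φ : A → B a completely positive order zero map. Let C ⊆ B denote the C*-subalgebra generated by the range of φ, i.e. the topological closure of the non-unital star-subalgebra generated by φ(A). Then there exist a positive element h of the multiplier algebra 𝓜(C) with ‖h‖ = ‖φ‖ (the operator norm of φ) such that h commutes with the canonical image in 𝓜(C) of every element of C, and a star-homomorphism π : A → 𝓜(C) such that π(a) commutes with h and π(a)·h = h·π(a) = φ(a) (where φ(a) ∈ C is viewed in 𝓜(C) via the canonical embedding) for all a ∈ A. Moreover, if A is unital, then h equals the image of φ(1_A). -/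
open scoped MultiplierAlgebra

/-- The C*-subalgebra of `B` generated by the range of `φ`: the topological closure of the
non-unital star subalgebra generated by `φ(A)`. -/
noncomputable def generatedCStar {A B : Type*} [NonUnitalCStarAlgebra A]
    [NonUnitalCStarAlgebra B] (φ : A →L[ℂ] B) : NonUnitalStarSubalgebra ℂ B :=
  (NonUnitalStarAlgebra.adjoin ℂ (Set.range φ)).topologicalClosure

instance generatedCStar_isClosed {A B : Type*} [NonUnitalCStarAlgebra A]
    [NonUnitalCStarAlgebra B] (φ : A →L[ℂ] B) : IsClosed ((generatedCStar φ : Set B)) :=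
  NonUnitalStarSubalgebra.isClosed_topologicalClosure _

theorem mem_generatedCStar {A B : Type*} [NonUnitalCStarAlgebra A]
    [NonUnitalCStarAlgebra B] (φ : A →L[ℂ] B) (a : A) : φ a ∈ generatedCStar φ :=
  (NonUnitalStarAlgebra.adjoin ℂ (Set.range φ)).le_topologicalClosure
    (NonUnitalStarAlgebra.subset_adjoin ℂ _ ⟨a, rfl⟩)

/-- A bounded bilinear map on `C(X, ℝ)` vanishing on pairs with product zero is balanced at `1`,
for functions with values in the unit interval. -/
theorem ContinuousMap.bilin_one_comm_of_mem_Icc {X E : Type*} [TopologicalSpace X] [CompactSpace X]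
    [NormedAddCommGroup E] [NormedSpace ℝ E] (W : C(X, ℝ) →ₗ[ℝ] C(X, ℝ) →ₗ[ℝ] E) (K : ℝ)
    (hK : ∀ f g, ‖W f g‖ ≤ K * ‖f‖ * ‖g‖) (hW : ∀ f g : C(X, ℝ), f * g = 0 → W f g = 0)
    (f : C(X, ℝ)) (hf0 : ∀ x, 0 ≤ f x) (hf1 : ∀ x, f x ≤ 1) : W f 1 = W 1 f := by
  have hK0 : 0 ≤ K * ‖(1 : C(X, ℝ))‖ * ‖(1 : C(X, ℝ))‖ := (norm_nonneg _).trans (hK 1 1)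
  have key (m : ℕ) : (m : ℝ) * ‖W f 1 - W 1 f‖ ≤ 2 * |K| := by
    -- `c t` is the unit ramp starting at height `t` and `u t` is the tent centred at `t + 1`
    let y : C(X, ℝ) := (3 * m : ℝ) • f
    let c : ℝ → C(X, ℝ) := fun t ↦
      ⟨fun x ↦ min (y x) (t + 1) - min (y x) t, by fun_prop⟩
    let u : ℝ → C(X, ℝ) := fun t ↦ c t - c (t + 1)
    have hc_apply (t x) : c t x = min (y x) (t + 1) - min (y x) t := rfl
    have hc0 (t x) : 0 ≤ c t x := by rw [hc_apply]; grind
    have hc1 (t x) : c t x ≤ 1 := by rw [hc_apply]; grind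
    have hu_apply (t x) : u t x = c t x - c (t + 1) x := rfl
    have hu0 (t x) : 0 ≤ u t x := by rw [hu_apply, hc_apply, hc_apply]; grind
    have hcc {s t : ℝ} (hst : t + 1 ≤ s) (x) : c s x = 0 ∨ 1 - c t x = 0 := by
      rw [hc_apply, hc_apply]; grind
    have hcc' {s t : ℝ} (hst : t + 1 ≤ s) : c s * (1 - c t) = 0 := by
      ext x; simpa using hcc hst x
    have huu {s t : ℝ} (hst : s + 2 ≤ t ∨ t + 2 ≤ s) : u s * u t = 0 := by
      ext x
      simp only [ContinuousMap.mul_apply, hu_apply, ContinuousMap.zero_apply, mul_eq_zero, hc_apply]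
      grind
    have hsum : ∑ k ∈ Finset.range (3 * m), c k = y := by
      ext x
      have := Finset.sum_range_sub (fun k : ℕ ↦ min (y x) k) (3 * m)
      simp only [ContinuousMap.coe_sum, Finset.sum_apply, hc_apply]
      push_cast at this
      rw [this, min_eq_left, min_eq_right]
      · simp
      · exact mul_nonneg (by positivity) (hf0 x)
      · exact mul_le_of_le_one_right (by positivity) (hf1 x)
    have hnorm (s : ℝ) : ‖∑ i ∈ Finset.range m, u (3 * i + s)‖ ≤ 1 := by
      refine (ContinuousMap.norm_le _ zero_le_one).2 fun x ↦ ?_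
      rw [ContinuousMap.coe_sum, Finset.sum_apply, Real.norm_of_nonneg
        (Finset.sum_nonneg fun i _ ↦ hu0 _ x)]
      have h1 : ∀ i ∈ Finset.range m, u (3 * i + s) x ≤
          c (3 * i + s) x - c (3 * (i + 1 : ℕ) + s) x := fun i _ ↦ by
        have a1 := hu0 (3 * i + s + 1) x
        have a2 := hu0 (3 * i + s + 1 + 1) x
        have a3 : (3 * ((i + 1 : ℕ) : ℝ) + s) = 3 * i + s + 1 + 1 + 1 := by push_cast; ring
        rw [hu_apply] at *
        rw [a3]
        linarith
      refine (Finset.sum_le_sum h1).trans ?_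
      rw [Finset.sum_range_sub' (fun i : ℕ ↦ c (3 * i + s) x)]
      linarith [hc1 (3 * (0 : ℕ) + s) x, hc0 (3 * m + s) x]
    have hblock {s t : ℝ} (hst : |s - t| = 1) :
        ‖∑ i ∈ Finset.range m, W (u (3 * i + s)) (u (3 * i + t))‖ ≤ |K| := by
      have : ∑ i ∈ Finset.range m, W (u (3 * i + s)) (u (3 * i + t)) =
          W (∑ i ∈ Finset.range m, u (3 * i + s)) (∑ i ∈ Finset.range m, u (3 * i + t)) := by
        simp only [map_sum, LinearMap.sum_apply]
        refine Finset.sum_congr rfl fun i hi ↦ ?_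
        rw [Finset.sum_eq_single_of_mem i hi]
        intro j _ hj
        refine hW _ _ (huu ?_)
        rcases abs_cases (s - t) with ⟨h, _⟩ | ⟨h, _⟩ <;>
        rcases lt_or_gt_of_ne hj with hj | hj <;>
        · have hij := (Nat.cast_le (α := ℝ)).2 (Nat.succ_le_of_lt hj)
          push_cast at hij
          first | (left; linarith) | (right; linarith)
      rw [this]
      refine (hK _ _).trans ?_
      have a := hnorm s
      have b := hnorm t
      calc K * _ * _ ≤ |K| * 1 * 1 := by gcongr; exact le_abs_self K
        _ = |K| := by ring
    have hterm (t : ℝ) : W (c t) 1 - W 1 (c t) = W (u t) (u (t - 1)) - W (u (t - 1)) (u t) := by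
      have e1 : W (c (t + 1)) (1 - c t) = 0 := hW _ _ (hcc' (by linarith))
      have e2 : W (1 - c t) (c (t + 1)) = 0 := hW _ _ (by rw [mul_comm]; exact hcc' (by linarith))
      have e3 : W (c t) (1 - c (t - 1)) = 0 := hW _ _ (hcc' (by linarith))
      have e4 : W (1 - c (t - 1)) (c t) = 0 := hW _ _ (by rw [mul_comm]; exact hcc' (by linarith))
      have e5 : W (c (t + 1)) (1 - c (t - 1)) = 0 := hW _ _ (hcc' (by linarith))
      have e6 : W (1 - c (t - 1)) (c (t + 1)) = 0 :=
        hW _ _ (by rw [mul_comm]; exact hcc' (by linarith))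
      simp only [u, sub_add_cancel, map_sub, LinearMap.sub_apply] at *
      rw [sub_eq_zero] at e1 e2 e3 e4 e5 e6
      rw [e3, e4, ← e5, ← e6, e1, e2]
      abel
    have hthree (g : ℕ → E) (n : ℕ) : ∑ k ∈ Finset.range (3 * n), g k =
        ∑ i ∈ Finset.range n, g (3 * i) + ∑ i ∈ Finset.range n, g (3 * i + 1) +
          ∑ i ∈ Finset.range n, g (3 * i + 2) := by
      induction n with
      | zero => simp
      | succ n ih =>
        rw [show 3 * (n + 1) = 3 * n + 1 + 1 + 1 by ring]
        simp only [Finset.sum_range_succ, ih]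
        abel
    have htotal : (3 * m : ℝ) • (W f 1 - W 1 f) =
        ∑ k ∈ Finset.range (3 * m), (W (u k) (u (k - 1)) - W (u (k - 1)) (u k)) := by
      calc (3 * m : ℝ) • (W f 1 - W 1 f) = W y 1 - W 1 y := by simp [y, smul_sub]
        _ = ∑ k ∈ Finset.range (3 * m), (W (c k) 1 - W 1 (c k)) := by
          rw [← hsum]; simp [map_sum, LinearMap.sum_apply]
        _ = _ := Finset.sum_congr rfl fun k _ ↦ hterm k
    have hbound : ‖(3 * m : ℝ) • (W f 1 - W 1 f)‖ ≤ 6 * |K| := by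
      rw [htotal, hthree]
      simp only [Finset.sum_sub_distrib]
      push_cast
      have p0 := hblock (s := 0) (t := -1) (by norm_num)
      have p1 := hblock (s := 1) (t := 0) (by norm_num)
      have p2 := hblock (s := 2) (t := 1) (by norm_num)
      have q0 := hblock (s := -1) (t := 0) (by norm_num)
      have q1 := hblock (s := 0) (t := 1) (by norm_num)
      have q2 := hblock (s := 1) (t := 2) (by norm_num)
      simp only [add_zero, ← sub_eq_add_neg] at p0 p1 p2 q0 q1 q2
      simp only [add_sub_assoc, sub_self, add_zero, show (2 : ℝ) - 1 = 1 by norm_num]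
      refine (norm_add_le_of_le (norm_add_le_of_le (norm_sub_le_of_le p0 q0)
        (norm_sub_le_of_le p1 q1)) (norm_sub_le_of_le p2 q2)).trans (by linarith)
    rw [norm_smul, Real.norm_of_nonneg (by positivity)] at hbound
    linarith
  by_contra hne
  have hpos : 0 < ‖W f 1 - W 1 f‖ := norm_pos_iff.2 (sub_ne_zero.2 hne)
  obtain ⟨m, hm⟩ := exists_nat_gt (2 * |K| / ‖W f 1 - W 1 f‖)
  rw [div_lt_iff₀ hpos] at hm
  exact absurd (key m) (not_le.2 hm)

/-- A bounded bilinear map on `C(X, ℝ)` vanishing on pairs with product zero is balanced at `1`. -/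
theorem ContinuousMap.bilin_one_comm {X E : Type*} [TopologicalSpace X] [CompactSpace X]
    [NormedAddCommGroup E] [NormedSpace ℝ E] (W : C(X, ℝ) →ₗ[ℝ] C(X, ℝ) →ₗ[ℝ] E) (K : ℝ)
    (hK : ∀ f g, ‖W f g‖ ≤ K * ‖f‖ * ‖g‖) (hW : ∀ f g : C(X, ℝ), f * g = 0 → W f g = 0)
    (f : C(X, ℝ)) : W f 1 = W 1 f := by
  set R : ℝ := ‖f‖ + 1
  have hR : 0 < R := by positivity
  let g : C(X, ℝ) := (2 * R)⁻¹ • (f + R • 1)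
  have hfx (x) : |f x| ≤ R := (f.norm_coe_le_norm x).trans (by simp [R])
  have hg : W g 1 = W 1 g := by
    refine ContinuousMap.bilin_one_comm_of_mem_Icc W K hK hW g (fun x ↦ ?_) (fun x ↦ ?_)
    · have := abs_le.1 (hfx x)
      have h : 0 ≤ f x + R := by linarith
      exact mul_nonneg (by positivity : 0 ≤ (2 * R)⁻¹) (by simpa using h)
    · have := abs_le.1 (hfx x)
      have h : (2 * R)⁻¹ * (f x + R) ≤ 1 := by
        rw [inv_mul_le_iff₀ (by positivity)]; linarith
      simpa [g, mul_add] using h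
  have hf : f = (2 * R) • g - R • 1 := by
    rw [smul_smul, mul_inv_cancel₀ (by positivity), one_smul, add_sub_cancel_right]
  rw [hf]
  simp [hg]

/-- If bounded linear maps `F, G` on a unital C⋆-algebra satisfy `F x * G y = 0` whenever
`x * y = 0`, then `F x * G 1 = F 1 * G x`. -/
theorem CStarAlgebra.map_mul_map_one_comm {U B : Type*} [CStarAlgebra U] [NonUnitalCStarAlgebra B]
    (F G : U →L[ℂ] B) (hFG : ∀ x y : U, x * y = 0 → F x * G y = 0) (x : U) :
    F x * G 1 = F 1 * G x := by
  have hsa (b : U) (hb : IsSelfAdjoint b) : F b * G 1 = F 1 * G b := by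
    let Ψ : C(spectrum ℝ b, ℝ) →ₗ[ℝ] U := (cfcHom hb (R := ℝ)).toAlgHom.toLinearMap
    let F' : C(spectrum ℝ b, ℝ) →ₗ[ℝ] B := (F.restrictScalars ℝ).toLinearMap ∘ₗ Ψ
    let G' : C(spectrum ℝ b, ℝ) →ₗ[ℝ] B := (G.restrictScalars ℝ).toLinearMap ∘ₗ Ψ
    let W := (LinearMap.mul ℝ B).compl₁₂ F' G'
    have hΨ (f) : Ψ f = cfcHom hb (R := ℝ) f := rfl
    have hWa (f g) : W f g = F (Ψ f) * G (Ψ g) := rfl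
    have hΨn (f) : ‖Ψ f‖ ≤ ‖f‖ := by exact (norm_cfcHom (𝕜 := ℝ) b f hb).le
    have := ContinuousMap.bilin_one_comm W (‖F‖ * ‖G‖) (fun f g ↦ ?_) (fun f g hfg ↦ ?_)
      (.restrict (spectrum ℝ b) (.id ℝ))
    · simpa [hWa, hΨ, cfcHom_id hb] using this
    · rw [hWa]
      calc _ ≤ (‖F‖ * ‖Ψ f‖) * (‖G‖ * ‖Ψ g‖) :=
            norm_mul_le_of_le (F.le_opNorm _) (G.le_opNorm _)
        _ ≤ (‖F‖ * ‖f‖) * (‖G‖ * ‖g‖) := by gcongr <;> exact hΨn _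
        _ = _ := by ring
    · rw [hWa]
      exact hFG _ _ (by rw [hΨ, hΨ, ← map_mul, hfg, map_zero])
  rw [← realPart_add_I_smul_imaginaryPart x]
  simp only [map_add, map_smul, add_mul, mul_add, smul_mul_assoc, mul_smul_comm]
  rw [hsa _ (realPart x).2, hsa _ (imaginaryPart x).2]

/-- The left action of the unitization of `A` on `A`. -/
def Unitization.actLeft {A : Type*} [NonUnitalCStarAlgebra A] (x : Unitization ℂ A) :
    A →ₗ[ℂ] A :=
  x.fst • LinearMap.id + LinearMap.mulLeft ℂ x.snd

/-- The right action of the unitization of `A` on `A`. -/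
def Unitization.actRight {A : Type*} [NonUnitalCStarAlgebra A] (x : Unitization ℂ A) :
    A →ₗ[ℂ] A :=
  x.fst • LinearMap.id + LinearMap.mulRight ℂ x.snd

theorem Unitization.actLeft_apply {A : Type*} [NonUnitalCStarAlgebra A] (x : Unitization ℂ A)
    (b : A) : x.actLeft b = x.fst • b + x.snd * b :=
  rfl

theorem Unitization.actRight_apply {A : Type*} [NonUnitalCStarAlgebra A] (x : Unitization ℂ A)
    (b : A) : x.actRight b = x.fst • b + b * x.snd :=
  rfl

theorem Unitization.inr_actLeft {A : Type*} [NonUnitalCStarAlgebra A] (x : Unitization ℂ A)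
    (b : A) : (x.actLeft b : Unitization ℂ A) = x * b := by
  ext <;> simp [actLeft_apply]

theorem Unitization.inr_actRight {A : Type*} [NonUnitalCStarAlgebra A] (x : Unitization ℂ A)
    (b : A) : (x.actRight b : Unitization ℂ A) = b * x := by
  ext <;> simp [actRight_apply]

theorem Unitization.actLeft_mul {A : Type*} [NonUnitalCStarAlgebra A] (x y : Unitization ℂ A)
    (b : A) : (x * y).actLeft b = x.actLeft (y.actLeft b) :=
  Unitization.inr_injective (R := ℂ) (by simp only [inr_actLeft, mul_assoc])

theorem Unitization.actLeft_inr {A : Type*} [NonUnitalCStarAlgebra A] (a b : A) :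
    (a : Unitization ℂ A).actLeft b = a * b := by
  simp [actLeft_apply]

theorem Unitization.star_actLeft {A : Type*} [NonUnitalCStarAlgebra A] (x : Unitization ℂ A)
    (b : A) : star (x.actLeft b) = (star x).actRight (star b) := by
  simp [actLeft_apply, actRight_apply]

section CompletelyPositive

variable {A B : Type*}
  [NonUnitalCStarAlgebra A] [PartialOrder A] [StarOrderedRing A]
  [NonUnitalCStarAlgebra B] [PartialOrder B] [StarOrderedRing B]
  {φ : A →L[ℂ] B}

theorem map_nonneg_of_cp
    (hcp : ∀ (n : ℕ) (m : Matrix (Fin n) (Fin n) A),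
      (∃ x : Matrix (Fin n) (Fin n) A, m = star x * x) →
      ∃ y : Matrix (Fin n) (Fin n) B, m.map φ = star y * y)
    (a : A) (ha : 0 ≤ a) : 0 ≤ φ a := by
  obtain ⟨b, rfl⟩ := CStarAlgebra.nonneg_iff_eq_star_mul_self.1 ha
  obtain ⟨y, hy⟩ := hcp 1 _ ⟨!![b], rfl⟩
  have := congrFun₂ hy 0 0
  simp [Matrix.mul_apply, Matrix.star_apply] at this
  rw [this]
  exact star_mul_self_nonneg _

theorem map_star_of_nonneg (hpos : ∀ a, 0 ≤ a → 0 ≤ φ a) (a : A) :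
    φ (star a) = star (φ a) :=
  map_star (PositiveLinearMap.mk₀ φ.toLinearMap hpos) a

theorem map_mul_eq_zero_of_cp
    (hcp : ∀ (n : ℕ) (m : Matrix (Fin n) (Fin n) A),
      (∃ x : Matrix (Fin n) (Fin n) A, m = star x * x) →
      ∃ y : Matrix (Fin n) (Fin n) B, m.map φ = star y * y)
    {a : A} {c : B} (hac : φ (star a * a) * c = 0) : φ a * c = 0 := by
  have key (e : A) : φ (e * a) * c = 0 := by
    obtain ⟨y, hy⟩ := hcp 2 _ ⟨!![a, star e; 0, 0], rfl⟩
    have h00 := congrFun₂ hy 0 0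
    have h10 := congrFun₂ hy 1 0
    simp [Matrix.mul_apply, Matrix.star_apply, Fin.sum_univ_two] at h00 h10
    have hsum : star (y 0 0 * c) * (y 0 0 * c) + star (y 1 0 * c) * (y 1 0 * c) = 0 := by
      have : star c * (φ (star a * a) * c) = 0 := by rw [hac, mul_zero]
      rw [h00] at this
      simpa [add_mul, mul_add, mul_assoc] using this
    obtain ⟨h0, h1⟩ := (add_eq_zero_iff_of_nonneg (star_mul_self_nonneg _)
      (star_mul_self_nonneg _)).1 hsum
    rw [CStarRing.star_mul_self_eq_zero_iff] at h0 h1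
    rw [h10, add_mul, mul_assoc, mul_assoc, h0, h1]
    simp
  have hlim := ((CStarAlgebra.increasingApproximateUnit A).tendsto_mul_right a)
  have hlim' := ((φ.continuous.tendsto a).comp hlim).mul_const c
  simp only [Function.comp_def, key] at hlim'
  exact tendsto_nhds_unique hlim' tendsto_const_nhds

/-- A completely positive order zero map preserves arbitrary zero products. -/
theorem map_mul_map_eq_zero_of_orderZero
    (hcp : ∀ (n : ℕ) (m : Matrix (Fin n) (Fin n) A),
      (∃ x : Matrix (Fin n) (Fin n) A, m = star x * x) →
      ∃ y : Matrix (Fin n) (Fin n) B, m.map φ = star y * y)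
    (hoz : ∀ a b : A, 0 ≤ a → 0 ≤ b → a * b = 0 → φ a * φ b = 0)
    {a b : A} (hab : a * b = 0) : φ a * φ b = 0 := by
  have hstar := map_star_of_nonneg (map_nonneg_of_cp hcp)
  have h1 : φ (star a * a) * φ (star (star b) * star b) = 0 := by
    refine hoz _ _ (star_mul_self_nonneg _) (star_mul_self_nonneg _) ?_
    rw [star_star, mul_assoc, ← mul_assoc a, hab, zero_mul, mul_zero]
  have h2 := congrArg star (map_mul_eq_zero_of_cp hcp h1)
  rw [star_mul, star_zero, ← hstar, star_mul, star_star] at h2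
  have h3 := congrArg star (map_mul_eq_zero_of_cp hcp (a := star b) (by simpa using h2))
  simpa [hstar] using h3

/-- A completely positive order zero map satisfies `φ (b x) φ (c) = φ (b) φ (x c)` for every `x`
in the unitization of its domain. -/
theorem map_actRight_mul_map_of_orderZero
    (hcp : ∀ (n : ℕ) (m : Matrix (Fin n) (Fin n) A),
      (∃ x : Matrix (Fin n) (Fin n) A, m = star x * x) →
      ∃ y : Matrix (Fin n) (Fin n) B, m.map φ = star y * y)
    (hoz : ∀ a b : A, 0 ≤ a → 0 ≤ b → a * b = 0 → φ a * φ b = 0)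
    (x : Unitization ℂ A) (b c : A) : φ (x.actRight b) * φ c = φ b * φ (x.actLeft c) := by
  let R : Unitization ℂ A →L[ℂ] A :=
    { toFun := fun x ↦ x.actRight b
      map_add' := fun x y ↦ by simp [Unitization.actRight_apply, add_smul, mul_add]; abel
      map_smul' := fun r x ↦ by simp [Unitization.actRight_apply, mul_smul, mul_smul_comm r]
      cont := by simp only [Unitization.actRight_apply]; fun_prop }
  let L : Unitization ℂ A →L[ℂ] A :=
    { toFun := fun x ↦ x.actLeft c
      map_add' := fun x y ↦ by simp [Unitization.actLeft_apply, add_smul, add_mul]; abel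
      map_smul' := fun r x ↦ by simp [Unitization.actLeft_apply, mul_smul, smul_mul_assoc r]
      cont := by simp only [Unitization.actLeft_apply]; fun_prop }
  have := CStarAlgebra.map_mul_map_one_comm (φ ∘L R) (φ ∘L L) (fun x y hxy ↦ ?_) x
  · simpa [R, L, Unitization.actLeft_apply, Unitization.actRight_apply] using this
  · refine map_mul_map_eq_zero_of_orderZero hcp hoz (Unitization.inr_injective (R := ℂ) ?_)
    simp only [R, L, LinearMap.coe_mk, AddHom.coe_mk,
      Unitization.inr_mul, Unitization.inr_actLeft, Unitization.inr_actRight]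
    rw [mul_assoc, ← mul_assoc x, hxy, zero_mul, mul_zero, Unitization.inr_zero]

end CompletelyPositive

namespace DoubleCentralizer

/-- Two multipliers of a C⋆-algebra agree as soon as their left actions do. -/
theorem ext_of_fst {C : Type*} [NonUnitalCStarAlgebra C] {m n : 𝓜(ℂ, C)}
    (h : m.fst = n.fst) : m = n := by
  rw [← sub_eq_zero, ← norm_eq_zero, ← norm_fst, sub_fst, h, sub_self, norm_zero]

/-- A densely defined bounded adjointable operator on a C⋆-algebra extends to a multiplier. -/
theorem exists_of_adjointable {C D : Type*} [NonUnitalCStarAlgebra C] [AddCommGroup D] [Module ℂ D]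
    {e f g : D →ₗ[ℂ] C} (he : DenseRange e) {K : ℝ} (hK : 0 ≤ K)
    (hf : ∀ z, ‖f z‖ ≤ K * ‖e z‖) (hg : ∀ z, ‖g z‖ ≤ K * ‖e z‖)
    (hfg : ∀ w z, star (e w) * f z = star (g w) * e z) :
    ∃ m : 𝓜(ℂ, C), (∀ z, m.fst (e z) = f z) ∧ (∀ z, (star m).fst (e z) = g z) ∧ ‖m‖ ≤ K := by
  let L := f.extendOfNorm e
  let L' := g.extendOfNorm e
  have hL (z) : L (e z) = f z := LinearMap.extendOfNorm_eq he ⟨K, hf⟩ z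
  have hL' (z) : L' (e z) = g z := LinearMap.extendOfNorm_eq he ⟨K, hg⟩ z
  have hLL' (x y : C) : star x * L y = star (L' x) * y := by
    refine he.induction_on₂ (p := fun x y ↦ star x * L y = star (L' x) * y)
      (isClosed_eq (by fun_prop) (by fun_prop)) (fun w z ↦ ?_) x y
    rw [hL, hL', hfg]
  let R : C →L[ℂ] C :=
    { toFun := fun x ↦ star (L' (star x))
      map_add' := fun x y ↦ by simp
      map_smul' := fun r x ↦ by simp
      cont := by fun_prop }
  refine ⟨⟨(L, R), fun x y ↦ ?_⟩, hL, fun z ↦ ?_, ?_⟩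
  · have := (hLL' (star x) y).symm
    rwa [star_star] at this
  · rw [star_fst]
    simp [R, hL']
  · rw [← norm_fst]
    exact LinearMap.opNorm_extendOfNorm_le he hK hf

/-- A self-adjoint multiplier `m` whose compressions `x⋆ m x` are never nonzero and negative
is positive. -/
theorem exists_eq_star_mul_self {C : Type*} [NonUnitalCStarAlgebra C] {m : 𝓜(ℂ, C)}
    (hm : IsSelfAdjoint m) (hpos : ∀ x w : C, star x * m.fst x = -(star w * w) → w = 0) :
    ∃ s : 𝓜(ℂ, C), m = star s * s := by
  let := CStarAlgebra.spectralOrder 𝓜(ℂ, C)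
  have := CStarAlgebra.spectralOrderedRing 𝓜(ℂ, C)
  obtain ⟨q, hq⟩ := CStarAlgebra.nonneg_iff_eq_star_mul_self.1 (CFC.negPart_nonneg m)
  have hsa : star m⁻ = m⁻ := (CFC.negPart_nonneg m).isSelfAdjoint
  have hcomp : star m⁻ * m * m⁻ = -(star (q * m⁻) * (q * m⁻)) := by
    nth_rw 2 [← CFC.posPart_sub_negPart m hm]
    rw [hsa, star_mul, hsa, mul_sub, CFC.negPart_mul_posPart, zero_sub, neg_mul, mul_assoc,
      mul_assoc, ← mul_assoc (star q), ← hq]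
  have hzero : q * m⁻ = 0 := by
    refine ext_of_fst (ContinuousLinearMap.ext fun x ↦ hpos ((m⁻).fst x) _ ?_)
    have hadj (n : 𝓜(ℂ, C)) (y z : C) : star (n.fst y) * z = star y * (star n).fst z := by
      rw [← central, star_snd, star_star]
    rw [hadj, hadj, ← mul_neg]
    have := congrArg (fun n : 𝓜(ℂ, C) ↦ star x * n.fst x) hcomp
    simpa only [mul_fst, neg_fst, mul_apply_eq_comp, neg_apply] using this
  have hneg : m⁻ = 0 := by
    rw [← CStarRing.star_mul_self_eq_zero_iff, hsa]
    nth_rw 1 [hq]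
    rw [mul_assoc, hzero, mul_zero]
  refine CStarAlgebra.nonneg_iff_eq_star_mul_self.1 ?_
  rw [← CFC.posPart_sub_negPart m hm, hneg, sub_zero]
  exact CFC.posPart_nonneg m

end DoubleCentralizer

section Balanced

open Filter
open scoped TensorProduct Topology

variable {A C : Type*} [NonUnitalCStarAlgebra A] [NonUnitalCStarAlgebra C]

/-- The linear map `a ⊗ x ↦ ψ a * x`. -/
noncomputable def mapMul (ψ : A →L[ℂ] C) : A ⊗[ℂ] C →ₗ[ℂ] C :=
  TensorProduct.lift (LinearMap.mul ℂ C ∘ₗ ψ.toLinearMap)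

@[simp]
theorem mapMul_tmul (ψ : A →L[ℂ] C) (a : A) (x : C) : mapMul ψ (a ⊗ₜ x) = ψ a * x :=
  rfl

/-- The linear map `(a ⊗ b) ⊗ x ↦ ψ a * ψ b * x`. -/
noncomputable def mapMulMapMul (ψ : A →L[ℂ] C) : (A ⊗[ℂ] A) ⊗[ℂ] C →ₗ[ℂ] C :=
  TensorProduct.lift (LinearMap.mul ℂ C ∘ₗ
    TensorProduct.lift ((LinearMap.mul ℂ C).compl₁₂ ψ.toLinearMap ψ.toLinearMap))

@[simp]
theorem mapMulMapMul_tmul (ψ : A →L[ℂ] C) (a b : A) (x : C) :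
    mapMulMapMul ψ ((a ⊗ₜ b) ⊗ₜ x) = ψ a * ψ b * x :=
  rfl

variable {ψ : A →L[ℂ] C}

theorem generated_induction (hstar : ∀ a, ψ (star a) = star (ψ a))
    (hgen : (NonUnitalStarAlgebra.adjoin ℂ (Set.range ψ)).topologicalClosure = ⊤)
    {P : C → Prop} (hclosed : IsClosed {x | P x}) (hmem : ∀ a, P (ψ a)) (hzero : P 0)
    (hadd : ∀ x y, P x → P y → P (x + y)) (hsmul : ∀ (r : ℂ) x, P x → P (r • x))
    (hmul : ∀ x y, P x → P y → P (x * y)) (x : C) : P x := by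
  have hsub : (NonUnitalStarAlgebra.adjoin ℂ (Set.range ψ) : Set C) ⊆ {x | P x} := by
    intro y hy
    change y ∈ NonUnitalAlgebra.adjoin ℂ (Set.range ψ ∪ star (Set.range ψ)) at hy
    induction hy using NonUnitalAlgebra.adjoin_induction with
    | mem y hy =>
      rcases hy with ⟨a, rfl⟩ | ⟨a, ha⟩
      · exact hmem a
      · rw [← star_star y, ← ha, ← hstar]
        exact hmem _
    | add x y _ _ hx hy => exact hadd x y hx hy
    | zero => exact hzero
    | mul x y _ _ hx hy => exact hmul x y hx hy
    | smul r x _ hx => exact hsmul r x hx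
  have hx : x ∈ (NonUnitalStarAlgebra.adjoin ℂ (Set.range ψ)).topologicalClosure :=
    hgen ▸ NonUnitalStarAlgebra.mem_top
  exact closure_minimal hsub hclosed hx

theorem denseRange_mapMul (hstar : ∀ a, ψ (star a) = star (ψ a))
    (hgen : (NonUnitalStarAlgebra.adjoin ℂ (Set.range ψ)).topologicalClosure = ⊤) :
    DenseRange (mapMul ψ) := by
  let := CStarAlgebra.spectralOrder C
  have := CStarAlgebra.spectralOrderedRing C
  let M := (LinearMap.range (mapMul ψ)).topologicalClosure
  have hM : ∀ x, x ∈ M → ∀ y, x * y ∈ M := fun x hx y ↦ by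
    refine map_mem_closure (f := fun x ↦ x * y) (by fun_prop) hx ?_
    rintro _ ⟨z, rfl⟩
    induction z with
    | zero => simp
    | add z w hz hw =>
      simp only [map_add, add_mul]
      exact add_mem hz hw
    | tmul a c => exact ⟨a ⊗ₜ (c * y), by simp [mul_assoc]⟩
  intro x
  refine generated_induction (P := fun x ↦ x ∈ M) hstar hgen
    (Submodule.isClosed_topologicalClosure _) (fun a ↦ ?_) (zero_mem _)
    (fun x y ↦ add_mem) (fun r x ↦ Submodule.smul_mem _ r) (fun x y hx _ ↦ hM x hx y) x
  exact mem_closure_of_tendsto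
    ((CStarAlgebra.increasingApproximateUnit C).tendsto_mul_left (ψ a))
    (Eventually.of_forall fun u ↦ ⟨a ⊗ₜ u, rfl⟩)

theorem denseRange_mapMul_mul (hstar : ∀ a, ψ (star a) = star (ψ a))
    (hgen : (NonUnitalStarAlgebra.adjoin ℂ (Set.range ψ)).topologicalClosure = ⊤) :
    DenseRange (mapMul ψ ∘ₗ (LinearMap.mul' ℂ A).rTensor C) := by
  let := CStarAlgebra.spectralOrder A
  have := CStarAlgebra.spectralOrderedRing A
  let M := (LinearMap.range (mapMul ψ ∘ₗ (LinearMap.mul' ℂ A).rTensor C)).topologicalClosure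
  have hM : ∀ z, mapMul ψ z ∈ M := fun z ↦ by
    induction z with
    | zero => simp
    | add z w hz hw =>
      rw [map_add]
      exact add_mem hz hw
    | tmul a c =>
      have h := (CStarAlgebra.increasingApproximateUnit A).tendsto_mul_right a
      exact mem_closure_of_tendsto (((ψ.continuous.tendsto a).comp h).mul_const c)
        (Eventually.of_forall fun u ↦ ⟨(u ⊗ₜ a) ⊗ₜ c, by simp⟩)
  intro x
  exact closure_minimal (Set.range_subset_iff.2 hM) (Submodule.isClosed_topologicalClosure _)
    (denseRange_mapMul hstar hgen x)

theorem clm_ext_map_mul (hstar : ∀ a, ψ (star a) = star (ψ a))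
    (hgen : (NonUnitalStarAlgebra.adjoin ℂ (Set.range ψ)).topologicalClosure = ⊤)
    {L L' : C →L[ℂ] C} (h : ∀ a x, L (ψ a * x) = L' (ψ a * x)) : L = L' := by
  refine DFunLike.coe_injective
    ((denseRange_mapMul hstar hgen).equalizer L.continuous L'.continuous (funext fun z ↦ ?_))
  induction z with
  | zero => simp
  | add z w hz hw => simp_all
  | tmul a c => exact h a c

theorem clm_ext_map_mul_mul (hstar : ∀ a, ψ (star a) = star (ψ a))
    (hgen : (NonUnitalStarAlgebra.adjoin ℂ (Set.range ψ)).topologicalClosure = ⊤)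
    {L L' : C →L[ℂ] C} (h : ∀ a b x, L (ψ (a * b) * x) = L' (ψ (a * b) * x)) : L = L' := by
  refine DFunLike.coe_injective
    ((denseRange_mapMul_mul hstar hgen).equalizer L.continuous L'.continuous (funext fun z ↦ ?_))
  induction z with
  | zero => simp
  | add z w hz hw => simp_all
  | tmul t c =>
    induction t with
    | zero => simp
    | add z w hz hw => simp_all [TensorProduct.add_tmul]
    | tmul a b => exact h a b c

section Multiplier

variable (hstar : ∀ a, ψ (star a) = star (ψ a))
  (hgen : (NonUnitalStarAlgebra.adjoin ℂ (Set.range ψ)).topologicalClosure = ⊤)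
  (hbal : ∀ (x : Unitization ℂ A) (b c : A), ψ (x.actRight b) * ψ c = ψ b * ψ (x.actLeft c))
include hstar hbal

theorem star_mapMul_actLeft_mul (x : Unitization ℂ A) (z w : A ⊗[ℂ] C) :
    star (mapMul ψ (x.actLeft.rTensor C z)) * mapMul ψ w =
      star (mapMul ψ z) * mapMul ψ ((star x).actLeft.rTensor C w) := by
  induction z with
  | zero => simp
  | add z z' hz hz' => simp only [map_add, star_add, add_mul, hz, hz']
  | tmul a c =>
    induction w with
    | zero => simp
    | add w w' hw hw' => simp only [map_add, mul_add, hw, hw']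
    | tmul b d =>
      simp only [LinearMap.rTensor_tmul, mapMul_tmul, star_mul, ← hstar, Unitization.star_actLeft]
      rw [mul_assoc, ← mul_assoc _ _ d, hbal, mul_assoc, mul_assoc]

theorem norm_mapMul_actLeft_le (x : Unitization ℂ A) (z : A ⊗[ℂ] C) :
    ‖mapMul ψ (x.actLeft.rTensor C z)‖ ≤ ‖x‖ * ‖mapMul ψ z‖ := by
  let := CStarAlgebra.spectralOrder C
  have := CStarAlgebra.spectralOrderedRing C
  let := CStarAlgebra.spectralOrder (Unitization ℂ A)
  have := CStarAlgebra.spectralOrderedRing (Unitization ℂ A)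
  obtain ⟨d, hd⟩ := CStarAlgebra.nonneg_iff_eq_star_mul_self.1
    (sub_nonneg.2 (CStarAlgebra.star_mul_le_algebraMap_norm_sq (a := x)))
  have hsq (y : Unitization ℂ A) : star (mapMul ψ (y.actLeft.rTensor C z)) *
      mapMul ψ (y.actLeft.rTensor C z) =
        star (mapMul ψ z) * mapMul ψ ((star y * y).actLeft.rTensor C z) := by
    rw [star_mapMul_actLeft_mul hstar hbal]
    have : (star y * y).actLeft = (star y).actLeft ∘ₗ y.actLeft :=
      LinearMap.ext fun b ↦ Unitization.actLeft_mul _ _ b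
    rw [this, LinearMap.rTensor_comp, LinearMap.comp_apply]
  have hadd : (star d * d).actLeft + (star x * x).actLeft =
      ((‖x‖ ^ 2 : ℝ) : ℂ) • LinearMap.id := by
    ext b
    refine Unitization.inr_injective (R := ℂ) ?_
    rw [LinearMap.add_apply, Unitization.inr_add, Unitization.inr_actLeft, Unitization.inr_actLeft,
      ← add_mul, ← hd, sub_add_cancel, Algebra.algebraMap_eq_smul_one, smul_one_mul,
      LinearMap.smul_apply, LinearMap.id_apply, Unitization.inr_smul, Complex.coe_smul]
  have hsum : star (mapMul ψ (d.actLeft.rTensor C z)) * mapMul ψ (d.actLeft.rTensor C z) +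
      star (mapMul ψ (x.actLeft.rTensor C z)) * mapMul ψ (x.actLeft.rTensor C z) =
        ((‖x‖ ^ 2 : ℝ) : ℂ) • (star (mapMul ψ z) * mapMul ψ z) := by
    rw [hsq, hsq, ← mul_add, ← map_add, ← LinearMap.add_apply, ← LinearMap.rTensor_add, hadd,
      LinearMap.rTensor_smul, LinearMap.rTensor_id, LinearMap.smul_apply, LinearMap.id_apply,
      map_smul, mul_smul_comm]
  have hle := CStarAlgebra.norm_le_norm_of_nonneg_of_le (star_mul_self_nonneg _)
    (le_add_of_nonneg_left (star_mul_self_nonneg (mapMul ψ (d.actLeft.rTensor C z))) :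
      star (mapMul ψ (x.actLeft.rTensor C z)) * mapMul ψ (x.actLeft.rTensor C z) ≤ _)
  rw [hsum, norm_smul, CStarRing.norm_star_mul_self, CStarRing.norm_star_mul_self,
    Complex.norm_real, Real.norm_of_nonneg (by positivity)] at hle
  refine abs_le_of_sq_le_sq' ?_ (by positivity) |>.2
  nlinarith

include hgen

theorem exists_multiplier_actLeft (x : Unitization ℂ A) :
    ∃ m : 𝓜(ℂ, C), (∀ a c, m.fst (ψ a * c) = ψ (x.actLeft a) * c) ∧
      (∀ a c, (star m).fst (ψ a * c) = ψ ((star x).actLeft a) * c) ∧ ‖m‖ ≤ ‖x‖ := by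
  obtain ⟨m, h1, h2, h3⟩ := DoubleCentralizer.exists_of_adjointable
    (denseRange_mapMul hstar hgen) (norm_nonneg x)
    (f := mapMul ψ ∘ₗ x.actLeft.rTensor C) (g := mapMul ψ ∘ₗ (star x).actLeft.rTensor C)
    (norm_mapMul_actLeft_le hstar hbal x)
    (fun z ↦ (norm_mapMul_actLeft_le hstar hbal (star x) z).trans_eq (by rw [norm_star]))
    (fun w z ↦ by
      simpa using (star_mapMul_actLeft_mul hstar hbal (star x) w z).symm)
  exact ⟨m, fun a c ↦ h1 (a ⊗ₜ c), fun a c ↦ h2 (a ⊗ₜ c), h3⟩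

/-- The representation by multipliers `π a (ψ b * c) = ψ (a * b) * c`. -/
theorem exists_starHom_multiplier :
    ∃ π : A →⋆ₙₐ[ℂ] 𝓜(ℂ, C), (∀ a b c, (π a).fst (ψ b * c) = ψ (a * b) * c) ∧
      ∀ a, ‖π a‖ ≤ ‖a‖ := by
  choose p hp hp' hpn using fun a : A ↦ exists_multiplier_actLeft hstar hgen hbal a
  simp only [← Unitization.inr_star, Unitization.actLeft_inr] at hp hp'
  have hext {m n : 𝓜(ℂ, C)} (h : ∀ a c, m.fst (ψ a * c) = n.fst (ψ a * c)) : m = n :=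
    DoubleCentralizer.ext_of_fst (clm_ext_map_mul hstar hgen h)
  refine ⟨{ toFun := p, map_smul' := fun r a ↦ hext fun b c ↦ ?_, map_zero' := hext fun b c ↦ ?_,
            map_add' := fun a a' ↦ hext fun b c ↦ ?_, map_mul' := fun a a' ↦ hext fun b c ↦ ?_,
            map_star' := fun a ↦ hext fun b c ↦ ?_ }, hp, fun a ↦ ?_⟩
  · simp [hp, smul_mul_assoc]
  · simp [hp]
  · simp [hp, add_mul]
  · simp [hp, mul_assoc]
  · simp [hp, hp']
  · simpa [Unitization.norm_inr] using hpn a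

/-- The positive multiplier `h (ψ (a * b) * c) = ψ a * ψ b * c`. -/
theorem exists_pos_multiplier [PartialOrder A] [StarOrderedRing A] [PartialOrder C]
    [StarOrderedRing C] (hpos : ∀ a, 0 ≤ a → 0 ≤ ψ a) :
    ∃ h : 𝓜(ℂ, C), (∀ a b c, h.fst (ψ (a * b) * c) = ψ a * ψ b * c) ∧ ‖h‖ ≤ ‖ψ‖ ∧
      ∃ s : 𝓜(ℂ, C), h = star s * s := by
  have hau := CStarAlgebra.increasingApproximateUnit A
  have := hau.neBot
  set e := mapMul ψ ∘ₗ (LinearMap.mul' ℂ A).rTensor C with he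
  have hlim (z) : Tendsto (fun u ↦ ψ u * e z) (CStarAlgebra.approximateUnit A)
      (𝓝 (mapMulMapMul ψ z)) := by
    induction z with
    | zero => simp
    | add z w hz hw => simpa [mul_add] using hz.add hw
    | tmul t c =>
      induction t with
      | zero => simp
      | add z w hz hw => simpa [mul_add, TensorProduct.add_tmul] using hz.add hw
      | tmul a b =>
        have h1 := ((ψ.continuous.tendsto a).comp (hau.tendsto_mul_right a)).mul_const (ψ b * c)
        simp only [mapMulMapMul_tmul, mul_assoc]
        refine h1.congr fun u ↦ ?_
        have := hbal a u b
        rw [Unitization.actLeft_inr, show (a : Unitization ℂ A).actRight u = u * a by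
          simp [Unitization.actRight_apply]] at this
        simp [e, ← mul_assoc, this]
  have hbd (z) : ‖mapMulMapMul ψ z‖ ≤ ‖ψ‖ * ‖e z‖ := by
    refine le_of_tendsto (hlim z).norm (hau.eventually_norm.mono fun u hu ↦ ?_)
    refine norm_mul_le_of_le ?_ le_rfl
    exact (ψ.le_opNorm u).trans (mul_le_of_le_one_right (norm_nonneg _) hu)
  have hadj (w z) : star (e w) * mapMulMapMul ψ z = star (mapMulMapMul ψ w) * e z := by
    refine tendsto_nhds_unique ((hlim z).const_mul (star (e w)))
      (((hlim w).star.mul_const (e z)).congr' ?_)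
    filter_upwards [hau.eventually_star_eq] with u hu
    rw [star_mul, ← hstar, hu, mul_assoc]
  obtain ⟨h, h1, h2, h3⟩ := DoubleCentralizer.exists_of_adjointable
    (denseRange_mapMul_mul hstar hgen) (norm_nonneg ψ) hbd hbd hadj
  have h4 (a b c) : h.fst (ψ (a * b) * c) = ψ a * ψ b * c := h1 ((a ⊗ₜ b) ⊗ₜ c)
  have hsa : IsSelfAdjoint h := DoubleCentralizer.ext_of_fst <|
    clm_ext_map_mul_mul hstar hgen fun a b c ↦
      (h2 ((a ⊗ₜ b) ⊗ₜ c)).trans (h1 ((a ⊗ₜ b) ⊗ₜ c)).symm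
  have hquad (x : C) : 0 ≤ star x * h.fst x := by
    refine (denseRange_mapMul_mul hstar hgen).induction_on
      (p := fun x ↦ 0 ≤ star x * h.fst x) x (isClosed_le (by fun_prop) (by fun_prop)) fun z ↦ ?_
    rw [h1]
    refine ge_of_tendsto ((hlim z).const_mul _) (hau.eventually_nonneg.mono fun u hu ↦ ?_)
    rw [← mul_assoc]
    exact star_left_conjugate_nonneg (hpos u hu) _
  refine ⟨h, h4, h3, DoubleCentralizer.exists_eq_star_mul_self hsa fun x w hw ↦ ?_⟩
  have h5 := hquad x
  rw [hw, neg_nonneg] at h5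
  exact CStarRing.star_mul_self_eq_zero_iff w |>.1 (h5.antisymm (star_mul_self_nonneg w))

end Multiplier

/-- The structure theorem for a balanced map whose range generates its codomain. -/
theorem exists_multiplier_factorization [PartialOrder A] [StarOrderedRing A] [PartialOrder C]
    [StarOrderedRing C] (hstar : ∀ a, ψ (star a) = star (ψ a))
    (hgen : (NonUnitalStarAlgebra.adjoin ℂ (Set.range ψ)).topologicalClosure = ⊤)
    (hbal : ∀ (x : Unitization ℂ A) (b c : A), ψ (x.actRight b) * ψ c = ψ b * ψ (x.actLeft c))
    (hpos : ∀ a, 0 ≤ a → 0 ≤ ψ a) :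
    ∃ h : 𝓜(ℂ, C), (∃ s : 𝓜(ℂ, C), h = star s * s) ∧ ‖h‖ = ‖ψ‖ ∧
      (∀ c : C, h * (c : 𝓜(ℂ, C)) = (c : 𝓜(ℂ, C)) * h) ∧
      ∃ π : A →⋆ₙₐ[ℂ] 𝓜(ℂ, C),
        (∀ a, π a * h = h * π a) ∧
        (∀ a, π a * h = (ψ a : 𝓜(ℂ, C))) ∧
        (∀ e : A, (∀ x : A, e * x = x ∧ x * e = x) → h = (ψ e : 𝓜(ℂ, C))) := by
  obtain ⟨π, hπ, hπn⟩ := exists_starHom_multiplier hstar hgen hbal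
  obtain ⟨h, hh, hhn, hhs⟩ := exists_pos_multiplier hstar hgen hbal hpos
  have hmid (a b c : A) : ψ (a * b) * ψ c = ψ a * ψ (b * c) := by
    simpa [Unitization.actLeft_inr, Unitization.actRight_apply] using hbal b a c
  have hext {m n : 𝓜(ℂ, C)} (H : ∀ a b x, m.fst (ψ (a * b) * x) = n.fst (ψ (a * b) * x)) :
      m = n := DoubleCentralizer.ext_of_fst (clm_ext_map_mul_mul hstar hgen H)
  have hπh (a : A) : π a * h = (ψ a : 𝓜(ℂ, C)) := by
    refine hext fun b c x ↦ ?_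
    simp only [DoubleCentralizer.mul_fst, mul_apply_eq_comp, DoubleCentralizer.coe_fst,
      ContinuousLinearMap.mul_apply', hh]
    rw [mul_assoc, hπ, ← mul_assoc, ← mul_assoc, hmid]
  have hhπ (a : A) : h * π a = (ψ a : 𝓜(ℂ, C)) := by
    refine hext fun b c x ↦ ?_
    simp only [DoubleCentralizer.mul_fst, mul_apply_eq_comp, DoubleCentralizer.coe_fst,
      ContinuousLinearMap.mul_apply', hπ]
    rw [← mul_assoc a, hh, ← mul_assoc, hmid]
  have hnorm (c : C) : ‖(c : 𝓜(ℂ, C))‖ = ‖c‖ := by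
    rw [← DoubleCentralizer.norm_fst, DoubleCentralizer.coe_fst,
      ContinuousLinearMap.opNorm_mul_apply]
  have hcoe : Continuous fun c : C ↦ (c : 𝓜(ℂ, C)) :=
    (AddMonoidHomClass.isometry_of_norm (DoubleCentralizer.coeHom (𝕜 := ℂ) (A := C))
      hnorm).continuous
  have hgenerator (a : A) : h * (ψ a : 𝓜(ℂ, C)) = (ψ a : 𝓜(ℂ, C)) * h := by
    refine hext fun b c x ↦ ?_
    simp only [DoubleCentralizer.mul_fst, mul_apply_eq_comp, DoubleCentralizer.coe_fst,
      ContinuousLinearMap.mul_apply', hh]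
    rw [← mul_assoc, ← hmid, mul_assoc, hh]
    simp only [← mul_assoc]
  refine ⟨h, hhs, le_antisymm hhn ?_, fun c ↦ ?_, π, fun a ↦ (hπh a).trans (hhπ a).symm, hπh,
    fun e he ↦ ?_⟩
  · refine ψ.opNorm_le_bound (norm_nonneg _) fun a ↦ ?_
    rw [← hnorm, ← hhπ]
    exact norm_mul_le_of_le le_rfl (hπn a)
  · refine generated_induction (P := fun c ↦ h * (c : 𝓜(ℂ, C)) = (c : 𝓜(ℂ, C)) * h) hstar hgen
      (isClosed_eq (hcoe.const_mul h) (hcoe.mul_const h)) hgenerator ?_ (fun x y hx hy ↦ ?_)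
      (fun r x hx ↦ ?_) (fun x y hx hy ↦ ?_) c
    · simp only [← DoubleCentralizer.coeHom_apply, map_zero, mul_zero, zero_mul]
    · simp only [← DoubleCentralizer.coeHom_apply] at hx hy ⊢
      rw [map_add, mul_add, add_mul, hx, hy]
    · simp only [← DoubleCentralizer.coeHom_apply] at hx ⊢
      rw [map_smul, mul_smul_comm, smul_mul_assoc, hx]
    · simp only [← DoubleCentralizer.coeHom_apply] at hx hy ⊢
      rw [map_mul, ← mul_assoc, hx, mul_assoc, hy, mul_assoc]
  · refine hext fun b c x ↦ ?_
    rw [hh, DoubleCentralizer.coe_fst, ContinuousLinearMap.mul_apply', ← mul_assoc, ← hmid,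
      (he b).1]

end Balanced

/-- An injective star homomorphism between C⋆-algebras reflects positivity. -/
theorem NonUnitalStarAlgHom.nonneg_of_map_nonneg {C B : Type*} [NonUnitalCStarAlgebra C]
    [PartialOrder C] [StarOrderedRing C] [NonUnitalCStarAlgebra B] [PartialOrder B]
    [StarOrderedRing B] (f : C →⋆ₙₐ[ℂ] B) (hf : Function.Injective f) {x : C} (hx : 0 ≤ f x) :
    0 ≤ x := by
  have hsa : IsSelfAdjoint x := hf ((map_star f x).trans hx.isSelfAdjoint)
  have h := f.map_cfcₙ (R := ℝ) (·⁻) x (hφ := map_continuous f) (hφa := hx.isSelfAdjoint)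
  rw [← CFC.negPart_def, ← CFC.negPart_def, (CFC.negPart_eq_zero_iff (f x)).2 hx] at h
  exact (CFC.negPart_eq_zero_iff x).1 (hf (h.trans (map_zero f).symm))

/-- The corestriction of `φ` to the C⋆-subalgebra generated by its range. -/
noncomputable def generatedCStarCorestrict {A B : Type*} [NonUnitalCStarAlgebra A]
    [NonUnitalCStarAlgebra B] (φ : A →L[ℂ] B) : A →L[ℂ] generatedCStar φ where
  toFun a := ⟨φ a, mem_generatedCStar φ a⟩
  map_add' a b := Subtype.ext (map_add φ a b)
  map_smul' r a := Subtype.ext (map_smul φ r a)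
  cont := φ.continuous.subtype_mk _

theorem adjoin_range_generatedCStarCorestrict {A B : Type*} [NonUnitalCStarAlgebra A]
    [NonUnitalCStarAlgebra B] (φ : A →L[ℂ] B) :
    (NonUnitalStarAlgebra.adjoin ℂ
      (Set.range (generatedCStarCorestrict φ))).topologicalClosure = ⊤ := by
  let S := NonUnitalStarAlgebra.adjoin ℂ (Set.range (generatedCStarCorestrict φ))
  have hle : NonUnitalStarAlgebra.adjoin ℂ (Set.range φ) ≤
      S.map (NonUnitalStarSubalgebraClass.subtype (generatedCStar φ)) := by
    refine NonUnitalStarAlgebra.adjoin_le ?_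
    rintro _ ⟨a, rfl⟩
    exact ⟨generatedCStarCorestrict φ a, NonUnitalStarAlgebra.subset_adjoin ℂ _ ⟨a, rfl⟩, rfl⟩
  refine eq_top_iff.2 fun x _ ↦ ?_
  change x ∈ closure (S : Set (generatedCStar φ))
  rw [closure_subtype]
  exact closure_mono hle x.2

/-- structure theorem for completely positive order zero maps.
Let `φ : A → B` be a completely positive order zero map between C*-algebras, and let
`C ⊆ B` be the C*-subalgebra generated by the range of `φ`.  Then there are a positive
element `h` of the multiplier algebra `𝓜(ℂ, C)` with `‖h‖ = ‖φ‖` commuting with the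
canonical image of `C`, and a star-homomorphism `π : A → 𝓜(ℂ, C)` whose values commute with
`h`, such that `π(a)·h = h·π(a) = φ(a)` in `𝓜(ℂ, C)` for all `a`; moreover if `A` has a unit
`e` then `h` is the canonical image of `φ(e)`.  (Positivity of `h` is expressed by
`h = star s * s` for some `s`.) -/
theorem order_zero_structure {A B : Type*}
    [NonUnitalCStarAlgebra A] [PartialOrder A] [StarOrderedRing A]
    [NonUnitalCStarAlgebra B] [PartialOrder B] [StarOrderedRing B]
    (φ : A →L[ℂ] B)
    (hcp : ∀ (n : ℕ) (m : Matrix (Fin n) (Fin n) A),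
      (∃ x : Matrix (Fin n) (Fin n) A, m = star x * x) →
      ∃ y : Matrix (Fin n) (Fin n) B, m.map φ = star y * y)
    (hoz : ∀ a b : A, 0 ≤ a → 0 ≤ b → a * b = 0 → φ a * φ b = 0) :
    ∃ h : 𝓜(ℂ, generatedCStar φ),
      (∃ s : 𝓜(ℂ, generatedCStar φ), h = star s * s) ∧
      ‖h‖ = ‖φ‖ ∧
      (∀ c : generatedCStar φ, h * (c : 𝓜(ℂ, generatedCStar φ))
        = (c : 𝓜(ℂ, generatedCStar φ)) * h) ∧
      ∃ π : A →⋆ₙₐ[ℂ] 𝓜(ℂ, generatedCStar φ),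
        (∀ a : A, π a * h = h * π a) ∧
        (∀ a : A, π a * h =
          ((⟨φ a, mem_generatedCStar φ a⟩ : generatedCStar φ) : 𝓜(ℂ, generatedCStar φ))) ∧
        (∀ e : A, (∀ x : A, e * x = x ∧ x * e = x) →
          h = ((⟨φ e, mem_generatedCStar φ e⟩ : generatedCStar φ) :
            𝓜(ℂ, generatedCStar φ))) := by
  let := CStarAlgebra.spectralOrder (generatedCStar φ)
  have := CStarAlgebra.spectralOrderedRing (generatedCStar φ)
  have hpos := map_nonneg_of_cp hcp
  have hnorm : ‖generatedCStarCorestrict φ‖ = ‖φ‖ :=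
    le_antisymm (ContinuousLinearMap.opNorm_le_bound _ (norm_nonneg _) φ.le_opNorm)
      (φ.opNorm_le_bound (norm_nonneg _) (generatedCStarCorestrict φ).le_opNorm)
  rw [← hnorm]
  exact exists_multiplier_factorization (ψ := generatedCStarCorestrict φ)
    (fun a ↦ Subtype.ext (map_star_of_nonneg hpos a))
    (adjoin_range_generatedCStarCorestrict φ)
    (fun x b c ↦ Subtype.ext (map_actRight_mul_map_of_orderZero hcp hoz x b c))
    (fun a ha ↦ (NonUnitalStarSubalgebraClass.subtype (generatedCStar φ)).nonneg_of_map_nonneg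
      Subtype.val_injective (hpos a ha))
end

section
/- Let A and B be C*-algebras, ψ : A → B a completely positive contractive order zero map, and τ : B → ℂ a positive tracial continuous linear functional (τ(b) ≥ 0 for every positive b ∈ B, and τ(x·y) = τ(y·x) for all x, y ∈ B). Then τ∘ψ is a positive tracial functional on A; in particular τ(ψ(x·y)) = τ(ψ(y·x)) for all x, y ∈ A. -/
open scoped ComplexOrder

/-- Telescoping partitions of unity on an interval. -/
lemma exists_partition_of_unity_real (M ε : ℝ) (hM : 0 < M) (hε : 0 < ε) :
    ∃ (n : ℕ) (δ : ℝ) (e g : ℕ → C(ℝ, ℝ)) (t : ℕ → ℝ), δ ^ 2 * n ≤ ε ∧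
      (∀ s, |s| ≤ M → ∑ i ∈ Finset.range n, e i s = 1) ∧
      (∀ i s, 0 ≤ e i s ∧ e i s ≤ 1 ∧ 0 ≤ g i s ∧ g i s ≤ 1) ∧
      (∀ i s, e i s * (1 - g i s) = 0) ∧
      (∀ i s, (s - t i) ^ 2 * g i s ≤ δ ^ 2 * g i s) := by
  obtain ⟨N, hN⟩ := exists_nat_gt (max 1 (72 * M ^ 2 / ε))
  have hN1 : (1 : ℝ) < N := (le_max_left _ _).trans_lt hN
  have hN2 : 72 * M ^ 2 / ε < N := (le_max_right _ _).trans_lt hN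
  have hN0 : (0 : ℝ) < N := by linarith
  set d : ℝ := 2 * M / N with hd
  have hd0 : 0 < d := by positivity
  let ρ : ℝ → ℝ := fun z ↦ max 0 (min 1 z)
  have hρ : Continuous ρ := by fun_prop
  have hmono : Monotone ρ := fun a b h ↦ by simp only [ρ]; gcongr
  have hρ0 : ∀ z, 0 ≤ ρ z := fun z ↦ le_max_left _ _
  have hρ1 : ∀ z, ρ z ≤ 1 := fun z ↦ max_le zero_le_one (min_le_left _ _)
  have hρz : ∀ z ≤ 0, ρ z = 0 := fun z hz ↦ max_eq_left ((min_le_right _ _).trans hz)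
  have hρo : ∀ z, 1 ≤ z → ρ z = 1 := fun z hz ↦ by simp [ρ, min_eq_left hz]
  let z : ℝ → ℝ := fun s ↦ (s + M) / d + 1
  have hz : Continuous z := by fun_prop
  refine ⟨N + 1, 3 * d, fun i ↦ ⟨fun s ↦ ρ (z s - i) - ρ (z s - (i + 1 : ℕ)), by fun_prop⟩,
    fun i ↦ ⟨fun s ↦ ρ (z s - i + 1) - ρ (z s - i - 2), by fun_prop⟩,
    fun i ↦ d * (i - 1) - M, ?_, ?_, ?_, ?_, ?_⟩
  · have : d ^ 2 = 4 * M ^ 2 / N ^ 2 := by rw [hd]; ring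
    rw [mul_pow, this]
    push_cast
    rw [div_lt_iff₀ hε] at hN2
    rw [show (3 ^ 2 * (4 * M ^ 2 / (N : ℝ) ^ 2) * (N + 1)) = 36 * M ^ 2 * (N + 1) / N ^ 2 by ring,
      div_le_iff₀ (by positivity)]
    nlinarith [sq_nonneg M]
  · intro s hs
    obtain ⟨h1, h2⟩ := abs_le.mp hs
    have h3 : 1 ≤ z s := by
      have : 0 ≤ (s + M) / d := div_nonneg (by linarith) hd0.le
      simp only [z]; linarith
    have h4 : z s ≤ N + 1 := by
      have : (s + M) / d ≤ N := by
        rw [div_le_iff₀ hd0, hd]; field_simp; linarith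
      simp only [z]; linarith
    simp only [ContinuousMap.coe_mk]
    rw [Finset.sum_range_sub' (fun i : ℕ ↦ ρ (z s - i))]
    rw [hρo (z s - (0 : ℕ)) (by simpa using h3), hρz _ (by push_cast; linarith), sub_zero]
  · intro i s
    have h1 : ρ (z s - (i + 1 : ℕ)) ≤ ρ (z s - i) := hmono (by push_cast; linarith)
    have h2 : ρ (z s - i - 2) ≤ ρ (z s - i + 1) := hmono (by linarith)
    have := hρ0 (z s - (i + 1 : ℕ))
    have := hρ0 (z s - i - 2)
    have := hρ1 (z s - i)
    have := hρ1 (z s - i + 1)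
    simp only [ContinuousMap.coe_mk]
    refine ⟨?_, ?_, ?_, ?_⟩ <;> linarith
  · intro i s
    simp only [ContinuousMap.coe_mk]
    push_cast
    rcases le_total (z s - i) 0 with h | h
    · rw [hρz _ h, hρz _ (by linarith)]; simp
    · rcases le_total 2 (z s - i) with h' | h'
      · rw [hρo _ (by linarith), hρo (z s - (i + 1)) (by linarith)]; simp
      · rw [hρo (z s - i + 1) (by linarith), hρz (z s - i - 2) (by linarith)]; simp
  · intro i s
    simp only [ContinuousMap.coe_mk]
    have hs : s - (d * (i - 1) - M) = d * (z s - i) := by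
      simp only [z]; field_simp; ring
    rw [hs]
    rcases le_total (z s - i) (-1) with h | h
    · rw [hρz _ (by linarith), hρz _ (by linarith)]; simp
    · rcases le_total 3 (z s - i) with h' | h'
      · rw [hρo _ (by linarith), hρo (z s - i - 2) (by linarith)]; simp
      · refine mul_le_mul_of_nonneg_right ?_ (sub_nonneg.mpr (hmono (by linarith)))
        rw [mul_pow, mul_pow, mul_comm]
        exact mul_le_mul_of_nonneg_right (by nlinarith) (sq_nonneg d)

/-- A bilinear map on functions that vanishes on disjointly supported pairs and satisfies a
square function bound is balanced. -/
lemma bilinear_id_one_eq_one_id {E : Type*} [NormedAddCommGroup E] [NormedSpace ℝ E]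
    (Φ : C(ℝ, ℝ) →ₗ[ℝ] C(ℝ, ℝ) →ₗ[ℝ] E) (M K : ℝ) (hM : 0 < M) (hK : 0 ≤ K)
    (hzero : ∀ f g : C(ℝ, ℝ), f * g = 0 → Φ f g = 0)
    (hbound : ∀ (n : ℕ) (F G : ℕ → C(ℝ, ℝ)) (C D : ℝ), 0 ≤ C → 0 ≤ D →
      (∀ s, |s| ≤ M → ∑ i ∈ Finset.range n, F i s ^ 2 ≤ C) →
      (∀ s, |s| ≤ M → ∑ i ∈ Finset.range n, G i s ^ 2 ≤ D) →
      ‖∑ i ∈ Finset.range n, Φ (F i) (G i)‖ ^ 2 ≤ C * D * K) :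
    Φ (.id ℝ) 1 = Φ 1 (.id ℝ) := by
  have hcongr : ∀ f f' g g' : C(ℝ, ℝ), (∀ s, |s| ≤ M → f s = f' s) → (∀ s, |s| ≤ M → g s = g' s) →
      Φ f g = Φ f' g' := by
    intro f f' g g' hf hg
    have hbdd : ∀ f : C(ℝ, ℝ), ∃ C, 0 ≤ C ∧ ∀ s, |s| ≤ M → f s ^ 2 ≤ C := by
      intro f
      obtain ⟨C, hC⟩ := (isCompact_Icc (a := -M) (b := M)).bddAbove_image
        (f := fun s ↦ f s ^ 2) (by fun_prop)
      exact ⟨max C 0, le_max_right _ _, fun s hs ↦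
        (hC ⟨s, ⟨(abs_le.mp hs).1, (abs_le.mp hs).2⟩, rfl⟩).trans (le_max_left _ _)⟩
    have h1 : ∀ u v : C(ℝ, ℝ), (∀ s, |s| ≤ M → u s = 0) → Φ u v = 0 := by
      intro u v hu
      obtain ⟨D, hD, hv⟩ := hbdd v
      have := hbound 1 (fun _ ↦ u) (fun _ ↦ v) 0 D le_rfl hD (by simpa using hu) (by simpa using hv)
      simpa using this
    have h2 : ∀ u v : C(ℝ, ℝ), (∀ s, |s| ≤ M → v s = 0) → Φ u v = 0 := by
      intro u v hu
      obtain ⟨D, hD, hv⟩ := hbdd u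
      have := hbound 1 (fun _ ↦ u) (fun _ ↦ v) D 0 hD le_rfl (by simpa using hv) (by simpa using hu)
      simpa using this
    have e1 := h1 (f - f') g (fun s hs ↦ by simp [hf s hs])
    have e2 := h2 f' (g - g') (fun s hs ↦ by simp [hg s hs])
    rw [map_sub, LinearMap.sub_apply, sub_eq_zero] at e1
    rw [map_sub, sub_eq_zero] at e2
    rw [e1, e2]
  have key : ∀ ε > 0, ‖Φ (.id ℝ) 1 - Φ 1 (.id ℝ)‖ ^ 2 ≤ 4 * (ε * K) := by
    intro ε hε
    obtain ⟨n, δ, e, g, t, hn, hsum, hrange, heg, hg⟩ := exists_partition_of_unity_real M ε hM hε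
    let w : ℕ → C(ℝ, ℝ) := fun i ↦ .id ℝ - .const ℝ (t i)
    have hid : ∀ i, ContinuousMap.id ℝ = w i + t i • (1 : C(ℝ, ℝ)) := by
      intro i; ext s; simp [w]
    have hcut : ∀ i u v, Φ (u * e i) v = Φ (u * e i) (v * g i) := by
      intro i u v
      rw [← sub_eq_zero, ← map_sub]
      apply hzero
      ext s
      have := heg i s
      simp only [ContinuousMap.mul_apply, ContinuousMap.sub_apply, ContinuousMap.zero_apply]
      linear_combination (u s * v s) * this
    have hL : ∀ u v : C(ℝ, ℝ), Φ u v = ∑ i ∈ Finset.range n, Φ (u * e i) (v * g i) := by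
      intro u v
      simp_rw [← hcut]
      rw [← LinearMap.sum_apply, ← map_sum, ← Finset.mul_sum]
      exact hcongr _ _ _ _ (fun s hs ↦ by simp [hsum s hs]) (fun _ _ ↦ rfl)
    have hdiff : Φ (.id ℝ) 1 - Φ 1 (.id ℝ) = ∑ i ∈ Finset.range n, Φ (w i * e i) (g i) -
        ∑ i ∈ Finset.range n, Φ (e i) (w i * g i) := by
      rw [hL, hL 1, ← Finset.sum_sub_distrib, ← Finset.sum_sub_distrib]
      refine Finset.sum_congr rfl fun i _ ↦ ?_
      rw [hid i]
      simp [add_mul]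
    have hw : ∀ i s, w i s = s - t i := fun i s ↦ rfl
    have he1 : ∀ i s, e i s ≤ g i s := by
      intro i s
      obtain ⟨h1, h2, h3, h4⟩ := hrange i s
      nlinarith [heg i s]
    have hwe : ∀ i s, (w i s) ^ 2 * e i s ≤ δ ^ 2 * e i s := by
      intro i s
      obtain ⟨h1, h2, h3, h4⟩ := hrange i s
      have h5 : e i s = e i s * g i s := by linear_combination heg i s
      have := mul_le_mul_of_nonneg_left (hg i s) h1
      rw [hw]
      rw [h5]; nlinarith
    have b1 := hbound n (fun i ↦ w i * e i) g (δ ^ 2) n (by positivity) (by positivity)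
      (fun s hs ↦ by
        calc ∑ i ∈ Finset.range n, (w i * e i) s ^ 2 ≤ ∑ i ∈ Finset.range n, δ ^ 2 * e i s := by
              refine Finset.sum_le_sum fun i _ ↦ ?_
              obtain ⟨h1, h2, h3, h4⟩ := hrange i s
              have := hwe i s
              rw [ContinuousMap.mul_apply, mul_pow]
              nlinarith [mul_nonneg (sq_nonneg (w i s)) h1]
          _ = δ ^ 2 := by rw [← Finset.mul_sum, hsum s hs, mul_one])
      (fun s hs ↦ by
        calc ∑ i ∈ Finset.range n, g i s ^ 2 ≤ ∑ i ∈ Finset.range n, (1 : ℝ) := by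
              refine Finset.sum_le_sum fun i _ ↦ ?_
              obtain ⟨h1, h2, h3, h4⟩ := hrange i s
              nlinarith
          _ = n := by simp)
    have b2 := hbound n e (fun i ↦ w i * g i) 1 (δ ^ 2 * n) (by positivity) (by positivity)
      (fun s hs ↦ by
        calc ∑ i ∈ Finset.range n, e i s ^ 2 ≤ ∑ i ∈ Finset.range n, e i s := by
              refine Finset.sum_le_sum fun i _ ↦ ?_
              obtain ⟨h1, h2, h3, h4⟩ := hrange i s
              nlinarith
          _ = 1 := hsum s hs)
      (fun s hs ↦ by
        calc ∑ i ∈ Finset.range n, (w i * g i) s ^ 2 ≤ ∑ i ∈ Finset.range n, δ ^ 2 := by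
              refine Finset.sum_le_sum fun i _ ↦ ?_
              obtain ⟨h1, h2, h3, h4⟩ := hrange i s
              have := hg i s
              rw [ContinuousMap.mul_apply, mul_pow, hw]
              nlinarith [mul_nonneg (sq_nonneg (s - t i)) h3, sq_nonneg δ]
          _ = δ ^ 2 * n := by simp [mul_comm])
    rw [hdiff]
    have h3 := mul_le_mul_of_nonneg_right hn hK
    refine (pow_le_pow_left₀ (norm_nonneg _) (norm_sub_le _ _) 2).trans ?_
    nlinarith [sq_nonneg (‖∑ i ∈ Finset.range n, Φ (w i * e i) (g i)‖ -
      ‖∑ i ∈ Finset.range n, Φ (e i) (w i * g i)‖)]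
  have hlim : ‖Φ (.id ℝ) 1 - Φ 1 (.id ℝ)‖ ^ 2 ≤ 0 := by
    refine le_of_forall_pos_le_add fun η hη ↦ ?_
    have := key (η / (4 * (K + 1))) (by positivity)
    refine this.trans ?_
    have h5 : 4 * (η / (4 * (K + 1)) * K) = η * (K / (K + 1)) := by field_simp
    rw [h5, zero_add]
    exact mul_le_of_le_one_right hη.le ((div_le_one (by positivity)).mpr (by linarith))
  have h6 : ‖Φ (.id ℝ) 1 - Φ 1 (.id ℝ)‖ = 0 := by
    have := norm_nonneg (Φ (.id ℝ) 1 - Φ 1 (.id ℝ)); nlinarith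
  exact sub_eq_zero.mp (norm_eq_zero.mp h6)

section CompletelyPositive

variable {A B : Type*} [NonUnitalCStarAlgebra A] [PartialOrder A] [StarOrderedRing A]
  [NonUnitalCStarAlgebra B] [PartialOrder B] [StarOrderedRing B]

open WithCStarModule in
/-- The Cauchy–Schwarz inequality for finite families in a C⋆-algebra. -/
lemma norm_sum_star_mul_sq_le (n : ℕ) (p q : ℕ → B) :
    ‖∑ i ∈ Finset.range n, star (p i) * q i‖ ^ 2 ≤
      ‖∑ i ∈ Finset.range n, star (p i) * p i‖ * ‖∑ i ∈ Finset.range n, star (q i) * q i‖ := by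
  let u : C⋆ᵐᵒᵈ(B, Π _ : Fin n, B) := (equiv B _).symm (fun i ↦ star (q i))
  let v : C⋆ᵐᵒᵈ(B, Π _ : Fin n, B) := (equiv B _).symm (fun i ↦ star (p i))
  have h := CStarModule.norm_inner_le (A := B) (C⋆ᵐᵒᵈ(B, Π _ : Fin n, B)) (x := u) (y := v)
  have h2 := pow_le_pow_left₀ (norm_nonneg _) h 2
  rw [mul_pow, pi_norm_sq, pi_norm_sq, pi_inner] at h2
  simp only [WithCStarModule.inner_def, u, v, equiv_symm_pi_apply, star_star] at h2
  rw [Finset.sum_range, Finset.sum_range, Finset.sum_range, mul_comm ‖∑ i : Fin n, star (p i) * p i‖]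
  exact h2

open WithCStarModule in
lemma star_mul_self_le_norm_smul (a b c d : B) :
    star (star c * a + star d * b) * (star c * a + star d * b) ≤
      ‖star c * c + star d * d‖ • (star a * a + star b * b) := by
  let u : C⋆ᵐᵒᵈ(B, B × B) := (equiv B _).symm (star a, star b)
  let v : C⋆ᵐᵒᵈ(B, B × B) := (equiv B _).symm (star c, star d)
  have h := CStarModule.inner_mul_inner_swap_le (A := B) (E := C⋆ᵐᵒᵈ(B, B × B)) (x := v) (y := u)
  rw [prod_norm_sq, prod_inner, prod_inner, prod_inner] at h
  simp only [WithCStarModule.inner_def, u, v, equiv_symm_fst, equiv_symm_snd, star_star] at h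
  simpa using h

variable {ψ : A →L[ℂ] B}

lemma map_nonneg_of_completelyPositive
    (hcp : ∀ (n : ℕ) (m : Matrix (Fin n) (Fin n) A),
      (∃ x : Matrix (Fin n) (Fin n) A, m = star x * x) →
      ∃ y : Matrix (Fin n) (Fin n) B, m.map ψ = star y * y) {a : A} (ha : 0 ≤ a) : 0 ≤ ψ a := by
  obtain ⟨x, rfl⟩ := CStarAlgebra.nonneg_iff_eq_star_mul_self.mp ha
  obtain ⟨y, hy⟩ := hcp 1 _ ⟨!![x], rfl⟩
  have := congrFun (congrFun hy 0) 0
  simp [Matrix.mul_apply, Matrix.star_apply] at this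
  rw [this]
  exact star_mul_self_nonneg _

open Filter Topology in
lemma map_star_and_star_mul_self_le_of_completelyPositive (hcontr : ‖ψ‖ ≤ 1)
    (hcp : ∀ (n : ℕ) (m : Matrix (Fin n) (Fin n) A),
      (∃ x : Matrix (Fin n) (Fin n) A, m = star x * x) →
      ∃ y : Matrix (Fin n) (Fin n) B, m.map ψ = star y * y) (a : A) :
    ψ (star a) = star (ψ a) ∧ star (ψ a) * ψ a ≤ ψ (star a * a) := by
  have hl := CStarAlgebra.increasingApproximateUnit A
  have : (CStarAlgebra.approximateUnit A).NeBot := hl.neBot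
  have key : ∀ e : A, IsSelfAdjoint e → ‖e‖ ≤ 1 → ψ (star a * e) = star (ψ (e * a)) ∧
      star (ψ (e * a)) * ψ (e * a) ≤ ψ (star a * a) := by
    intro e he he1
    obtain ⟨y, hy⟩ := hcp 2 _ ⟨!![a, e; 0, 0], rfl⟩
    have h00 := congrFun (congrFun hy 0) 0
    have h01 := congrFun (congrFun hy 0) 1
    have h10 := congrFun (congrFun hy 1) 0
    have h11 := congrFun (congrFun hy 1) 1
    simp [Matrix.mul_apply, Matrix.star_apply, Fin.sum_univ_two, he.star_eq] at h00 h01 h10 h11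
    refine ⟨by rw [h01, h10]; simp, ?_⟩
    rw [h00, h10]
    refine (star_mul_self_le_norm_smul _ _ _ _).trans ?_
    rw [← h11, ← h00]
    have hn : ‖ψ (e * e)‖ ≤ 1 := by
      refine (ψ.le_of_opNorm_le hcontr _).trans ?_
      rw [one_mul]
      exact (norm_mul_le _ _).trans (mul_le_one₀ he1 (norm_nonneg _) he1)
    have hp : 0 ≤ ψ (star a * a) :=
      map_nonneg_of_completelyPositive hcp (star_mul_self_nonneg a)
    calc ‖ψ (e * e)‖ • ψ (star a * a) ≤ (1 : ℝ) • ψ (star a * a) :=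
          smul_le_smul_of_nonneg_right hn hp
      _ = _ := one_smul _ _
  have t1 : Tendsto (fun e ↦ ψ (star a * e)) (CStarAlgebra.approximateUnit A) (𝓝 (ψ (star a))) :=
    (ψ.continuous.tendsto _).comp (hl.tendsto_mul_left (star a))
  have t2 : Tendsto (fun e ↦ ψ (e * a)) (CStarAlgebra.approximateUnit A) (𝓝 (ψ a)) :=
    (ψ.continuous.tendsto _).comp (hl.tendsto_mul_right a)
  have ev := hl.eventually_isSelfAdjoint.and hl.eventually_norm
  constructor
  · refine tendsto_nhds_unique_of_eventuallyEq t1 t2.star ?_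
    filter_upwards [ev] with e he using (key e he.1 he.2).1
  · refine le_of_tendsto (t2.star.mul t2) ?_
    filter_upwards [ev] with e he using (key e he.1 he.2).2

lemma star_map_mul_map_eq_zero (hstar : ∀ a, ψ (star a) = star (ψ a))
    (hschwarz : ∀ a, star (ψ a) * ψ a ≤ ψ (star a * a))
    (hoz : ∀ a b : A, 0 ≤ a → 0 ≤ b → a * b = 0 → ψ a * ψ b = 0) {x y : A}
    (hxy : star x * y = 0) : star (ψ x) * ψ y = 0 := by
  have hsch : ∀ a, ψ a * star (ψ a) ≤ ψ (a * star a) := fun a ↦ by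
    have := hschwarz (star a)
    rwa [hstar, star_star, star_star] at this
  have hP := hoz (x * star x) (y * star y) (mul_star_self_nonneg _) (mul_star_self_nonneg _)
    (by rw [mul_assoc, ← mul_assoc (star x), hxy, zero_mul, mul_zero])
  set P := ψ (x * star x)
  set Q := ψ (y * star y) with hQdef
  have hQ : star Q = Q := by rw [hQdef, ← hstar]; simp
  have h1 : star (ψ x) * Q = 0 := by
    rw [← CStarRing.star_mul_self_eq_zero_iff]
    refine le_antisymm ?_ (star_mul_self_nonneg _)
    have := star_left_conjugate_le_conjugate (hsch x) Q
    rw [hQ, mul_assoc Q P, hP, mul_zero] at this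
    simpa [hQ, mul_assoc] using this
  rw [← CStarRing.mul_star_self_eq_zero_iff]
  refine le_antisymm ?_ (mul_star_self_nonneg _)
  have := star_left_conjugate_le_conjugate (hsch y) (ψ x)
  rw [h1, zero_mul] at this
  simpa [mul_assoc] using this

end CompletelyPositive

section LeftAction

variable {A : Type*} [NonUnitalCStarAlgebra A]

/-- The left action of the unitization of `A` on `A`. -/
def unitizationAct : Unitization ℂ A →ₗ[ℂ] A →ₗ[ℂ] A :=
  LinearMap.mk₂ ℂ (fun u b ↦ u.fst • b + u.snd * b)
    (fun u v b ↦ by simp [add_smul, add_mul]; abel)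
    (fun c u b ↦ by simp [mul_smul, smul_mul_assoc])
    (fun u b b' ↦ by simp [mul_add]; abel)
    (fun c u b ↦ by simp [smul_comm c, mul_smul_comm])

@[simp]
lemma inr_unitizationAct (u : Unitization ℂ A) (b : A) :
    (unitizationAct u b : Unitization ℂ A) = u * (b : Unitization ℂ A) := by
  ext <;> simp [unitizationAct]

lemma norm_unitizationAct_le (u : Unitization ℂ A) (b : A) :
    ‖unitizationAct u b‖ ≤ ‖u‖ * ‖b‖ := by
  rw [← Unitization.norm_inr (𝕜 := ℂ), ← Unitization.norm_inr (𝕜 := ℂ) (a := b),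
    inr_unitizationAct]
  exact norm_mul_le _ _

lemma unitizationAct_mul_right (u : Unitization ℂ A) (b c : A) :
    unitizationAct u (b * c) = unitizationAct u b * c := by
  apply Unitization.inr_injective (R := ℂ)
  simp [mul_assoc]

lemma unitizationAct_mul (u v : Unitization ℂ A) (b : A) :
    unitizationAct (u * v) b = unitizationAct u (unitizationAct v b) := by
  apply Unitization.inr_injective (R := ℂ)
  simp [mul_assoc]

lemma unitizationAct_one (b : A) : unitizationAct (1 : Unitization ℂ A) b = b := by
  apply Unitization.inr_injective (R := ℂ)
  simp

lemma unitizationAct_inr (a b : A) : unitizationAct (a : Unitization ℂ A) b = a * b := by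
  apply Unitization.inr_injective (R := ℂ)
  simp

lemma star_unitizationAct_mul (u v : Unitization ℂ A) (x y : A) :
    star (unitizationAct u x) * unitizationAct v y =
      star x * unitizationAct (star u * v) y := by
  apply Unitization.inr_injective (R := ℂ)
  simp [mul_assoc]

/-- The real-linear map `f ↦ f(b) x`. -/
noncomputable def cfcAct (b : Unitization ℂ A) (x : A) : C(ℝ, ℝ) →ₗ[ℝ] A where
  toFun f := unitizationAct (cfc f b) x
  map_add' f g := by
    rw [← LinearMap.add_apply, ← map_add]
    congr 2
    exact cfc_add b f g
  map_smul' r f := by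
    have : cfc (⇑(r • f)) b = (r : ℂ) • cfc f b := by
      rw [Complex.coe_smul]
      exact cfc_smul r f b
    rw [this, map_smul, LinearMap.smul_apply, Complex.coe_smul, RingHom.id_apply]

lemma cfcAct_apply (b : Unitization ℂ A) (x : A) (f : C(ℝ, ℝ)) :
    cfcAct b x f = unitizationAct (cfc f b) x := rfl

lemma star_cfcAct_mul (b : Unitization ℂ A) (x y : A) (f g : C(ℝ, ℝ)) :
    star (cfcAct b x f) * cfcAct b y g = star x * unitizationAct (cfc ⇑(f * g) b) y := by
  rw [cfcAct_apply, cfcAct_apply, star_unitizationAct_mul, ← cfc_star]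
  simp only [star_trivial]
  rw [← cfc_mul (⇑f) (⇑g) b]
  rfl

end LeftAction

section Balanced

variable {A B : Type*} [NonUnitalCStarAlgebra A] [NonUnitalCStarAlgebra B] [PartialOrder B]
  [StarOrderedRing B] {ψ : A →L[ℂ] B}

lemma norm_sum_star_map_cfcAct_le (hcontr : ‖ψ‖ ≤ 1)
    (hschwarz : ∀ a, star (ψ a) * ψ a ≤ ψ (star a * a))
    {b : Unitization ℂ A} {M : ℝ} (hM : ‖b‖ ≤ M) (x : A) (n : ℕ) (F : ℕ → C(ℝ, ℝ))
    (C : ℝ) (hC : 0 ≤ C) (hF : ∀ s, |s| ≤ M → ∑ i ∈ Finset.range n, F i s ^ 2 ≤ C) :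
    ‖∑ i ∈ Finset.range n, star (ψ (cfcAct b x (F i))) * ψ (cfcAct b x (F i))‖ ≤
      C * ‖x‖ ^ 2 := by
  have h1 : ∑ i ∈ Finset.range n, star (ψ (cfcAct b x (F i))) * ψ (cfcAct b x (F i)) ≤
      ψ (∑ i ∈ Finset.range n, star (cfcAct b x (F i)) * cfcAct b x (F i)) := by
    rw [map_sum]
    exact Finset.sum_le_sum fun i _ ↦ hschwarz _
  refine (CStarAlgebra.norm_le_norm_of_nonneg_of_le
    (Finset.sum_nonneg fun i _ ↦ star_mul_self_nonneg _) h1).trans ?_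
  refine (ψ.le_of_opNorm_le hcontr _).trans ?_
  rw [one_mul]
  have h2 : ∑ i ∈ Finset.range n, star (cfcAct b x (F i)) * cfcAct b x (F i) =
      star x * unitizationAct (cfc (⇑(∑ i ∈ Finset.range n, F i * F i)) b) x := by
    simp_rw [star_cfcAct_mul]
    rw [← Finset.mul_sum]
    simp_rw [← cfcAct_apply]
    rw [map_sum]
  rw [h2]
  have h3 : ‖cfc (⇑(∑ i ∈ Finset.range n, F i * F i)) b‖ ≤ C := by
    refine norm_cfc_le hC fun s hs ↦ ?_
    have hs' : |s| ≤ M := (spectrum.norm_le_norm_of_mem hs).trans hM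
    have := hF s hs'
    rw [ContinuousMap.coe_sum, Finset.sum_apply, Real.norm_of_nonneg]
    · simpa [sq] using this
    · exact Finset.sum_nonneg fun i _ ↦ mul_self_nonneg _
  calc _ ≤ ‖star x‖ * (‖cfc (⇑(∑ i ∈ Finset.range n, F i * F i)) b‖ * ‖x‖) :=
        (norm_mul_le _ _).trans (by gcongr; exact norm_unitizationAct_le _ _)
    _ ≤ ‖x‖ * (C * ‖x‖) := by rw [norm_star]; gcongr
    _ = _ := by ring

variable [PartialOrder A] [StarOrderedRing A]

/-- Order zero maps are balanced with respect to multiplication by self-adjoint elements. -/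
lemma star_map_mul_mul_map (hcontr : ‖ψ‖ ≤ 1) (hstar : ∀ a, ψ (star a) = star (ψ a))
    (hschwarz : ∀ a, star (ψ a) * ψ a ≤ ψ (star a * a))
    (hoz : ∀ a b : A, 0 ≤ a → 0 ≤ b → a * b = 0 → ψ a * ψ b = 0)
    {b : A} (hb : IsSelfAdjoint b) (x y : A) :
    star (ψ (b * x)) * ψ y = star (ψ x) * ψ (b * y) := by
  have hb' : IsSelfAdjoint (b : Unitization ℂ A) := hb.inr ℂ
  let β : Unitization ℂ A := b
  let Φ : C(ℝ, ℝ) →ₗ[ℝ] C(ℝ, ℝ) →ₗ[ℝ] B :=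
    LinearMap.mk₂ ℝ (fun f g ↦ star (ψ (cfcAct β x f)) * ψ (cfcAct β y g))
      (fun f f' g ↦ by simp [add_mul])
      (fun c f g ↦ by
        rw [map_smul, ← Complex.coe_smul, map_smul, star_smul]; simp [smul_mul_assoc])
      (fun f g g' ↦ by simp [mul_add])
      (fun c f g ↦ by
        rw [map_smul, ← Complex.coe_smul, map_smul]; simp [mul_smul_comm])
  have hΦ : ∀ f g, Φ f g = star (ψ (cfcAct β x f)) * ψ (cfcAct β y g) := fun _ _ ↦ rfl
  have hid : ∀ z, cfcAct β z (.id ℝ) = b * z := fun z ↦ by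
    rw [cfcAct_apply, ContinuousMap.coe_id, cfc_id ℝ β hb', unitizationAct_inr]
  have hone : ∀ z, cfcAct β z 1 = z := fun z ↦ by
    rw [cfcAct_apply, ContinuousMap.coe_one, cfc_one ℝ β hb', unitizationAct_one]
  have key := bilinear_id_one_eq_one_id Φ (‖β‖ + 1) (‖x‖ ^ 2 * ‖y‖ ^ 2) (by positivity)
    (by positivity)
    (fun f g hfg ↦ by
      rw [hΦ]
      refine star_map_mul_map_eq_zero hstar hschwarz hoz ?_
      rw [star_cfcAct_mul, hfg, ← cfcAct_apply, map_zero, mul_zero])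
    (fun n F G C D hC hD hF hG ↦ by
      simp_rw [hΦ]
      refine (norm_sum_star_mul_sq_le n _ _).trans ?_
      have h1 := norm_sum_star_map_cfcAct_le hcontr hschwarz (b := β) (M := ‖β‖ + 1)
        (by linarith) x n F C hC hF
      have h2 := norm_sum_star_map_cfcAct_le hcontr hschwarz (b := β) (M := ‖β‖ + 1)
        (by linarith) y n G D hD hG
      calc _ ≤ (C * ‖x‖ ^ 2) * (D * ‖y‖ ^ 2) := by gcongr
        _ = _ := by ring)
  rw [hΦ, hΦ, hid, hid, hone, hone] at key
  exact key

lemma map_mul_mul_map (hcontr : ‖ψ‖ ≤ 1) (hstar : ∀ a, ψ (star a) = star (ψ a))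
    (hschwarz : ∀ a, star (ψ a) * ψ a ≤ ψ (star a * a))
    (hoz : ∀ a b : A, 0 ≤ a → 0 ≤ b → a * b = 0 → ψ a * ψ b = 0)
    {b : A} (hb : IsSelfAdjoint b) (x y : A) :
    ψ (x * b) * ψ y = ψ x * ψ (b * y) := by
  have := star_map_mul_mul_map hcontr hstar hschwarz hoz hb (star x) y
  rw [← hstar, ← hstar] at this
  simpa [hb.star_eq] using this

end Balanced

section Trace

open Filter Topology

lemma mul_norm_one_sub_pow_mul_le {D : Type*} [CStarAlgebra D] [PartialOrder D]
    [StarOrderedRing D] {h : D} (h0 : 0 ≤ h) (h1 : h ≤ 1) (n : ℕ) :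
    n * ‖(1 - h) ^ n * h * (1 - h) ^ n‖ ≤ 1 := by
  have hs : IsSelfAdjoint h := .of_nonneg h0
  have hc : cfc (fun t : ℝ ↦ (1 - t) ^ n * t * (1 - t) ^ n) h = (1 - h) ^ n * h * (1 - h) ^ n := by
    have e1 : cfc (fun t : ℝ ↦ 1 - t) h = 1 - h := by
      rw [cfc_sub (fun _ ↦ (1 : ℝ)) (fun t ↦ t) h, cfc_const_one ℝ h, cfc_id' ℝ h]
    rw [cfc_mul (fun t : ℝ ↦ (1 - t) ^ n * t) (fun t ↦ (1 - t) ^ n) h,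
      cfc_mul (fun t : ℝ ↦ (1 - t) ^ n) (fun t ↦ t) h, cfc_pow (fun t : ℝ ↦ 1 - t) n h, e1,
      cfc_id' ℝ h]
  rcases Nat.eq_zero_or_pos n with rfl | hn
  · simp
  have hn' : (0 : ℝ) < n := by exact_mod_cast hn
  rw [← hc, mul_comm, ← le_div_iff₀ hn']
  refine norm_cfc_le (by positivity) fun t ht ↦ ?_
  have ht0 : 0 ≤ t := spectrum_nonneg_of_nonneg h0 ht
  have ht1 : t ≤ 1 := (CFC.le_one_iff (R := ℝ) h).mp h1 t ht
  have hp0 : 0 ≤ (1 - t) ^ n := pow_nonneg (by linarith) n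
  have hp1 : (1 - t) ^ n ≤ 1 := pow_le_one₀ (by linarith) (by linarith)
  rw [Real.norm_of_nonneg (by positivity), le_div_iff₀ hn']
  have hb : 1 + (n : ℝ) * t ≤ (1 + t) ^ n := one_add_mul_le_pow (by linarith) n
  have hb2 : (1 - t) ^ n * (1 + t) ^ n ≤ 1 := by
    rw [← mul_pow]
    exact pow_le_one₀ (by nlinarith) (by nlinarith)
  have hb3 : (1 - t) ^ n * (n * t) ≤ 1 := by nlinarith
  calc (1 - t) ^ n * t * (1 - t) ^ n * n = ((1 - t) ^ n * (n * t)) * (1 - t) ^ n := by ring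
    _ ≤ 1 * 1 := by gcongr
    _ = 1 := one_mul 1

variable {A B : Type*} [NonUnitalCStarAlgebra A] [PartialOrder A] [NonUnitalCStarAlgebra B]
  {ψ : A →L[ℂ] B}

lemma tendsto_map_mul_self_mul {l : Filter A} (hl : l.IsIncreasingApproximateUnit) (x : A) :
    Tendsto (fun e ↦ ψ (e * e * x)) l (𝓝 (ψ x)) := by
  refine (ψ.continuous.tendsto _).comp ?_
  have h1 := hl.tendsto_mul_right x
  have h2 : Tendsto (fun e ↦ ‖e * x - x‖ + ‖e * x - x‖) l (𝓝 0) := by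
    have := (h1.sub_const x).norm
    simpa using this.add this
  rw [tendsto_iff_norm_sub_tendsto_zero]
  refine squeeze_zero' (.of_forall fun _ ↦ norm_nonneg _) ?_ h2
  filter_upwards [hl.eventually_norm] with e he
  have : e * e * x - x = e * (e * x - x) + (e * x - x) := by
    rw [mul_sub, mul_assoc]; abel
  rw [this]
  exact (norm_add_le _ _).trans (add_le_add_left
    ((norm_mul_le _ _).trans (mul_le_of_le_one_left (norm_nonneg _) he)) _)

lemma tendsto_map_mul_mul_self {l : Filter A} (hl : l.IsIncreasingApproximateUnit) (x : A) :
    Tendsto (fun e ↦ ψ (x * (e * e))) l (𝓝 (ψ x)) := by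
  refine (ψ.continuous.tendsto _).comp ?_
  have h1 := hl.tendsto_mul_left x
  have h2 : Tendsto (fun e ↦ ‖x * e - x‖ + ‖x * e - x‖) l (𝓝 0) := by
    have := (h1.sub_const x).norm
    simpa using this.add this
  rw [tendsto_iff_norm_sub_tendsto_zero]
  refine squeeze_zero' (.of_forall fun _ ↦ norm_nonneg _) ?_ h2
  filter_upwards [hl.eventually_norm] with e he
  have : x * (e * e) - x = (x * e - x) * e + (x * e - x) := by
    rw [sub_mul, mul_assoc]; abel
  rw [this]
  exact (norm_add_le _ _).trans (add_le_add_left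
    ((norm_mul_le _ _).trans (mul_le_of_le_one_right (norm_nonneg _) he)) _)

variable [StarOrderedRing A] [PartialOrder B] [StarOrderedRing B]

/-- The complement in the unitization of the image of `e * e`. -/
def mapCompl (ψ : A →L[ℂ] B) (e : A) : Unitization ℂ B := 1 - (ψ (e * e) : Unitization ℂ B)

lemma inr_map_mul_self_nonneg_le_one (hcontr : ‖ψ‖ ≤ 1)
    (hpos : ∀ a : A, 0 ≤ a → 0 ≤ ψ a) {e : A} (he : IsSelfAdjoint e) (he1 : ‖e‖ ≤ 1) :
    0 ≤ (ψ (e * e) : Unitization ℂ B) ∧ (ψ (e * e) : Unitization ℂ B) ≤ 1 := by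
  refine Set.mem_Icc.mp (CStarAlgebra.inr_mem_Icc_iff_norm_le.mpr ⟨hpos _ ?_, ?_⟩)
  · simpa [he.star_eq] using star_mul_self_nonneg e
  · refine (ψ.le_of_opNorm_le hcontr _).trans ?_
    rw [one_mul]
    exact (norm_mul_le _ _).trans (mul_le_one₀ he1 (norm_nonneg _) he1)

lemma norm_mapCompl_pow_le_one (hcontr : ‖ψ‖ ≤ 1)
    (hpos : ∀ a : A, 0 ≤ a → 0 ≤ ψ a) {e : A} (he : IsSelfAdjoint e) (he1 : ‖e‖ ≤ 1) (n : ℕ) :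
    ‖mapCompl ψ e ^ n‖ ≤ 1 := by
  obtain ⟨h0, h1⟩ := inr_map_mul_self_nonneg_le_one hcontr hpos he he1
  have : ‖mapCompl ψ e‖ ≤ 1 :=
    (CStarAlgebra.norm_le_one_iff_of_nonneg _ (sub_nonneg.mpr h1)).mpr
      (sub_le_self _ h0)
  exact (norm_pow_le _ _).trans (pow_le_one₀ (norm_nonneg _) this)

lemma mul_norm_mapCompl_pow_act_sq_le (hcontr : ‖ψ‖ ≤ 1) (hpos : ∀ a : A, 0 ≤ a → 0 ≤ ψ a)
    (hstar : ∀ a, ψ (star a) = star (ψ a))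
    (hschwarz : ∀ a, star (ψ a) * ψ a ≤ ψ (star a * a))
    {e : A} (he : IsSelfAdjoint e) (he1 : ‖e‖ ≤ 1) (n : ℕ) (a : A) :
    n * ‖unitizationAct (mapCompl ψ e ^ n) (ψ (e * a))‖ ^ 2 ≤ ‖a‖ ^ 2 := by
  obtain ⟨h0, h1⟩ := inr_map_mul_self_nonneg_le_one hcontr hpos he he1
  set c := mapCompl ψ e with hc
  set p := ψ (e * a)
  have hcs : star (c ^ n) = c ^ n := by
    have : star c = c := by
      rw [hc, mapCompl, star_sub, star_one, (IsSelfAdjoint.of_nonneg h0).star_eq]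
    rw [star_pow, this]
  have hle : p * star p ≤ ‖a‖ ^ 2 • ψ (e * e) := by
    have h2 := hschwarz (star (e * a))
    rw [hstar, star_star, star_star] at h2
    refine h2.trans ?_
    have h3 : e * a * star (e * a) ≤ ‖a‖ ^ 2 • (e * e) := by
      have := CStarAlgebra.star_left_conjugate_le_norm_smul (a := e) (b := a * star a)
        (.mul_star_self a)
      rw [CStarRing.norm_self_mul_star, he.star_eq, ← sq] at this
      simpa [he.star_eq, mul_assoc] using this
    have h4 := hpos _ (sub_nonneg.mpr h3)
    rw [map_sub, sub_nonneg, ← Complex.coe_smul, map_smul, Complex.coe_smul] at h4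
    exact h4
  have hle' : (p : Unitization ℂ B) * star (p : Unitization ℂ B) ≤ ‖a‖ ^ 2 • (ψ (e * e) : Unitization ℂ B) := by
    have hsa : IsSelfAdjoint (ψ (e * e)) := by
      rw [IsSelfAdjoint, ← hstar, star_mul, he.star_eq]
    have := (Unitization.inr_le_iff _ _ (.mul_star_self p)
      ((IsSelfAdjoint.all (‖a‖ ^ 2)).smul hsa)).mpr hle
    simpa using this
  have hnorm : ‖unitizationAct (c ^ n) p‖ ^ 2 ≤
      ‖a‖ ^ 2 * ‖c ^ n * (ψ (e * e) : Unitization ℂ B) * c ^ n‖ := by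
    rw [← Unitization.norm_inr (𝕜 := ℂ), inr_unitizationAct, sq, ← CStarRing.norm_self_mul_star]
    have h5 := star_right_conjugate_le_conjugate hle' (c ^ n)
    have h6 := CStarAlgebra.norm_le_norm_of_nonneg_of_le
      (star_right_conjugate_nonneg (mul_star_self_nonneg (p : Unitization ℂ B)) (c ^ n)) h5
    rw [hcs] at h6
    rw [star_mul, hcs]
    refine le_trans (le_of_eq ?_) (h6.trans (le_of_eq ?_))
    · simp only [mul_assoc]
    · rw [mul_smul_comm, smul_mul_assoc, norm_smul, Real.norm_of_nonneg (by positivity)]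
  have hfin := mul_norm_one_sub_pow_mul_le h0 h1 n
  change n * ‖c ^ n * _ * c ^ n‖ ≤ 1 at hfin
  calc _ ≤ n * (‖a‖ ^ 2 * ‖c ^ n * (ψ (e * e) : Unitization ℂ B) * c ^ n‖) := by gcongr
    _ = ‖a‖ ^ 2 * (n * ‖c ^ n * (ψ (e * e) : Unitization ℂ B) * c ^ n‖) := by ring
    _ ≤ ‖a‖ ^ 2 * 1 := by gcongr
    _ = _ := mul_one _

/-- The commutation defect of the image of an approximate unit tends to zero. -/
lemma tendsto_norm_mapCompl_pow_commutator (hcontr : ‖ψ‖ ≤ 1) (hpos : ∀ a : A, 0 ≤ a → 0 ≤ ψ a)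
    (hstar : ∀ a, ψ (star a) = star (ψ a))
    (hschwarz : ∀ a, star (ψ a) * ψ a ≤ ψ (star a * a))
    (hoz : ∀ a b : A, 0 ≤ a → 0 ≤ b → a * b = 0 → ψ a * ψ b = 0)
    {l : Filter A} (hl : l.IsIncreasingApproximateUnit) {x : A} (hx : IsSelfAdjoint x) (n : ℕ) :
    Tendsto (fun e ↦ ‖mapCompl ψ e ^ n * (ψ x : Unitization ℂ B) -
      (ψ x : Unitization ℂ B) * mapCompl ψ e ^ n‖) l (𝓝 0) := by
  have ev := hl.eventually_isSelfAdjoint.and hl.eventually_norm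
  have hone : Tendsto (fun e ↦ ‖mapCompl ψ e * (ψ x : Unitization ℂ B) -
      (ψ x : Unitization ℂ B) * mapCompl ψ e‖) l (𝓝 0) := by
    have t1 := tendsto_map_mul_self_mul hl x (ψ := ψ)
    have t2 := tendsto_map_mul_mul_self hl x (ψ := ψ)
    have t3 : Tendsto (fun e ↦ ‖ψ x - ψ (e * e * x)‖ + ‖ψ x - ψ (x * (e * e))‖) l (𝓝 0) := by
      have h1 := (tendsto_const_nhds (x := ψ x)).sub t1
      have h2 := (tendsto_const_nhds (x := ψ x)).sub t2
      simpa using h1.norm.add h2.norm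
    refine squeeze_zero' (.of_forall fun _ ↦ norm_nonneg _) ?_ t3
    filter_upwards [ev] with e ⟨he, he1⟩
    have hh : ‖ψ (e * e)‖ ≤ 1 := by
      refine (ψ.le_of_opNorm_le hcontr _).trans ?_
      rw [one_mul]
      exact (norm_mul_le _ _).trans (mul_le_one₀ he1 (norm_nonneg _) he1)
    have hcomm := map_mul_mul_map hcontr hstar hschwarz hoz hx (e * e) (e * e)
    have heq : mapCompl ψ e * (ψ x : Unitization ℂ B) - (ψ x : Unitization ℂ B) * mapCompl ψ e =
        (((ψ x - ψ (e * e * x)) * ψ (e * e) - ψ (e * e) * (ψ x - ψ (x * (e * e))) : B) :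
          Unitization ℂ B) := by
      rw [sub_mul, mul_sub, hcomm, mapCompl]
      simp only [Unitization.inr_sub, Unitization.inr_mul, sub_mul, mul_sub, one_mul, mul_one]
      abel
    rw [heq, Unitization.norm_inr]
    refine (norm_sub_le _ _).trans (add_le_add ?_ ?_)
    · exact (norm_mul_le _ _).trans (mul_le_of_le_one_right (norm_nonneg _) hh)
    · exact (norm_mul_le _ _).trans (mul_le_of_le_one_left (norm_nonneg _) hh)
  induction n with
  | zero => simpa using tendsto_const_nhds
  | succ n ih =>
    refine squeeze_zero' (.of_forall fun _ ↦ norm_nonneg _) ?_ (by simpa using ih.add hone)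
    filter_upwards [ev] with e ⟨he, he1⟩
    have hc := norm_mapCompl_pow_le_one hcontr hpos he he1
    set c := mapCompl ψ e
    have hc1 : ‖c‖ ≤ 1 := by simpa using hc 1
    set p : Unitization ℂ B := (ψ x : Unitization ℂ B)
    have heq : c ^ (n + 1) * p - p * c ^ (n + 1) =
        c * (c ^ n * p - p * c ^ n) + (c * p - p * c) * c ^ n := by
      rw [pow_succ']; noncomm_ring
    rw [heq]
    refine (norm_add_le _ _).trans (add_le_add ?_ ?_)
    · exact (norm_mul_le _ _).trans (mul_le_of_le_one_left (norm_nonneg _) hc1)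
    · exact (norm_mul_le _ _).trans (mul_le_of_le_one_right (norm_nonneg _) (hc n))

lemma tendsto_trace_mapCompl_pow_commutator (hcontr : ‖ψ‖ ≤ 1) (hpos : ∀ a : A, 0 ≤ a → 0 ≤ ψ a)
    (hstar : ∀ a, ψ (star a) = star (ψ a))
    (hschwarz : ∀ a, star (ψ a) * ψ a ≤ ψ (star a * a))
    (hoz : ∀ a b : A, 0 ≤ a → 0 ≤ b → a * b = 0 → ψ a * ψ b = 0)
    (τ : B →L[ℂ] ℂ) (hτtr : ∀ x y : B, τ (x * y) = τ (y * x))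
    {l : Filter A} (hl : l.IsIncreasingApproximateUnit) {x y : A}
    (hx : IsSelfAdjoint x) (hy : IsSelfAdjoint y) (n : ℕ) :
    Tendsto (fun e ↦ τ (unitizationAct (mapCompl ψ e ^ n) (ψ (x * y - y * x)))) l
      (𝓝 (τ (ψ (x * y - y * x)))) := by
  have ev := hl.eventually_isSelfAdjoint.and hl.eventually_norm
  induction n with
  | zero => simp only [pow_zero, unitizationAct_one]; exact tendsto_const_nhds
  | succ n ih =>
    have hsplit : ∀ e, τ (unitizationAct (mapCompl ψ e ^ (n + 1)) (ψ (x * y - y * x))) =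
        τ (unitizationAct (mapCompl ψ e ^ n) (ψ (x * y - y * x))) -
        τ (unitizationAct (mapCompl ψ e ^ n) (ψ (e * e) * ψ (x * y - y * x))) := by
      intro e
      rw [pow_succ, unitizationAct_mul, ← map_sub τ, ← map_sub]
      congr 2
      rw [mapCompl, map_sub, LinearMap.sub_apply, unitizationAct_one, unitizationAct_inr]
    simp_rw [hsplit]
    suffices h : Tendsto (fun e ↦
        τ (unitizationAct (mapCompl ψ e ^ n) (ψ (e * e) * ψ (x * y - y * x)))) l (𝓝 0) by
      simpa using ih.sub h
    have t1 : Tendsto (fun e ↦ ‖ψ (e * e * x) - ψ x‖) l (𝓝 0) := by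
      simpa using ((tendsto_map_mul_self_mul hl x (ψ := ψ)).sub_const (ψ x)).norm
    have t2 : Tendsto (fun e ↦ ‖ψ (e * e * y) - ψ y‖) l (𝓝 0) := by
      simpa using ((tendsto_map_mul_self_mul hl y (ψ := ψ)).sub_const (ψ y)).norm
    have t3 := tendsto_norm_mapCompl_pow_commutator hcontr hpos hstar hschwarz hoz hl hx n
    have t4 : Tendsto (fun e ↦ ‖τ‖ * (‖mapCompl ψ e ^ n * (ψ x : Unitization ℂ B) -
        (ψ x : Unitization ℂ B) * mapCompl ψ e ^ n‖ * ‖ψ y‖) +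
        ‖τ‖ * (‖ψ (e * e * x) - ψ x‖ * ‖ψ y‖ + ‖ψ (e * e * y) - ψ y‖ * ‖ψ x‖)) l (𝓝 0) := by
      simpa using ((t3.mul_const ‖ψ y‖).const_mul ‖τ‖).add
        (((t1.mul_const ‖ψ y‖).add (t2.mul_const ‖ψ x‖)).const_mul ‖τ‖)
    rw [tendsto_zero_iff_norm_tendsto_zero]
    refine squeeze_zero' (.of_forall fun _ ↦ norm_nonneg _) ?_ t4
    filter_upwards [ev] with e ⟨he, he1⟩
    have hc := norm_mapCompl_pow_le_one hcontr hpos he he1 n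
    set u := mapCompl ψ e ^ n
    have hxy := map_mul_mul_map hcontr hstar hschwarz hoz hx (e * e) y
    have hyx := map_mul_mul_map hcontr hstar hschwarz hoz hy (e * e) x
    have hdec : ψ (e * e) * ψ (x * y - y * x) = (ψ x * ψ y - ψ y * ψ x) +
        ((ψ (e * e * x) - ψ x) * ψ y - (ψ (e * e * y) - ψ y) * ψ x) := by
      rw [map_sub, mul_sub, ← hxy, ← hyx, sub_mul, sub_mul]
      abel
    rw [hdec, map_add, map_add]
    refine (norm_add_le _ _).trans (add_le_add ?_ ?_)
    · have htr : τ (unitizationAct u (ψ x * ψ y - ψ y * ψ x)) =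
          τ (unitizationAct u (ψ x * ψ y) - ψ x * unitizationAct u (ψ y)) := by
        rw [map_sub, map_sub τ, map_sub τ, unitizationAct_mul_right u (ψ y), hτtr _ (ψ x)]
      rw [htr]
      refine (τ.le_opNorm _).trans (mul_le_mul_of_nonneg_left ?_ (norm_nonneg _))
      rw [← Unitization.norm_inr (𝕜 := ℂ), ← Unitization.norm_inr (𝕜 := ℂ) (a := ψ y)]
      refine le_trans (le_of_eq ?_) (norm_mul_le _ _)
      simp [sub_mul, mul_assoc]
    · refine (τ.le_opNorm _).trans (mul_le_mul_of_nonneg_left ?_ (norm_nonneg _))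
      refine (norm_unitizationAct_le _ _).trans ?_
      refine (mul_le_of_le_one_left (norm_nonneg _) hc).trans ?_
      exact (norm_sub_le _ _).trans (add_le_add (norm_mul_le _ _) (norm_mul_le _ _))

lemma trace_map_mul_comm_of_isSelfAdjoint (hcontr : ‖ψ‖ ≤ 1) (hpos : ∀ a : A, 0 ≤ a → 0 ≤ ψ a)
    (hstar : ∀ a, ψ (star a) = star (ψ a))
    (hschwarz : ∀ a, star (ψ a) * ψ a ≤ ψ (star a * a))
    (hoz : ∀ a b : A, 0 ≤ a → 0 ≤ b → a * b = 0 → ψ a * ψ b = 0)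
    (τ : B →L[ℂ] ℂ) (hτtr : ∀ x y : B, τ (x * y) = τ (y * x)) {x y : A}
    (hx : IsSelfAdjoint x) (hy : IsSelfAdjoint y) : τ (ψ (x * y)) = τ (ψ (y * x)) := by
  have hl := CStarAlgebra.increasingApproximateUnit A
  set l := CStarAlgebra.approximateUnit A
  have : l.NeBot := hl.neBot
  have ev := hl.eventually_isSelfAdjoint.and hl.eventually_norm
  set w := x * y - y * x with hw
  have hbound : ∀ n : ℕ, n * ‖τ (ψ w)‖ ^ 2 ≤ ‖τ‖ ^ 2 * ‖w‖ ^ 2 := by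
    intro n
    have t1 := tendsto_trace_mapCompl_pow_commutator hcontr hpos hstar hschwarz hoz τ hτtr hl hx hy n
    rw [← hw] at t1
    have t2 : Tendsto (fun e ↦ τ (unitizationAct (mapCompl ψ e ^ n) (ψ (e * w) - ψ w))) l
        (𝓝 0) := by
      have t3 : Tendsto (fun e ↦ ‖τ‖ * ‖ψ (e * w) - ψ w‖) l (𝓝 0) := by
        have := (ψ.continuous.tendsto _).comp (hl.tendsto_mul_right w)
        simpa using ((this.sub_const (ψ w)).norm).const_mul ‖τ‖
      rw [tendsto_zero_iff_norm_tendsto_zero]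
      refine squeeze_zero' (.of_forall fun _ ↦ norm_nonneg _) ?_ t3
      filter_upwards [ev] with e ⟨he, he1⟩
      refine (τ.le_opNorm _).trans (mul_le_mul_of_nonneg_left ?_ (norm_nonneg _))
      exact (norm_unitizationAct_le _ _).trans (mul_le_of_le_one_left (norm_nonneg _)
        (norm_mapCompl_pow_le_one hcontr hpos he he1 n))
    have t4 : Tendsto (fun e ↦ τ (unitizationAct (mapCompl ψ e ^ n) (ψ (e * w)))) l
        (𝓝 (τ (ψ w))) := by
      have := t1.add t2
      simp only [← map_add, add_zero, add_sub_cancel] at this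
      exact this
    refine le_of_tendsto ((t4.norm.pow 2).const_mul (n : ℝ)) ?_
    filter_upwards [ev] with e ⟨he, he1⟩
    have h1 := mul_norm_mapCompl_pow_act_sq_le hcontr hpos hstar hschwarz he he1 n w
    set v := unitizationAct (mapCompl ψ e ^ n) (ψ (e * w))
    have h2 : ‖τ v‖ ^ 2 ≤ (‖τ‖ * ‖v‖) ^ 2 := by gcongr; exact τ.le_opNorm v
    calc _ ≤ n * (‖τ‖ * ‖v‖) ^ 2 := by gcongr
      _ = ‖τ‖ ^ 2 * (n * ‖v‖ ^ 2) := by ring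
      _ ≤ _ := by gcongr
  have hzero : τ (ψ w) = 0 := by
    by_contra hne
    have hpos' : 0 < ‖τ (ψ w)‖ ^ 2 := by positivity
    obtain ⟨n, hn⟩ := exists_nat_gt (‖τ‖ ^ 2 * ‖w‖ ^ 2 / ‖τ (ψ w)‖ ^ 2)
    rw [div_lt_iff₀ hpos'] at hn
    exact absurd (hbound n) (not_le.mpr hn)
  rwa [hw, map_sub, map_sub, sub_eq_zero] at hzero

end Trace

/-- Winter–Zacharias, Corollary on order zero maps and traces.
If `ψ : A → B` is a completely positive contractive order zero map between C*-algebras and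
`τ` is a positive tracial continuous linear functional on `B`, then `τ ∘ ψ` is a positive
tracial functional on `A`.

Here complete positivity is expressed by requiring that the entrywise application of `ψ` to
any positive matrix over `A` (i.e. a matrix of the form `star x * x`) yields a positive matrix
over `B`. -/
theorem order_zero_traces {A B : Type*}
    [NonUnitalCStarAlgebra A] [PartialOrder A] [StarOrderedRing A]
    [NonUnitalCStarAlgebra B] [PartialOrder B] [StarOrderedRing B]
    (ψ : A →L[ℂ] B) (hcontr : ‖ψ‖ ≤ 1)
    (hcp : ∀ (n : ℕ) (m : Matrix (Fin n) (Fin n) A),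
      (∃ x : Matrix (Fin n) (Fin n) A, m = star x * x) →
      ∃ y : Matrix (Fin n) (Fin n) B, m.map ψ = star y * y)
    (hoz : ∀ a b : A, 0 ≤ a → 0 ≤ b → a * b = 0 → ψ a * ψ b = 0)
    (τ : B →L[ℂ] ℂ)
    (hτpos : ∀ b : B, 0 ≤ b → 0 ≤ τ b)
    (hτtr : ∀ x y : B, τ (x * y) = τ (y * x)) :
    (∀ a : A, 0 ≤ a → 0 ≤ τ (ψ a)) ∧ (∀ x y : A, τ (ψ (x * y)) = τ (ψ (y * x))) := by
  have hpos : ∀ a : A, 0 ≤ a → 0 ≤ ψ a := fun a ha ↦ map_nonneg_of_completelyPositive hcp ha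
  have hss := map_star_and_star_mul_self_le_of_completelyPositive hcontr hcp
  refine ⟨fun a ha ↦ hτpos _ (hpos a ha), fun x y ↦ ?_⟩
  have key : ∀ a b : A, IsSelfAdjoint a → IsSelfAdjoint b → τ (ψ (a * b)) = τ (ψ (b * a)) :=
    fun a b ha hb ↦ trace_map_mul_comm_of_isSelfAdjoint hcontr hpos (fun a ↦ (hss a).1)
      (fun a ↦ (hss a).2) hoz τ hτtr ha hb
  rw [← realPart_add_I_smul_imaginaryPart x, ← realPart_add_I_smul_imaginaryPart y]
  simp only [add_mul, mul_add, smul_mul_assoc, mul_smul_comm, map_add, map_smul]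
  rw [key _ _ (realPart x).2 (realPart y).2, key _ _ (realPart x).2 (imaginaryPart y).2,
    key _ _ (imaginaryPart x).2 (realPart y).2, key _ _ (imaginaryPart x).2 (imaginaryPart y).2]
  simp only [smul_eq_mul]
  ring
end

section
/- Let F be a finite-dimensional C*-algebra. For every η > 0 there exists δ > 0 such that the following holds: for every C*-algebra A, every completely positive contractive order zero map φ : F → A, and every positive contraction d in the unitization A⁺ = Unitization(ℂ, A) satisfying ‖d·φ(x) − φ(x)·d‖ ≤ δ·‖x‖ for all x ∈ F (computed in A⁺, with φ(x) viewed in A⁺), there exists a completely positive contractive order zero map φ̂ : F → A such that ‖φ̂(x) − d^{1/2}·φ(x)·d^{1/2}‖ ≤ η·‖x‖ for all x ∈ F, where d^{1/2} is the positive square root of d in A⁺ and the difference is computed in A⁺ (note that d^{1/2}·φ(x)·d^{1/2} lies in A since A is an ideal in A⁺). -/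
/-- A finite-dimensional space with a definite inner product core has an orthonormal basis. -/
theorem InnerProductSpace.Core.exists_orthonormal_expansion {V : Type*} [AddCommGroup V]
    [Module ℂ V] [FiniteDimensional ℂ V] (c : InnerProductSpace.Core ℂ V) :
    ∃ (n : ℕ) (a : Fin n → V), (∀ v, v = ∑ i, c.inner (a i) v • a i) ∧
      ∀ T : V →ₗ[ℂ] V, LinearMap.trace ℂ V T = ∑ i, c.inner (a i) (T (a i)) := by
  let : NormedAddCommGroup V := c.toNormedAddCommGroup
  let : InnerProductSpace ℂ V := InnerProductSpace.ofCore c.toCore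
  exact ⟨_, stdOrthonormalBasis ℂ V, fun v => ((stdOrthonormalBasis ℂ V).sum_repr' v).symm,
    fun T => T.trace_eq_sum_inner (stdOrthonormalBasis ℂ V)⟩

section Trace

open scoped ComplexOrder

variable {F : Type*} [NonUnitalCStarAlgebra F] [PartialOrder F] [StarOrderedRing F]

theorem nonneg_of_mul_eq_smul {a v : F} (ha : 0 ≤ a) (hv : v ≠ 0) {μ : ℂ}
    (h : a * v = μ • v) : 0 ≤ μ := by
  have h1 : 0 ≤ star v * a * v := star_left_conjugate_nonneg ha v
  have h2 : 0 ≤ star v * v := star_mul_self_nonneg v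
  have h3 : star v * v ≠ 0 := by simpa using hv
  rw [mul_assoc, h, mul_smul_comm] at h1
  have h4 : star μ = μ := smul_left_injective ℂ h3 (by
    simpa [star_smul] using h1.isSelfAdjoint.star_eq)
  obtain ⟨r, rfl⟩ := Complex.conj_eq_iff_real.1 h4
  rw [Complex.zero_le_real]
  by_contra! hr
  refine smul_ne_zero hr.ne h3 (le_antisymm (smul_nonpos_of_nonpos_of_nonneg hr.le h2) ?_)
  rwa [Complex.coe_smul] at h1

theorem charpoly_mulLeft_roots_nonneg [FiniteDimensional ℂ F] {a : F} (ha : 0 ≤ a) {μ : ℂ}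
    (hμ : μ ∈ (LinearMap.charpoly (LinearMap.mulLeft ℂ a)).roots) : 0 ≤ μ := by
  have : Module.End.HasEigenvalue (LinearMap.mulLeft ℂ a) μ := by
    rw [Module.End.hasEigenvalue_iff_isRoot_charpoly]
    exact (Polynomial.mem_roots'.1 hμ).2
  obtain ⟨v, hv⟩ := this.exists_hasEigenvector
  exact nonneg_of_mul_eq_smul ha hv.2 hv.apply_eq_smul

theorem trace_mulLeft_nonneg [FiniteDimensional ℂ F] {a : F} (ha : 0 ≤ a) :
    0 ≤ LinearMap.trace ℂ F (LinearMap.mulLeft ℂ a) := by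
  rw [Module.End.trace_eq_sum_roots_charpoly_of_splits (IsAlgClosed.splits _)]
  exact Multiset.sum_nonneg fun μ hμ => charpoly_mulLeft_roots_nonneg ha hμ

theorem eq_zero_of_trace_mulLeft_star_mul_self [FiniteDimensional ℂ F] {x : F}
    (h : LinearMap.trace ℂ F (LinearMap.mulLeft ℂ (star x * x)) = 0) : x = 0 := by
  set a := star x * x with ha
  have ha0 : 0 ≤ a := star_mul_self_nonneg x
  set L := LinearMap.mulLeft ℂ a with hL
  have hnil : L ^ Module.finrank ℂ F = 0 := by
    have hroots : ∀ μ ∈ L.charpoly.roots, μ = 0 := by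
      rw [Module.End.trace_eq_sum_roots_charpoly_of_splits (IsAlgClosed.splits _)] at h
      exact Multiset.all_zero_of_le_zero_le_of_sum_eq_zero
        (fun μ hμ => charpoly_mulLeft_roots_nonneg ha0 hμ) h
    have hs := (IsAlgClosed.splits L.charpoly).eq_prod_roots_of_monic L.charpoly_monic
    rw [Multiset.eq_replicate_of_mem hroots] at hs
    have hc := LinearMap.aeval_self_charpoly L
    rw [hs] at hc
    simpa [← (IsAlgClosed.splits L.charpoly).natDegree_eq_card_roots,
      LinearMap.charpoly_natDegree] using hc
  have hker : ∀ v, L (L v) = 0 → L v = 0 := fun v hv => by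
    simp only [hL, LinearMap.mulLeft_apply] at hv ⊢
    rw [← CStarRing.star_mul_self_eq_zero_iff, star_mul, ha0.isSelfAdjoint.star_eq, mul_assoc, hv,
      mul_zero]
  have hz : ∀ n : ℕ, ∀ v, (L ^ (n + 1)) v = 0 → L v = 0 := by
    intro n
    induction n with
    | zero => intro v hv; simpa using hv
    | succ n ih =>
      intro v hv
      rw [pow_succ, Module.End.mul_apply] at hv
      exact hker v (ih _ hv)
  have h0 : L a = 0 := hz (Module.finrank ℂ F) a (by rw [pow_succ', hnil]; simp)
  rw [hL, LinearMap.mulLeft_apply] at h0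
  rw [← CStarRing.star_mul_self_eq_zero_iff, ← ha, ← CStarRing.star_mul_self_eq_zero_iff,
    ha0.isSelfAdjoint.star_eq, h0]

theorem trace_mulLeft_star [FiniteDimensional ℂ F] (x : F) :
    LinearMap.trace ℂ F (LinearMap.mulLeft ℂ (star x)) =
      star (LinearMap.trace ℂ F (LinearMap.mulLeft ℂ x)) := by
  have hx : x ∈ Submodule.span ℂ {a : F | 0 ≤ a} := by
    rw [CStarAlgebra.span_nonneg]
    exact Submodule.mem_top
  set τ : F →ₗ[ℂ] ℂ := LinearMap.trace ℂ F ∘ₗ LinearMap.mul ℂ F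
  change τ (star x) = star (τ x)
  induction hx using Submodule.span_induction with
  | mem x hx =>
    rw [(LE.le.isSelfAdjoint hx).star_eq]
    exact (trace_mulLeft_nonneg hx).isSelfAdjoint.star_eq.symm
  | zero => simp
  | add x y _ _ hx hy => simp only [star_add, map_add, hx, hy]
  | smul c x _ hx => simp only [star_smul, map_smul, hx, smul_eq_mul, star_mul']

/-- A finite-dimensional C⋆-algebra has a self-adjoint separability idempotent; in particular it
is unital. -/
theorem exists_separability_idempotent [FiniteDimensional ℂ F] :
    ∃ (n : ℕ) (a : Fin n → F),
      (∀ x, ∑ j, (x * a j) ⊗ₜ[ℂ] star (a j) = ∑ j, a j ⊗ₜ[ℂ] (star (a j) * x)) ∧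
      ∀ x, (∑ j, a j * star (a j)) * x = x := by
  set τ : F →ₗ[ℂ] ℂ := LinearMap.trace ℂ F ∘ₗ LinearMap.mul ℂ F with hτ
  have τ_def (x : F) : τ x = LinearMap.trace ℂ F (LinearMap.mulLeft ℂ x) := rfl
  have τ_comm (x y : F) : τ (x * y) = τ (y * x) := by
    simp only [τ_def, LinearMap.mulLeft_mul]
    exact LinearMap.trace_mul_comm ℂ _ _
  have τ_star (x : F) : τ (star x) = star (τ x) := trace_mulLeft_star x
  have τ_def0 (x : F) (h : τ (star x * x) = 0) : x = 0 := eq_zero_of_trace_mulLeft_star_mul_self h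
  let c : InnerProductSpace.Core ℂ F :=
    { inner := fun x y => τ (star x * y)
      conj_inner_symm := fun x y => by
        rw [starRingEnd_apply, ← τ_star, star_mul, star_star]
      re_inner_nonneg := fun x =>
        (Complex.nonneg_iff.1 (trace_mulLeft_nonneg (star_mul_self_nonneg x))).1
      add_left := fun x y z => by rw [star_add, add_mul, map_add]
      smul_left := fun x y r => by
        rw [star_smul, smul_mul_assoc, map_smul, smul_eq_mul, starRingEnd_apply]
      definite := τ_def0 }
  obtain ⟨n, a, ha, htr⟩ := c.exists_orthonormal_expansion
  change ∀ v, v = ∑ i, τ (star (a i) * v) • a i at ha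
  change ∀ T : F →ₗ[ℂ] F, LinearMap.trace ℂ F T = ∑ i, τ (star (a i) * T (a i)) at htr
  refine ⟨n, a, fun x => ?_, fun x => ?_⟩
  · have h1 (j) : x * a j = ∑ i, τ (star (a i) * (x * a j)) • a i := ha _
    have h2 (i) : star (a i) * x = ∑ j, τ (star (a i) * (x * a j)) • star (a j) := by
      have := congrArg star (ha (star x * a i))
      simpa [star_sum, star_smul, ← τ_star, mul_assoc] using this
    calc _ = ∑ j, ∑ i, τ (star (a i) * (x * a j)) • (a i ⊗ₜ[ℂ] star (a j)) := by
          refine Finset.sum_congr rfl fun j _ => ?_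
          conv_lhs => rw [h1 j]
          simp only [TensorProduct.sum_tmul, TensorProduct.smul_tmul']
      _ = _ := by
          rw [Finset.sum_comm]
          refine Finset.sum_congr rfl fun i _ => ?_
          conv_rhs => rw [h2 i]
          simp only [TensorProduct.tmul_sum, TensorProduct.tmul_smul]
  · set z := ∑ j, a j * star (a j) with hz
    have h1 (y : F) : τ (y * z) = τ y := by
      rw [τ_def y, htr, hz, Finset.mul_sum, map_sum]
      refine Finset.sum_congr rfl fun j _ => ?_
      rw [τ_comm (star (a j)), LinearMap.mulLeft_apply, mul_assoc]
    refine sub_eq_zero.1 (τ_def0 _ ?_)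
    rw [mul_sub, map_sub, τ_comm, τ_comm _ x, mul_assoc, τ_comm z, mul_assoc, sub_eq_zero]
    have := h1 (x * star (z * x - x))
    rwa [mul_assoc] at this

end Trace

section Spectral

theorem finite_spectrum_of_finiteDimensional {B : Type*} [Ring B] [Algebra ℂ B]
    [FiniteDimensional ℂ B] (b : B) : (spectrum ℂ b).Finite := by
  nontriviality B
  refine ((minpoly ℂ b).rootSet_finite ℂ).subset fun z hz => ?_
  have h := spectrum.subset_polynomial_aeval b (minpoly ℂ b) (Set.mem_image_of_mem _ hz)
  rw [minpoly.aeval, spectrum.zero_eq, Set.mem_singleton_iff] at h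
  exact (Polynomial.mem_rootSet.2 ⟨minpoly.ne_zero (Algebra.IsIntegral.isIntegral b), by
    simpa [Polynomial.aeval_def] using h⟩)

variable {F : Type*} [NonUnitalCStarAlgebra F]

theorem finite_quasispectrum_real [FiniteDimensional ℂ F] (a : F) :
    (quasispectrum ℝ a).Finite := by
  rw [← quasispectrum.preimage_algebraMap ℂ, Unitization.quasispectrum_eq_spectrum_inr ℂ]
  have : FiniteDimensional ℂ (Unitization ℂ F) :=
    Module.Finite.equiv (Unitization.linearEquiv ℂ ℂ F).symm
  exact (finite_spectrum_of_finiteDimensional _).preimage (algebraMap ℝ ℂ).injective.injOn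

theorem IsSelfAdjoint.exists_spectral_decomposition [PartialOrder F] [StarOrderedRing F]
    [FiniteDimensional ℂ F] {a : F} (ha : IsSelfAdjoint a) :
    ∃ (S : Finset ℝ) (p : ℝ → F), (∀ i, IsSelfAdjoint (p i)) ∧ (∀ i ∈ S, p i * p i = p i) ∧
      (∀ i ∈ S, ∀ j ∈ S, i ≠ j → p i * p j = 0) ∧ a = ∑ i ∈ S, i • p i := by
  have hfin := finite_quasispectrum_real a
  have hc (f : ℝ → ℝ) : ContinuousOn f (quasispectrum ℝ a) := hfin.continuousOn f
  let f : ℝ → ℝ → ℝ := fun i t => if t = i then 1 else 0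
  have hf0 {i : ℝ} (hi : i ≠ 0) : f i 0 = 0 := if_neg hi.symm
  refine ⟨hfin.toFinset.erase 0, fun i => cfcₙ (f i) a, fun i => cfcₙ_predicate _ _,
    fun i hi => ?_, fun i hi j hj hij => ?_, ?_⟩
  · have := hf0 (Finset.ne_of_mem_erase hi)
    rw [← cfcₙ_mul (f i) (f i) a (hc _) this (hc _) this]
    congr 1
    ext t
    simp [f]
  · rw [← cfcₙ_mul (f i) (f j) a (hc _) (hf0 (Finset.ne_of_mem_erase hi)) (hc _)
      (hf0 (Finset.ne_of_mem_erase hj)), ← cfcₙ_zero ℝ a]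
    congr 1
    ext t
    simp only [f, Pi.zero_apply]
    grind
  · have h0 (i) (hi : i ∈ hfin.toFinset.erase 0) := hf0 (Finset.ne_of_mem_erase hi)
    rw [Finset.sum_congr rfl fun i hi => (cfcₙ_smul i (f i) a (hc _) (h0 i hi)).symm,
      ← cfcₙ_sum (fun i t => i • f i t) a _ (fun i _ => hc _) (fun i hi => by simp [h0 i hi])]
    conv_lhs => rw [← cfcₙ_id' ℝ a]
    refine cfcₙ_congr fun t ht => ?_
    simp only [Finset.sum_apply, f, smul_eq_mul, mul_ite, mul_one, mul_zero]
    rw [Finset.sum_ite_eq]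
    by_cases h : t = 0 <;> simp [h, ht]

end Spectral

section OrderZero

/-- Complete positivity: the entrywise maps preserve matrices of the form `star x * x`. -/
def IsCP {F A : Type*} [NonUnitalSemiring F] [StarRing F] [NonUnitalSemiring A] [StarRing A]
    (φ : F → A) : Prop :=
  ∀ (n : ℕ) (m : Matrix (Fin n) (Fin n) F), (∃ x : Matrix (Fin n) (Fin n) F, m = star x * x) →
    ∃ y : Matrix (Fin n) (Fin n) A, m.map φ = star y * y

/-- The order zero condition: orthogonality of positive elements is preserved. -/
def IsOrderZero {F A : Type*} [NonUnitalSemiring F] [LE F] [NonUnitalSemiring A]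
    (φ : F → A) : Prop :=
  ∀ a b : F, 0 ≤ a → 0 ≤ b → a * b = 0 → φ a * φ b = 0

theorem star_eq_of_isLeftUnit {R : Type*} [Mul R] [StarMul R] {e : R} (he : ∀ x, e * x = x) :
    star e = e := by
  have h := congrArg star (he (star e))
  rw [star_mul, star_star, he] at h
  exact h

theorem IsCP.exists_two_by_two {F A : Type*} [NonUnitalCStarAlgebra F] [NonUnitalCStarAlgebra A]
    {e : F} (he : ∀ x, e * x = x) (he' : ∀ x, x * e = x)
    {φ : F →ₗ[ℂ] A} (hcp : IsCP φ) (x : F) :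
    ∃ y : Matrix (Fin 2) (Fin 2) A,
      φ (star x * x) = star (y 0 0) * y 0 0 + star (y 1 0) * y 1 0 ∧
      φ (star x) = star (y 0 0) * y 0 1 + star (y 1 0) * y 1 1 ∧
      φ x = star (y 0 1) * y 0 0 + star (y 1 1) * y 1 0 ∧
      φ e = star (y 0 1) * y 0 1 + star (y 1 1) * y 1 1 := by
  have hes := star_eq_of_isLeftUnit he
  obtain ⟨y, hy⟩ := hcp 2 _ ⟨!![x, e; 0, 0], rfl⟩
  have h (i j) := congrFun (congrFun hy i) j
  refine ⟨y, ?_, ?_, ?_, ?_⟩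
  · simpa [Matrix.star_eq_conjTranspose, Matrix.mul_apply, hes, he, he'] using h 0 0
  · simpa [Matrix.star_eq_conjTranspose, Matrix.mul_apply, hes, he, he'] using h 0 1
  · simpa [Matrix.star_eq_conjTranspose, Matrix.mul_apply, hes, he, he'] using h 1 0
  · simpa [Matrix.star_eq_conjTranspose, Matrix.mul_apply, hes, he, he'] using h 1 1

theorem IsCP.map_star {F A : Type*} [NonUnitalCStarAlgebra F] [NonUnitalCStarAlgebra A]
    {e : F} (he : ∀ x, e * x = x) (he' : ∀ x, x * e = x)
    {φ : F →ₗ[ℂ] A} (hcp : IsCP φ) (x : F) : φ (star x) = star (φ x) := by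
  obtain ⟨y, -, h1, h2, -⟩ := hcp.exists_two_by_two he he' x
  rw [h1, h2]
  simp

theorem IsCP.map_unit_nonneg {F A : Type*} [NonUnitalCStarAlgebra F] [NonUnitalCStarAlgebra A]
    [PartialOrder A] [StarOrderedRing A] {e : F} (he : ∀ x, e * x = x) (he' : ∀ x, x * e = x)
    {φ : F →ₗ[ℂ] A} (hcp : IsCP φ) : 0 ≤ φ e := by
  obtain ⟨y, -, -, -, h⟩ := hcp.exists_two_by_two he he' 0
  rw [h]
  exact add_nonneg (star_mul_self_nonneg _) (star_mul_self_nonneg _)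

variable {F A : Type*} [NonUnitalCStarAlgebra F] [PartialOrder F] [StarOrderedRing F]
  [NonUnitalCStarAlgebra A]

theorem orderZero_jordan_of_isSelfAdjoint [FiniteDimensional ℂ F] {e : F}
    (he : ∀ x, e * x = x) (he' : ∀ x, x * e = x) (φ : F →ₗ[ℂ] A)
    (hφ : IsOrderZero φ) {a : F} (ha : IsSelfAdjoint a) :
    φ e * φ a = φ a * φ e ∧ φ a * φ a = φ e * φ (a * a) := by
  have hes : star e = e := star_eq_of_isLeftUnit he
  obtain ⟨S, p, hp, hpp, hpq, hS⟩ := ha.exists_spectral_decomposition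
  set q := e - ∑ i ∈ S, p i with hq
  have hpn {i} (hi : i ∈ S) : 0 ≤ p i := by
    rw [← hpp i hi]
    nth_rw 1 [← (hp i).star_eq]
    exact star_mul_self_nonneg _
  have hsum {i} (hi : i ∈ S) : (∑ j ∈ S, p j) * p i = p i := by
    rw [Finset.sum_mul, Finset.sum_eq_single_of_mem i hi fun j hj hji => hpq j hj i hi hji, hpp i hi]
  have hsum' {i} (hi : i ∈ S) : p i * (∑ j ∈ S, p j) = p i := by
    rw [Finset.mul_sum, Finset.sum_eq_single_of_mem i hi fun j hj hji => hpq i hi j hj hji.symm,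
      hpp i hi]
  have hqp {i} (hi : i ∈ S) : q * p i = 0 := by rw [hq, sub_mul, he, hsum hi, sub_self]
  have hpq' {i} (hi : i ∈ S) : p i * q = 0 := by rw [hq, mul_sub, he', hsum' hi, sub_self]
  have hqn : 0 ≤ q := by
    have h1 : q = star q * q := by
      have : star q = q := by simp [hq, hes, fun i => (hp i).star_eq]
      rw [this]
      nth_rw 2 [hq]
      rw [mul_sub, he', Finset.mul_sum, Finset.sum_eq_zero fun i hi => hqp hi, sub_zero]
    rw [h1]
    exact star_mul_self_nonneg _
  have hφe : φ e = φ q + ∑ i ∈ S, φ (p i) := by rw [hq, map_sub, map_sum]; abel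
  have hφa : φ a = ∑ i ∈ S, i • φ (p i) := by
    rw [hS, map_sum]; exact Finset.sum_congr rfl fun i _ => LinearMap.map_smul_of_tower _ _ _
  have hmul (g k : ℝ → ℝ) : (∑ i ∈ S, g i • φ (p i)) * (∑ i ∈ S, k i • φ (p i)) =
      ∑ i ∈ S, (g i * k i) • (φ (p i) * φ (p i)) := by
    rw [Finset.sum_mul]
    refine Finset.sum_congr rfl fun i hi => ?_
    rw [Finset.mul_sum, Finset.sum_eq_single_of_mem i hi fun j hj hji => ?_, smul_mul_smul_comm]
    rw [smul_mul_smul_comm, hφ _ _ (hpn hi) (hpn hj) (hpq i hi j hj hji.symm), smul_zero]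
  have hmulF : a * a = ∑ i ∈ S, (i * i) • p i := by
    conv_lhs => rw [hS]
    rw [Finset.sum_mul]
    refine Finset.sum_congr rfl fun i hi => ?_
    rw [Finset.mul_sum, Finset.sum_eq_single_of_mem i hi fun j hj hji => ?_, smul_mul_smul_comm,
      hpp i hi]
    rw [smul_mul_smul_comm, hpq i hi j hj hji.symm, smul_zero]
  have hφaa : φ (a * a) = ∑ i ∈ S, (i * i) • φ (p i) := by
    rw [hmulF, map_sum]; exact Finset.sum_congr rfl fun i _ => LinearMap.map_smul_of_tower _ _ _
  have hone : ∑ i ∈ S, φ (p i) = ∑ i ∈ S, (1 : ℝ) • φ (p i) := by simp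
  have hq0 (g : ℝ → ℝ) : φ q * ∑ i ∈ S, g i • φ (p i) = 0 := by
    rw [Finset.mul_sum]
    refine Finset.sum_eq_zero fun i hi => ?_
    rw [mul_smul_comm, hφ _ _ hqn (hpn hi) (hqp hi), smul_zero]
  have hq0' (g : ℝ → ℝ) : (∑ i ∈ S, g i • φ (p i)) * φ q = 0 := by
    rw [Finset.sum_mul]
    refine Finset.sum_eq_zero fun i hi => ?_
    rw [smul_mul_assoc, hφ _ _ (hpn hi) hqn (hpq' hi), smul_zero]
  constructor
  · rw [hφe, hφa, add_mul, mul_add, hq0, hq0', hone, hmul, hmul]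
    simp
  · rw [hφaa, hφe, hφa, add_mul, hq0, hone, hmul, hmul]
    simp

theorem orderZero_commute [FiniteDimensional ℂ F] {e : F}
    (he : ∀ x, e * x = x) (he' : ∀ x, x * e = x) {φ : F →ₗ[ℂ] A}
    (hφ : IsOrderZero φ) (x : F) : φ e * φ x = φ x * φ e := by
  obtain ⟨a, b, rfl⟩ : ∃ a b : selfAdjoint F, x = a + Complex.I • (b : F) :=
    ⟨realPart x, imaginaryPart x, (realPart_add_I_smul_imaginaryPart x).symm⟩
  simp only [map_add, map_smul, mul_add, add_mul, mul_smul_comm, smul_mul_assoc,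
    (orderZero_jordan_of_isSelfAdjoint he he' φ hφ a.2).1,
    (orderZero_jordan_of_isSelfAdjoint he he' φ hφ b.2).1]

theorem orderZero_jordan [FiniteDimensional ℂ F] {e : F}
    (he : ∀ x, e * x = x) (he' : ∀ x, x * e = x) {φ : F →ₗ[ℂ] A}
    (hφ : IsOrderZero φ) (x : F) :
    φ (star x) * φ x + φ x * φ (star x) = φ e * φ (star x * x + x * star x) := by
  obtain ⟨a, b, rfl⟩ : ∃ a b : selfAdjoint F, x = a + Complex.I • (b : F) :=
    ⟨realPart x, imaginaryPart x, (realPart_add_I_smul_imaginaryPart x).symm⟩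
  have ha := (orderZero_jordan_of_isSelfAdjoint he he' φ hφ a.2).2
  have hb := (orderZero_jordan_of_isSelfAdjoint he he' φ hφ b.2).2
  have h1 : star ((a : F) + Complex.I • (b : F)) = a - Complex.I • (b : F) := by
    simp [star_smul, a.2.star_eq, b.2.star_eq, sub_eq_add_neg]
  rw [h1]
  simp only [map_add, map_sub, map_smul, mul_add, add_mul, mul_sub, sub_mul, mul_smul_comm,
    smul_mul_assoc, smul_sub, smul_add, smul_smul, Complex.I_mul_I, ha, hb]
  module

variable [PartialOrder A] [StarOrderedRing A]

/-- Weighted Kadison-Schwarz inequality. -/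
theorem IsCP.schwarz [FiniteDimensional ℂ F] {e : F} (he : ∀ x, e * x = x) (he' : ∀ x, x * e = x)
    {φ : F →ₗ[ℂ] A} (hcp : IsCP φ) (hφ : IsOrderZero φ) (x : F) :
    0 ≤ φ e * (φ e * φ (star x * x) - φ (star x) * φ x) := by
  obtain ⟨y, h1, h2, h3, h4⟩ := hcp.exists_two_by_two he he' x
  have hs := hcp.map_star he he' x
  have hc := orderZero_commute he he' hφ
  have hh : star (φ e) = φ e := (hcp.map_unit_nonneg he he').isSelfAdjoint.star_eq
  set h := φ e
  set w : Fin 2 → A := fun i => y i 0 * h - y i 1 * φ x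
  have hw : star (w 0) * w 0 + star (w 1) * w 1 =
      h * φ (star x * x) * h - h * φ (star x) * φ x - φ (star x) * φ x * h
        + φ (star x) * h * φ x := by
    have e1 : star (w 0) * w 0 + star (w 1) * w 1 =
      h * (star (y 0 0) * y 0 0 + star (y 1 0) * y 1 0) * h
        - h * (star (y 0 0) * y 0 1 + star (y 1 0) * y 1 1) * φ x
        - star (φ x) * (star (y 0 1) * y 0 0 + star (y 1 1) * y 1 0) * h
        + star (φ x) * (star (y 0 1) * y 0 1 + star (y 1 1) * y 1 1) * φ x := by
      simp only [w, star_sub, star_mul, hh]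
      noncomm_ring
    rw [e1, ← h1, ← h2, ← h3, ← h4, hs]
  have : h * (h * φ (star x * x) - φ (star x) * φ x) = star (w 0) * w 0 + star (w 1) * w 1 := by
    rw [hw, mul_assoc h, ← hc, mul_assoc (φ (star x)) (φ x), ← hc x, ← hc (star x), mul_assoc h,
      ← mul_assoc (φ (star x)) h, ← hc (star x), mul_sub, mul_assoc h]
    abel
  rw [this]
  exact add_nonneg (star_mul_self_nonneg _) (star_mul_self_nonneg _)

/-- A completely positive order zero map on a unital algebra is multiplicative up to the weight
`φ e`. -/
theorem IsCP.map_star_mul_self [FiniteDimensional ℂ F] {e : F} (he : ∀ x, e * x = x)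
    (he' : ∀ x, x * e = x) {φ : F →ₗ[ℂ] A} (hcp : IsCP φ) (hφ : IsOrderZero φ) (x : F) :
    φ (star x) * φ x = φ e * φ (star x * x) := by
  have hs := hcp.map_star he he' x
  have hc := orderZero_commute he he' hφ
  have hh : star (φ e) = φ e := (hcp.map_unit_nonneg he he').isSelfAdjoint.star_eq
  have h1 := hcp.schwarz he he' hφ x
  have h2 := hcp.schwarz he he' hφ (star x)
  have hj := orderZero_jordan he he' hφ x
  rw [star_star] at h2
  set h := φ e
  set D := h * φ (star x * x) - φ (star x) * φ x with hD
  have hD' : h * φ (x * star x) - φ x * φ (star x) = -D := by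
    rw [map_add, mul_add] at hj
    rw [hD, neg_sub, sub_eq_sub_iff_add_eq_add, add_comm (h * φ (x * star x)), ← hj]
  have hhD : h * D = 0 := by
    rw [hD', mul_neg] at h2
    exact le_antisymm (neg_nonneg.1 h2) h1
  have hDs : star D = D := by
    have := hcp.map_star he he' (star x * x)
    rw [star_mul, star_star] at this
    rw [hD, star_sub, star_mul, star_mul, ← this, hh, hs, star_star, hc]
  have hDh : D * h = 0 := by simpa [hDs, hh] using congrArg star hhD
  have h3 : D * (φ (star x) * φ x) * D + D * (φ x * φ (star x)) * D = 0 := by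
    rw [← add_mul, ← mul_add, hj, ← mul_assoc, hDh, zero_mul, zero_mul]
  have p1 : 0 ≤ D * (φ (star x) * φ x) * D := by
    rw [hs]
    nth_rw 1 [← hDs]
    exact star_left_conjugate_nonneg (star_mul_self_nonneg _) _
  have p2 : 0 ≤ D * (φ x * φ (star x)) * D := by
    rw [hs]
    nth_rw 1 [← hDs]
    exact star_left_conjugate_nonneg (mul_star_self_nonneg _) _
  have h4 : D * (φ (star x) * φ x) * D = 0 := ((add_eq_zero_iff_of_nonneg p1 p2).1 h3).1
  have h5 : φ x * D = 0 := by
    rw [← CStarRing.star_mul_self_eq_zero_iff, star_mul, hDs, ← hs, ← h4]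
    simp only [mul_assoc]
  have h6 : D = 0 := by
    rw [← CStarRing.star_mul_self_eq_zero_iff, hDs]
    nth_rw 1 [hD]
    rw [sub_mul, mul_assoc (φ (star x)), h5, mul_zero, sub_zero, hc, mul_assoc, hhD, mul_zero]
  exact (sub_eq_zero.1 h6).symm

theorem IsCP.map_mul_map [FiniteDimensional ℂ F] {e : F} (he : ∀ x, e * x = x)
    (he' : ∀ x, x * e = x) {φ : F →ₗ[ℂ] A} (hcp : IsCP φ) (hφ : IsOrderZero φ) (x y : F) :
    φ x * φ y = φ e * φ (x * y) := by
  have hm := hcp.map_star_mul_self he he' hφ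
  have h1 := hm (star x + y)
  have h2 := hm (star x + Complex.I • y)
  have hx := hm (star x)
  have hy := hm y
  rw [star_star] at hx
  simp only [star_add, star_star, star_smul, map_add, map_smul, mul_add, add_mul, mul_smul_comm,
    smul_mul_assoc, smul_add, Complex.star_def, Complex.conj_I, hx, hy] at h1 h2
  have hP : (φ x * φ y - φ e * φ (x * y)) +
      (φ (star y) * φ (star x) - φ e * φ (star y * star x)) = 0 := by
    rw [← sub_eq_zero] at h1
    rw [← h1]
    abel
  have hQ : Complex.I • (φ x * φ y - φ e * φ (x * y)) -
      Complex.I • (φ (star y) * φ (star x) - φ e * φ (star y * star x)) = 0 := by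
    rw [← sub_eq_zero] at h2
    rw [← h2]
    module
  rw [← smul_sub, smul_eq_zero_iff_right Complex.I_ne_zero, sub_eq_zero] at hQ
  rw [← hQ] at hP
  rwa [← two_smul ℂ, smul_eq_zero_iff_right two_ne_zero, sub_eq_zero] at hP

end OrderZero

section Approx

open Polynomial

theorem norm_mul_commutator_le {B : Type*} [NormedRing B] (a b c : B) :
    ‖a * b * c - c * (a * b)‖ ≤ ‖a‖ * ‖b * c - c * b‖ + ‖a * c - c * a‖ * ‖b‖ := by
  have : a * b * c - c * (a * b) = a * (b * c - c * b) + (a * c - c * a) * b := by noncomm_ring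
  rw [this]
  exact (norm_add_le _ _).trans (add_le_add (norm_mul_le _ _) (norm_mul_le _ _))

/-- Polynomials in a contraction are bounded and their commutators are controlled, uniformly over
all normed algebras. -/
theorem Polynomial.exists_commutator_bound (p : ℝ[X]) :
    ∃ M : ℝ, 0 ≤ M ∧ ∀ (B : Type*) [NormedRing B] [NormOneClass B] [NormedAlgebra ℝ B] (u : B),
      ‖u‖ ≤ 1 → ‖aeval u p‖ ≤ M ∧
        ∀ b : B, ‖aeval u p * b - b * aeval u p‖ ≤ M * ‖u * b - b * u‖ := by
  induction p using Polynomial.induction_on' with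
  | add p q hp hq =>
    obtain ⟨M, hM, hp⟩ := hp
    obtain ⟨N, hN, hq⟩ := hq
    refine ⟨M + N, add_nonneg hM hN, fun B _ _ _ u hu => ⟨?_, fun b => ?_⟩⟩
    · rw [map_add]
      exact (norm_add_le _ _).trans (add_le_add (hp B u hu).1 (hq B u hu).1)
    · have : aeval u (p + q) * b - b * aeval u (p + q) =
          (aeval u p * b - b * aeval u p) + (aeval u q * b - b * aeval u q) := by
        rw [map_add]; noncomm_ring
      rw [this, add_mul]
      exact (norm_add_le _ _).trans (add_le_add ((hp B u hu).2 b) ((hq B u hu).2 b))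
  | monomial n c =>
    refine ⟨|c| * (n + 1), by positivity, fun B _ _ _ u hu => ?_⟩
    have hpow (k : ℕ) : ‖u ^ k‖ ≤ 1 := (norm_pow_le u k).trans (pow_le_one₀ (norm_nonneg _) hu)
    have hcomm (k : ℕ) (b : B) : ‖u ^ k * b - b * u ^ k‖ ≤ k * ‖u * b - b * u‖ := by
      induction k with
      | zero => simp
      | succ k ih =>
        rw [pow_succ]
        refine (norm_mul_commutator_le _ _ _).trans ?_
        push_cast
        nlinarith [hpow k, norm_nonneg (u * b - b * u), norm_nonneg (u ^ k * b - b * u ^ k),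
          mul_le_mul_of_nonneg_right (hpow k) (norm_nonneg (u * b - b * u)),
          mul_le_mul_of_nonneg_left hu (norm_nonneg (u ^ k * b - b * u ^ k))]
    rw [aeval_monomial, ← Algebra.smul_def]
    constructor
    · rw [norm_smul, Real.norm_eq_abs]
      have := (Nat.cast_nonneg n : (0 : ℝ) ≤ n)
      gcongr
      linarith [hpow n]
    · intro b
      rw [smul_mul_assoc, mul_smul_comm, ← smul_sub, norm_smul, Real.norm_eq_abs, mul_assoc]
      gcongr
      refine (hcomm n b).trans ?_
      gcongr
      linarith

/-- The square root of positive contractions is uniformly approximated by a real polynomial without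
constant term. -/
theorem exists_polynomial_near_sqrt {ε : ℝ} (hε : 0 < ε) :
    ∃ p : ℝ[X], ∀ (B : Type*) [CStarAlgebra B] [Nontrivial B] [PartialOrder B]
      [StarOrderedRing B] (u : B),
      0 ≤ u → ‖u‖ ≤ 1 → ‖aeval u (X * p) - CFC.sqrt u‖ ≤ ε := by
  obtain ⟨q, hq⟩ := exists_polynomial_near_of_continuousOn 0 1 Real.sqrt
    Real.continuous_sqrt.continuousOn (ε / 2) (half_pos hε)
  refine ⟨q.divX, fun B _ _ _ _ u hu0 hu1 => ?_⟩
  have hX : X * q.divX = q - C (q.eval 0) := by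
    rw [← coeff_zero_eq_eval_zero]
    nth_rw 2 [← X_mul_divX_add q]
    ring
  rw [CFC.sqrt_eq_real_sqrt u, cfcₙ_eq_cfc, hX, ← cfc_polynomial _ u, ← cfc_sub ..]
  refine norm_cfc_le hε.le fun t ht => ?_
  have ht0 : 0 ≤ t := spectrum_nonneg_of_nonneg hu0 ht
  have ht1 : t ≤ 1 := by
    exact (le_abs_self t).trans ((spectrum.norm_le_norm_of_mem ht).trans hu1)
  have h1 := hq t ⟨ht0, ht1⟩
  have h2 := hq 0 ⟨le_rfl, zero_le_one⟩
  rw [Real.sqrt_zero, sub_zero] at h2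
  rw [eval_sub, eval_C, Real.norm_eq_abs]
  rw [abs_lt] at h1 h2
  rw [abs_le]
  constructor <;> linarith

end Approx

section Estimate

open Polynomial

theorem norm_mul_self_sub_mul_self_le {B : Type*} [NormedRing B] {k s : B} {ε : ℝ} (hε : ε ≤ 1)
    (hk : ‖k - s‖ ≤ ε) (hs : ‖s‖ ≤ 1) : ‖k * k - s * s‖ ≤ 3 * ε := by
  have h : k * k - s * s = (k - s) * (k - s) + (k - s) * s + s * (k - s) := by noncomm_ring
  rw [h]
  refine norm_add₃_le.trans ?_
  have h1 := norm_mul_le (k - s) (k - s)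
  have h2 := norm_mul_le (k - s) s
  have h3 := norm_mul_le s (k - s)
  have h0 := norm_nonneg (k - s)
  nlinarith [norm_nonneg s]

theorem norm_commutator_le_of_near {B : Type*} [NormedRing B] {k s b : B} {ε c : ℝ}
    (hk : ‖k - s‖ ≤ ε) (hb : ‖k * b - b * k‖ ≤ c) : ‖b * s - s * b‖ ≤ 2 * ε * ‖b‖ + c := by
  have h : b * s - s * b = (k - s) * b + b * (s - k) + -(k * b - b * k) := by noncomm_ring
  rw [h]
  refine norm_add₃_le.trans ?_
  have h1 := norm_mul_le (k - s) b
  have h2 := norm_mul_le b (s - k)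
  rw [norm_sub_rev s k] at h2
  rw [norm_neg]
  nlinarith [norm_nonneg b]

theorem norm_sum_mul_commutator_le {F B : Type*} [NonUnitalCStarAlgebra F] [NormedRing B] {n : ℕ}
    (a : Fin n → F) {ψ : F → B} {d : B} {M K : ℝ} (hM : 0 ≤ M) (hK : 0 ≤ K)
    (hψ : ∀ x, ‖ψ x‖ ≤ M * ‖x‖) (hd : ∀ x, ‖d * ψ x - ψ x * d‖ ≤ K * ‖x‖) (x : F) :
    ‖∑ j, ψ (a j) * d * ψ (star (a j) * x) - (∑ j, ψ (a j) * ψ (star (a j) * x)) * d‖ ≤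
      M * K * (∑ j, ‖a j‖ ^ 2) * ‖x‖ := by
  rw [Finset.sum_mul, ← Finset.sum_sub_distrib, Finset.mul_sum, Finset.sum_mul]
  refine norm_sum_le_of_le _ fun j _ => ?_
  rw [mul_assoc, mul_assoc (ψ _), ← mul_sub]
  refine (norm_mul_le _ _).trans ?_
  calc _ ≤ M * ‖a j‖ * (K * (‖a j‖ * ‖x‖)) := by
        refine mul_le_mul (hψ _) ((hd _).trans ?_) (norm_nonneg _) (by positivity)
        have := norm_mul_le (star (a j)) x
        rw [norm_star] at this
        gcongr
    _ = _ := by ring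

theorem norm_weighted_le {F B : Type*} [NonUnitalCStarAlgebra F] [CStarAlgebra B] {e : F}
    {Φ : F →L[ℂ] B}
    (hstar : ∀ x, Φ (star x) = star (Φ x)) (hmul : ∀ x y, Φ x * Φ y = Φ e * Φ (x * y))
    {r : B} (hr : star r = r) (hcomm : ∀ x, r * Φ x = Φ x * r) {κ : ℝ} (hκ : ‖r * Φ e‖ ≤ κ)
    (x : F) : ‖r * Φ x‖ ≤ κ * ‖x‖ := by
  have hκ0 : 0 ≤ κ := (norm_nonneg _).trans hκ
  set T : F →L[ℂ] B := (ContinuousLinearMap.mul ℂ B r).comp Φ with hT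
  have hTx (x : F) : T x = r * Φ x := rfl
  have h1 (x : F) : ‖T x‖ ≤ √(κ * ‖T‖) * ‖x‖ := by
    have key : star (T x) * T x = (r * Φ e) * T (star x * x) := by
      calc star (T x) * T x = (Φ (star x) * r) * (r * Φ x) := by
            rw [hTx, star_mul, hr, ← hstar]
        _ = r * (r * (Φ e * Φ (star x * x))) := by
            rw [← hcomm (star x), mul_assoc, ← mul_assoc (Φ (star x)) r, ← hcomm (star x),
              mul_assoc, hmul]
        _ = (r * Φ e) * (r * Φ (star x * x)) := by
            rw [← mul_assoc r (Φ e), hcomm e, mul_assoc (Φ e), ← mul_assoc r, hcomm e]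
    have hn : ‖T x‖ ^ 2 ≤ κ * ‖T‖ * ‖x‖ ^ 2 := by
      rw [sq, ← CStarRing.norm_star_mul_self, key, sq ‖x‖,
        ← CStarRing.norm_star_mul_self, mul_assoc κ]
      exact (norm_mul_le _ _).trans (mul_le_mul hκ (T.le_opNorm _) (norm_nonneg _) hκ0)
    rw [← Real.sqrt_sq (norm_nonneg x), ← Real.sqrt_mul (by positivity)]
    exact Real.le_sqrt_of_sq_le hn
  have h2 : ‖T‖ ≤ √(κ * ‖T‖) := T.opNorm_le_bound (Real.sqrt_nonneg _) h1
  have h3 : ‖T‖ ≤ κ := by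
    have h4 := mul_self_le_mul_self (norm_nonneg T) h2
    rw [Real.mul_self_sqrt (by positivity)] at h4
    by_contra! h5
    nlinarith
  exact (T.le_opNorm x).trans (mul_le_mul_of_nonneg_right h3 (norm_nonneg x))

theorem norm_sqrt_le_one {B : Type*} [CStarAlgebra B] [PartialOrder B] [StarOrderedRing B] {u : B}
    (h0 : 0 ≤ u) (h1 : ‖u‖ ≤ 1) : ‖CFC.sqrt u‖ ≤ 1 := by
  have h : ‖CFC.sqrt u‖ * ‖CFC.sqrt u‖ = ‖u‖ := by
    rw [← CStarRing.norm_star_mul_self, (CFC.sqrt_nonneg u).isSelfAdjoint.star_eq,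
      CFC.sqrt_mul_sqrt_self u]
  nlinarith [norm_nonneg (CFC.sqrt u)]

theorem star_aeval_of_isSelfAdjoint {B : Type*} [CStarAlgebra B] {u : B} (hu : IsSelfAdjoint u)
    (p : ℝ[X]) : star (aeval u p) = aeval u p := by
  rw [← cfc_polynomial p u hu]
  exact (cfc_predicate _ _ : IsSelfAdjoint _).star_eq

/-- If `u * p(u)` is close to `√u`, then weighting an order zero map twice by `p (Φ e)` and by
`Φ e` almost gives back the map. -/
theorem norm_weight_sub_one_mul_le {F B : Type*} [NonUnitalCStarAlgebra F] [CStarAlgebra B]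
    [PartialOrder B] [StarOrderedRing B] {e : F} {Φ : F →L[ℂ] B}
    (hstar : ∀ x, Φ (star x) = star (Φ x)) (hmul : ∀ x y, Φ x * Φ y = Φ e * Φ (x * y))
    (hcomm : ∀ x, Φ e * Φ x = Φ x * Φ e) (h0 : 0 ≤ Φ e) (h1 : ‖Φ e‖ ≤ 1) {g : B}
    (hgs : star g = g) (hg : ∀ x, g * Φ x = Φ x * g) {ε : ℝ} (hε : ε ≤ 1)
    (hp : ‖Φ e * g - CFC.sqrt (Φ e)‖ ≤ ε) (x : F) :
    ‖(g * g * Φ e - 1) * Φ x‖ ≤ 3 * ε * ‖x‖ := by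
  refine norm_weighted_le hstar hmul ?_ (fun x => ?_) ?_ x
  · simp only [star_sub, star_mul, star_one, hgs, h0.isSelfAdjoint.star_eq]
    rw [← mul_assoc, ← hg, mul_assoc, ← hg, mul_assoc]
  · rw [sub_mul, mul_sub, one_mul, mul_one]
    simp only [mul_assoc]
    rw [hcomm, ← mul_assoc g (Φ x), hg x, mul_assoc (Φ x), ← mul_assoc g (Φ x), hg x, mul_assoc]
  · have : (g * g * Φ e - 1) * Φ e =
        (Φ e * g) * (Φ e * g) - CFC.sqrt (Φ e) * CFC.sqrt (Φ e) := by
      rw [CFC.sqrt_mul_sqrt_self _ h0, sub_mul, one_mul, ← hg]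
      simp only [mul_assoc]
      rw [← mul_assoc (Φ e) g, ← hg, mul_assoc]
    rw [this]
    exact norm_mul_self_sub_mul_self_le hε hp (norm_sqrt_le_one h0 h1)

theorem norm_mul_sub_sqrt_mul_sqrt_le {B : Type*} [CStarAlgebra B] [PartialOrder B]
    [StarOrderedRing B] {d b : B} (h0 : 0 ≤ d) (h1 : ‖d‖ ≤ 1) {c : ℝ}
    (hc : ‖b * CFC.sqrt d - CFC.sqrt d * b‖ ≤ c) :
    ‖b * d - CFC.sqrt d * b * CFC.sqrt d‖ ≤ c := by
  have h : b * d - CFC.sqrt d * b * CFC.sqrt d =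
      (b * CFC.sqrt d - CFC.sqrt d * b) * CFC.sqrt d := by
    rw [sub_mul, mul_assoc b, CFC.sqrt_mul_sqrt_self d h0]
  rw [h]
  refine (norm_mul_le _ _).trans ?_
  nlinarith [norm_sqrt_le_one h0 h1, norm_nonneg (b * CFC.sqrt d - CFC.sqrt d * b),
    norm_nonneg (CFC.sqrt d)]

/-- The completely positive order zero perturbation of `x ↦ √d * Φ x * √d` obtained by averaging
`d` over the separability idempotent `∑ j, a j ⊗ star (a j)`. -/
theorem norm_average_sub_le {F B : Type*} [NonUnitalCStarAlgebra F] [CStarAlgebra B]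
    [PartialOrder B] [StarOrderedRing B] {n : ℕ} {a : Fin n → F} {e : F}
    (he : e = ∑ j, a j * star (a j)) (he' : ∀ x, e * x = x) {Φ : F →L[ℂ] B}
    (hΦ : ∀ x, ‖Φ x‖ ≤ ‖x‖)
    (hstar : ∀ x, Φ (star x) = star (Φ x)) (hmul : ∀ x y, Φ x * Φ y = Φ e * Φ (x * y))
    (hcomm : ∀ x, Φ e * Φ x = Φ x * Φ e) (h0 : 0 ≤ Φ e) (h1 : ‖Φ e‖ ≤ 1) {g : B}
    (hgs : star g = g) (hg : ∀ x, g * Φ x = Φ x * g) {ε M N δ : ℝ} (hε : ε ≤ 1) (hM : 0 ≤ M)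
    (hδ : 0 ≤ δ) (hp : ‖Φ e * g - CFC.sqrt (Φ e)‖ ≤ ε) (hgM : ‖g‖ ≤ M) {d k : B} (hd0 : 0 ≤ d)
    (hd1 : ‖d‖ ≤ 1) (hgd : ‖g * d - d * g‖ ≤ M * δ) (hd : ∀ x, ‖d * Φ x - Φ x * d‖ ≤ δ * ‖x‖)
    (hk : ‖k - CFC.sqrt d‖ ≤ ε) (hkΦ : ∀ x, ‖k * Φ x - Φ x * k‖ ≤ N * δ * ‖x‖) (x : F) :
    ‖∑ j, (g * Φ (a j)) * d * (g * Φ (star (a j) * x)) - CFC.sqrt d * Φ x * CFC.sqrt d‖ ≤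
      (5 * ε + (2 * M ^ 2 * (∑ j, ‖a j‖ ^ 2) + N) * δ) * ‖x‖ := by
  have hε0 : 0 ≤ ε := (norm_nonneg _).trans hp
  have hψ (x y : F) : (g * Φ x) * (g * Φ y) = (g * g * Φ e) * Φ (x * y) := by
    rw [mul_assoc g (Φ x), ← mul_assoc (Φ x) g, ← hg, mul_assoc g (Φ x), hmul]
    simp only [mul_assoc]
  have hψn (x : F) : ‖g * Φ x‖ ≤ M * ‖x‖ :=
    (norm_mul_le _ _).trans (mul_le_mul hgM (hΦ x) (norm_nonneg _) hM)
  have hψd (x : F) : ‖d * (g * Φ x) - (g * Φ x) * d‖ ≤ 2 * M * δ * ‖x‖ := by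
    rw [norm_sub_rev]
    refine (norm_mul_commutator_le _ _ _).trans ?_
    have h2 := mul_le_mul hgM ((norm_sub_rev _ _).trans_le (hd x)) (norm_nonneg _) hM
    have h3 := mul_le_mul hgd (hΦ x) (norm_nonneg _) (by positivity)
    linarith
  have e1 := norm_sum_mul_commutator_le a hM (by positivity) hψn hψd x
  have hsum : ∑ j, (g * Φ (a j)) * (g * Φ (star (a j) * x)) = (g * g * Φ e) * Φ x := by
    simp only [hψ, ← mul_assoc (a _)]
    rw [← Finset.mul_sum, ← map_sum, ← Finset.sum_mul, ← he, he']
  rw [hsum] at e1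
  have e2 := norm_weight_sub_one_mul_le hstar hmul hcomm h0 h1 hgs hg hε hp x
  have e3 := norm_mul_sub_sqrt_mul_sqrt_le hd0 hd1 (norm_commutator_le_of_near hk (hkΦ x))
  have e4 : ‖(g * g * Φ e - 1) * Φ x * d‖ ≤ 3 * ε * ‖x‖ :=
    (norm_mul_le _ _).trans (by nlinarith [norm_nonneg ((g * g * Φ e - 1) * Φ x)])
  have key : ∑ j, (g * Φ (a j)) * d * (g * Φ (star (a j) * x)) - CFC.sqrt d * Φ x * CFC.sqrt d =
      (∑ j, (g * Φ (a j)) * d * (g * Φ (star (a j) * x)) - (g * g * Φ e) * Φ x * d) +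
      (g * g * Φ e - 1) * Φ x * d + (Φ x * d - CFC.sqrt d * Φ x * CFC.sqrt d) := by
    rw [sub_mul, sub_mul, one_mul]
    abel
  rw [key]
  refine norm_add₃_le.trans ?_
  have e5 := mul_le_mul_of_nonneg_left (hΦ x) hε0
  linarith

/-- A uniform version of `norm_average_sub_le`. -/
theorem exists_polynomial_average_near {F : Type*} [NonUnitalCStarAlgebra F] {n : ℕ}
    {a : Fin n → F} {e : F} (he : e = ∑ j, a j * star (a j)) (he' : ∀ x, e * x = x)
    {η : ℝ} (hη : 0 < η) :
    ∃ δ > (0 : ℝ), ∃ p : ℝ[X], ∀ (B : Type*) [CStarAlgebra B] [Nontrivial B] [PartialOrder B]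
      [StarOrderedRing B] (Φ : F →L[ℂ] B), (∀ x, ‖Φ x‖ ≤ ‖x‖) →
      (∀ x, Φ (star x) = star (Φ x)) → (∀ x y, Φ x * Φ y = Φ e * Φ (x * y)) →
      (∀ x, Φ e * Φ x = Φ x * Φ e) → 0 ≤ Φ e →
      ∀ d : B, 0 ≤ d → ‖d‖ ≤ 1 → (∀ x, ‖d * Φ x - Φ x * d‖ ≤ δ * ‖x‖) →
      ∀ x, ‖∑ j, (aeval (Φ e) p * Φ (a j)) * d * (aeval (Φ e) p * Φ (star (a j) * x)) -
        CFC.sqrt d * Φ x * CFC.sqrt d‖ ≤ η * ‖x‖ := by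
  obtain ⟨ε, hε0, hε1, hε2⟩ : ∃ ε : ℝ, 0 < ε ∧ ε ≤ 1 ∧ ε ≤ η / 10 :=
    ⟨min (η / 10) 1, by positivity, min_le_right _ _, min_le_left _ _⟩
  obtain ⟨p, hp⟩ := exists_polynomial_near_sqrt hε0
  obtain ⟨M, hM, hpM⟩ := p.exists_commutator_bound
  obtain ⟨N, hN, hpN⟩ := (X * p).exists_commutator_bound
  obtain ⟨δ, hδ0, hδ1⟩ :
      ∃ δ > (0 : ℝ), (2 * M ^ 2 * (∑ j, ‖a j‖ ^ 2) + N) * δ ≤ η / 2 := by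
    refine ⟨η / (2 * (2 * M ^ 2 * (∑ j, ‖a j‖ ^ 2) + N + 1)), by positivity, ?_⟩
    rw [mul_div_assoc', div_le_iff₀ (by positivity)]
    nlinarith [hη]
  refine ⟨δ, hδ0, p, fun B _ _ _ _ Φ hΦ hstar hmul hcomm hh0 d hd0 hd1 hdΦ x => ?_⟩
  have he1 : ‖e‖ ≤ 1 := by
    have h : ‖e‖ * ‖e‖ = ‖e‖ := by
      have : star e = e := by simp [he]
      rw [← CStarRing.norm_star_mul_self, this, he']
    by_contra! h1
    nlinarith
  have hh1 : ‖Φ e‖ ≤ 1 := (hΦ e).trans he1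
  have hgc (x : F) : aeval (Φ e) p * Φ x = Φ x * aeval (Φ e) p := by
    have := (hpM B (Φ e) hh1).2 (Φ x)
    rw [hcomm, sub_self, norm_zero, mul_zero] at this
    exact sub_eq_zero.1 (norm_le_zero_iff.1 this)
  have hp1 := hp B (Φ e) hh0 hh1
  rw [map_mul, aeval_X] at hp1
  have hgd : ‖aeval (Φ e) p * d - d * aeval (Φ e) p‖ ≤ M * δ := by
    refine ((hpM B (Φ e) hh1).2 d).trans (mul_le_mul_of_nonneg_left ?_ hM)
    rw [norm_sub_rev]
    exact (hdΦ e).trans (mul_le_of_le_one_right hδ0.le he1)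
  have hkΦ (x : F) : ‖aeval d (X * p) * Φ x - Φ x * aeval d (X * p)‖ ≤ N * δ * ‖x‖ := by
    rw [mul_assoc]
    exact ((hpN B d hd1).2 _).trans (mul_le_mul_of_nonneg_left (hdΦ x) hN)
  refine (norm_average_sub_le he he' hΦ hstar hmul hcomm hh0 hh1
    (star_aeval_of_isSelfAdjoint hh0.isSelfAdjoint p) hgc hε1 hM hδ0.le hp1 (hpM B _ hh1).1
    hd0 hd1 hgd hdΦ (hp B d hd0 hd1) hkΦ x).trans ?_
  refine mul_le_mul_of_nonneg_right ?_ (norm_nonneg x)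
  linarith

end Estimate

section Average

open scoped TensorProduct

theorem Finset.exists_sum_star_mul_self_eq {R ι : Type*} [NonUnitalCStarAlgebra R]
    [PartialOrder R] [StarOrderedRing R] (s : Finset ι) (Y : ι → R) :
    ∃ y, ∑ j ∈ s, star (Y j) * Y j = star y * y :=
  CStarAlgebra.nonneg_iff_eq_star_mul_self.1 (s.sum_nonneg fun _ _ => star_mul_self_nonneg _)

theorem Matrix.exists_sum_star_mul_self_eq {A ι : Type*} [NonUnitalCStarAlgebra A]
    [PartialOrder A] [StarOrderedRing A] {k : ℕ} (s : Finset ι)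
    (Y : ι → Matrix (Fin k) (Fin k) A) :
    ∃ y, ∑ j ∈ s, star (Y j) * Y j = star y * y :=
  letI : PartialOrder (CStarMatrix (Fin k) (Fin k) A) := CStarAlgebra.spectralOrder _
  letI : StarOrderedRing (CStarMatrix (Fin k) (Fin k) A) := CStarAlgebra.spectralOrderedRing _
  Finset.exists_sum_star_mul_self_eq (R := CStarMatrix (Fin k) (Fin k) A) s Y

theorem IsCP.real_smul {F A : Type*} [NonUnitalCStarAlgebra F] [NonUnitalCStarAlgebra A]
    {φ : F → A} (hφ : IsCP φ) {c : ℝ} (hc : 0 ≤ c) : IsCP fun x => c • φ x := by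
  intro n m hm
  obtain ⟨y, hy⟩ := hφ n m hm
  refine ⟨√c • y, ?_⟩
  rw [star_smul, star_trivial, smul_mul_smul_comm, Real.mul_self_sqrt hc, ← hy]
  rfl

theorem IsOrderZero.real_smul {F A : Type*} [NonUnitalCStarAlgebra F] [PartialOrder F]
    [NonUnitalCStarAlgebra A] {φ : F → A} (hφ : IsOrderZero φ) (c : ℝ) :
    IsOrderZero fun x => c • φ x := fun a b ha hb hab => by
  rw [smul_mul_smul_comm, hφ a b ha hb hab, smul_zero]

theorem TensorProduct.sum_map₂_eq_of_sum_tmul_eq {F B : Type*} [NonUnitalCStarAlgebra F]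
    [AddCommGroup B] [Module ℂ B] {n : ℕ} {a : Fin n → F}
    (ha : ∀ x, ∑ j, (x * a j) ⊗ₜ[ℂ] star (a j) = ∑ j, a j ⊗ₜ[ℂ] (star (a j) * x))
    (β : F →ₗ[ℂ] F →ₗ[ℂ] B) (x : F) :
    ∑ j, β (x * a j) (star (a j)) = ∑ j, β (a j) (star (a j) * x) := by
  simpa using congrArg (TensorProduct.lift β) (ha x)

/-- Averaging a positive element `d` of the unitization over a separability idempotent, along a
`*`-preserving map which preserves all orthogonality relations. -/
theorem exists_average_map {F A : Type*} [NonUnitalCStarAlgebra F] [PartialOrder F]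
    [NonUnitalCStarAlgebra A] [PartialOrder A] [StarOrderedRing A] {n : ℕ} {a : Fin n → F}
    (ha : ∀ x, ∑ j, (x * a j) ⊗ₜ[ℂ] star (a j) = ∑ j, a j ⊗ₜ[ℂ] (star (a j) * x))
    {ψ : F →ₗ[ℂ] A} (hstar : ∀ x, ψ (star x) = star (ψ x))
    (hψ : ∀ x y, x * y = 0 → ψ x * ψ y = 0) {d : Unitization ℂ A} (hd : 0 ≤ d) :
    ∃ φ : F →ₗ[ℂ] A, IsCP φ ∧ IsOrderZero φ ∧
      ∀ x, (φ x : Unitization ℂ A) =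
        ∑ j, (ψ (a j) : Unitization ℂ A) * d * (ψ (star (a j) * x) : Unitization ℂ A) := by
  let Ψ : F →ₗ[ℂ] Unitization ℂ A := (Unitization.inrHom ℂ ℂ A).comp ψ
  let φ : F →ₗ[ℂ] A := (Unitization.sndHom ℂ ℂ A).comp
    (∑ j, (LinearMap.mulLeft ℂ (Ψ (a j) * d)).comp (Ψ.comp (LinearMap.mulLeft ℂ (star (a j)))))
  have hinr {z : Unitization ℂ A} (hz : z.fst = 0) : (z.snd : Unitization ℂ A) = z := by
    ext <;> simp [hz]
  have hφ (x : F) : (φ x : Unitization ℂ A) = ∑ j, Ψ (a j) * d * Ψ (star (a j) * x) := by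
    have : φ x = (∑ j, Ψ (a j) * d * Ψ (star (a j) * x)).snd := by
      simp only [φ, LinearMap.comp_apply, LinearMap.sum_apply, LinearMap.mulLeft_apply]
      rfl
    rw [this, hinr]
    change Unitization.fstHom ℂ A _ = 0
    simp [Ψ, map_sum]
  have hbi (x y : F) : ∑ j, Ψ (a j) * d * Ψ (star (a j) * (x * y)) =
      ∑ j, Ψ (x * a j) * d * Ψ (star (a j) * y) := by
    have := TensorProduct.sum_map₂_eq_of_sum_tmul_eq ha
      ((LinearMap.mul ℂ (Unitization ℂ A)).compl₁₂ ((LinearMap.mulRight ℂ d).comp Ψ)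
        (Ψ.comp (LinearMap.mulRight ℂ y))) x
    simpa [mul_assoc] using this.symm
  have hbi' (y : F) : ∑ j, Ψ (a j) * d * Ψ (star (a j) * y) =
      ∑ j, Ψ (y * a j) * d * Ψ (star (a j)) := by
    have := TensorProduct.sum_map₂_eq_of_sum_tmul_eq ha
      ((LinearMap.mul ℂ (Unitization ℂ A)).compl₁₂ ((LinearMap.mulRight ℂ d).comp Ψ) Ψ) y
    simpa using this.symm
  have hΨstar (x : F) : Ψ (star x) = star (Ψ x) := by simp [Ψ, hstar]
  refine ⟨φ, ?_, ?_, hφ⟩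
  · rintro k m ⟨X, rfl⟩
    let v (j : Fin n) (x : F) : A := (CFC.sqrt d * Ψ (star (a j) * x)).snd
    have hv (j : Fin n) (x : F) : (v j x : Unitization ℂ A) = CFC.sqrt d * Ψ (star (a j) * x) :=
      hinr (by simp [Ψ])
    have hφv (x y : F) : φ (star x * y) = ∑ j, star (v j x) * v j y := by
      apply Unitization.inr_injective (R := ℂ)
      have : ((∑ j, star (v j x) * v j y : A) : Unitization ℂ A) =
          ∑ j, star (v j x : Unitization ℂ A) * (v j y : Unitization ℂ A) :=
        (map_sum (Unitization.inrHom ℂ ℂ A) _ _).trans (by simp)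
      rw [hφ, hbi, this]
      refine Finset.sum_congr rfl fun j _ => ?_
      rw [hv, hv, star_mul, (CFC.sqrt_nonneg d).isSelfAdjoint.star_eq, ← hΨstar, star_mul,
        star_star, mul_assoc _ (CFC.sqrt d), ← mul_assoc (CFC.sqrt d),
        CFC.sqrt_mul_sqrt_self d hd, mul_assoc]
    obtain ⟨y, hy⟩ := Matrix.exists_sum_star_mul_self_eq (A := A) (k := k) Finset.univ
      fun j => X.map (v j)
    refine ⟨y, hy ▸ ?_⟩
    ext r s
    simp only [Matrix.map_apply, Matrix.star_eq_conjTranspose, Matrix.mul_apply,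
      Matrix.conjTranspose_apply, Matrix.sum_apply, map_sum, hφv]
    exact Finset.sum_comm
  · intro x y _ _ hxy
    apply Unitization.inr_injective (R := ℂ)
    rw [Unitization.inr_mul, hφ, hφ, hbi' y, Finset.sum_mul_sum, Unitization.inr_zero]
    refine Finset.sum_eq_zero fun i _ => Finset.sum_eq_zero fun j _ => ?_
    have h : Ψ (star (a i) * x) * Ψ (y * a j) = 0 := by
      have := hψ (star (a i) * x) (y * a j)
        (by simp only [mul_assoc, ← mul_assoc x, hxy, zero_mul, mul_zero])
      simp [Ψ, ← Unitization.inr_mul, this]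
    rw [mul_assoc, ← mul_assoc (Ψ _), ← mul_assoc (Ψ _), h, zero_mul, zero_mul, mul_zero]

end Average

section Stability

open Polynomial

/-- The averaged map associated with a completely positive order zero map, as a bounded map. -/
theorem exists_orderZero_near {F A : Type*} [NonUnitalCStarAlgebra F] [PartialOrder F]
    [StarOrderedRing F] [FiniteDimensional ℂ F] [NonUnitalCStarAlgebra A] [PartialOrder A]
    [StarOrderedRing A] {n : ℕ} {a : Fin n → F}
    (ha : ∀ x, ∑ j, (x * a j) ⊗ₜ[ℂ] star (a j) = ∑ j, a j ⊗ₜ[ℂ] (star (a j) * x))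
    {Φ : F →L[ℂ] Unitization ℂ A} {φ : F →L[ℂ] A} (hΦφ : ∀ x, Φ x = (φ x : Unitization ℂ A))
    {e : F} (hstar : ∀ x, Φ (star x) = star (Φ x)) (hmul : ∀ x y, Φ x * Φ y = Φ e * Φ (x * y))
    {g : Unitization ℂ A} (hgs : star g = g) (hg : ∀ x, g * Φ x = Φ x * g)
    {d : Unitization ℂ A} (hd0 : 0 ≤ d) (hd1 : ‖d‖ ≤ 1) (hφ : ‖φ‖ ≤ 1) {η : ℝ} (hη : 0 < η)
    (hgd : ∀ x, ‖∑ j, (g * Φ (a j)) * d * (g * Φ (star (a j) * x)) -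
        CFC.sqrt d * Φ x * CFC.sqrt d‖ ≤ η / 2 * ‖x‖) :
    ∃ φhat : F →L[ℂ] A, ‖φhat‖ ≤ 1 ∧ IsCP φhat ∧ IsOrderZero φhat ∧
      ∀ x, ‖(φhat x : Unitization ℂ A) - CFC.sqrt d * Φ x * CFC.sqrt d‖ ≤ η * ‖x‖ := by
  let ψ : F →ₗ[ℂ] A := (Unitization.sndHom ℂ ℂ A).comp ((LinearMap.mulLeft ℂ g).comp Φ.toLinearMap)
  have hψ (x : F) : (ψ x : Unitization ℂ A) = g * Φ x := by
    change ((g * Φ x).snd : Unitization ℂ A) = g * Φ x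
    ext <;> simp [hΦφ]
  have hψstar (x : F) : ψ (star x) = star (ψ x) := by
    apply Unitization.inr_injective (R := ℂ)
    rw [Unitization.inr_star, hψ, hψ, star_mul, hgs, hg, hstar]
  have hψ0 (x y : F) (hxy : x * y = 0) : ψ x * ψ y = 0 := by
    apply Unitization.inr_injective (R := ℂ)
    rw [Unitization.inr_mul, hψ, hψ, mul_assoc, ← mul_assoc (Φ x), ← hg, mul_assoc g (Φ x), hmul,
      hxy, map_zero, mul_zero, mul_zero, mul_zero, Unitization.inr_zero]
  obtain ⟨φ₀, hcp, hoz, hφ₀⟩ := exists_average_map ha hψstar hψ0 hd0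
  simp only [hψ] at hφ₀
  simp only [← hφ₀] at hgd
  have hs (x : F) : ‖CFC.sqrt d * Φ x * CFC.sqrt d‖ ≤ ‖x‖ := by
    have h1 := norm_sqrt_le_one hd0 hd1
    have h2 : ‖Φ x‖ ≤ ‖x‖ := by
      rw [hΦφ, Unitization.norm_inr]
      simpa using φ.le_of_opNorm_le hφ x
    calc _ ≤ ‖CFC.sqrt d‖ * ‖Φ x‖ * ‖CFC.sqrt d‖ := norm_mul₃_le
      _ ≤ 1 * ‖x‖ * 1 := by gcongr
      _ = ‖x‖ := by ring
  have hn (x : F) : ‖(φ₀ x : Unitization ℂ A)‖ ≤ (1 + η / 2) * ‖x‖ := by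
    have := norm_le_norm_add_norm_sub' (φ₀ x : Unitization ℂ A)
      (CFC.sqrt d * Φ x * CFC.sqrt d)
    linarith [hs x, hgd x]
  set c : ℝ := (1 + η / 2)⁻¹ with hc
  have hc0 : 0 ≤ c := by positivity
  have hc1 : c * (1 + η / 2) = 1 := inv_mul_cancel₀ (by positivity)
  have hcn (x : F) : ‖c • φ₀ x‖ ≤ 1 * ‖x‖ := by
    rw [norm_smul, Real.norm_of_nonneg hc0, ← Unitization.norm_inr (𝕜 := ℂ), ← hc1, mul_assoc]
    exact mul_le_mul_of_nonneg_left (hn x) hc0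
  refine ⟨(c • φ₀).mkContinuous 1 hcn, LinearMap.mkContinuous_norm_le _ zero_le_one _,
    hcp.real_smul hc0, hoz.real_smul c, fun x => ?_⟩
  change ‖((c • φ₀ x : A) : Unitization ℂ A) - _‖ ≤ _
  have h1 : ((c • φ₀ x : A) : Unitization ℂ A) - (φ₀ x : Unitization ℂ A) =
      ((c - 1) • φ₀ x : A) := by
    rw [sub_smul, one_smul, Unitization.inr_sub]
  have h2 : ‖((c • φ₀ x : A) : Unitization ℂ A) - (φ₀ x : Unitization ℂ A)‖ ≤ η / 2 * ‖x‖ := by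
    rw [h1, Unitization.norm_inr, norm_smul, Real.norm_of_nonpos (by nlinarith),
      ← Unitization.norm_inr (𝕜 := ℂ)]
    calc _ ≤ -(c - 1) * ((1 + η / 2) * ‖x‖) :=
          mul_le_mul_of_nonneg_left (hn x) (by nlinarith)
      _ = _ := by linear_combination (-‖x‖) * hc1
  have := norm_sub_le_norm_sub_add_norm_sub ((c • φ₀ x : A) : Unitization ℂ A)
    (φ₀ x : Unitization ℂ A) (CFC.sqrt d * Φ x * CFC.sqrt d)
  linarith [hgd x]

end Stability

/-- weak stability of order zero maps with finite-dimensional domain.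
Let `F` be a finite-dimensional C*-algebra. For every `η > 0` there is `δ > 0` such that for
every C*-algebra `A`, every completely positive contractive order zero map `φ : F → A`, and
every positive contraction `d` in the unitization `A⁺ = Unitization ℂ A` which `δ`-commutes
with the range of `φ`, there is a completely positive contractive order zero map
`φ̂ : F → A` with `‖φ̂(x) − d^{1/2}·φ(x)·d^{1/2}‖ ≤ η·‖x‖` for all `x ∈ F`.

Complete positivity is expressed by requiring that the entrywise application of the map to
any positive matrix (one of the form `star x * x`) yields a positive matrix. -/
theorem order_zero_weakly_stable {F : Type*} [NonUnitalCStarAlgebra F]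
    [PartialOrder F] [StarOrderedRing F] [FiniteDimensional ℂ F]
    {η : ℝ} (hη : 0 < η) :
    ∃ δ > (0 : ℝ), ∀ (A : Type*) [NonUnitalCStarAlgebra A] [PartialOrder A]
      [StarOrderedRing A],
      ∀ φ : F →L[ℂ] A, ‖φ‖ ≤ 1 →
        (∀ (n : ℕ) (m : Matrix (Fin n) (Fin n) F),
          (∃ x : Matrix (Fin n) (Fin n) F, m = star x * x) →
          ∃ y : Matrix (Fin n) (Fin n) A, m.map φ = star y * y) →
        (∀ a b : F, 0 ≤ a → 0 ≤ b → a * b = 0 → φ a * φ b = 0) →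
        ∀ d : Unitization ℂ A, 0 ≤ d → ‖d‖ ≤ 1 →
          (∀ x : F, ‖d * (φ x : Unitization ℂ A) - (φ x : Unitization ℂ A) * d‖ ≤ δ * ‖x‖) →
          ∃ φhat : F →L[ℂ] A, ‖φhat‖ ≤ 1 ∧
            (∀ (n : ℕ) (m : Matrix (Fin n) (Fin n) F),
              (∃ x : Matrix (Fin n) (Fin n) F, m = star x * x) →
              ∃ y : Matrix (Fin n) (Fin n) A, m.map φhat = star y * y) ∧
            (∀ a b : F, 0 ≤ a → 0 ≤ b → a * b = 0 → φhat a * φhat b = 0) ∧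
            ∀ x : F,
              ‖(φhat x : Unitization ℂ A) -
                CFC.sqrt d * (φ x : Unitization ℂ A) * CFC.sqrt d‖ ≤ η * ‖x‖ := by
  obtain ⟨n, a, ha, hunit⟩ := exists_separability_idempotent (F := F)
  obtain ⟨e, he⟩ : ∃ e : F, e = ∑ j, a j * star (a j) := ⟨_, rfl⟩
  rw [← he] at hunit
  have hunit' (x : F) : x * e = x := by
    rw [← star_star x, ← star_eq_of_isLeftUnit hunit, ← star_mul, hunit]
  obtain ⟨δ, hδ, p, hp⟩ := exists_polynomial_average_near he hunit (half_pos hη)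
  refine ⟨δ, hδ, fun A _ _ _ φ hφ hcp hoz d hd0 hd1 hdφ => ?_⟩
  let Φ : F →L[ℂ] Unitization ℂ A :=
    ((Unitization.inrHom ℂ ℂ A).comp φ.toLinearMap).toContinuousLinearMap
  have hcp' : IsCP φ.toLinearMap := hcp
  have hoz' : IsOrderZero φ.toLinearMap := hoz
  have hΦ (x : F) : Φ x = (φ x : Unitization ℂ A) := rfl
  have hΦn (x : F) : ‖Φ x‖ ≤ ‖x‖ := by
    rw [hΦ, Unitization.norm_inr]
    simpa using φ.le_of_opNorm_le hφ x
  have hstar (x : F) : Φ (star x) = star (Φ x) := by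
    have := hcp'.map_star hunit hunit' x
    rw [hΦ, hΦ, ← Unitization.inr_star]
    exact congrArg _ this
  have hmul (x y : F) : Φ x * Φ y = Φ e * Φ (x * y) := by
    have := hcp'.map_mul_map hunit hunit' hoz' x y
    simp only [hΦ, ← Unitization.inr_mul]
    exact congrArg _ this
  have hcomm (x : F) : Φ e * Φ x = Φ x * Φ e := by
    rw [hmul x e, hunit']
  have h0 : 0 ≤ Φ e := Unitization.inr_nonneg_iff.2 (hcp'.map_unit_nonneg hunit hunit')
  exact exists_orderZero_near ha hΦ hstar hmul
    (star_aeval_of_isSelfAdjoint h0.isSelfAdjoint p)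
    (fun x => (Algebra.commute_of_mem_adjoin_singleton_of_commute
      (Polynomial.aeval_mem_adjoin_singleton ℝ (Φ e)) (hcomm x).symm).symm) hd0 hd1 hφ hη
    (hp (Unitization ℂ A) Φ hΦn hstar hmul hcomm h0 d hd0 hd1 hdφ)
end

section
/- Let A be a separable C*-algebra and J ⊆ A a closed two-sided ideal (closed under adjoints). Suppose τ is a densely defined lower semicontinuous trace on J, i.e. τ : J₊ → [0,∞] satisfies: τ(a+b) = τ(a)+τ(b) for all positive a, b ∈ J; τ(t·a) = t·τ(a) for all t > 0 and positive a ∈ J, with τ(0) = 0; τ is lower semicontinuous on the positive cone of J with respect to the norm topology; τ(x*·x) = τ(x·x*) for all x ∈ J; and the set {a ∈ J₊ : τ(a) < ∞} is dense in J₊. Then τ extends to a (not necessarily densely defined) lower semicontinuous trace on A: there exists τ' : A₊ → [0,∞] which is additive and positively homogeneous on A₊, lower semicontinuous for the norm topology, satisfies τ'(x*·x) = τ'(x·x*) for all x ∈ A, and satisfies τ'(a) = τ(a) for every positive a ∈ J. -/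
open scoped ENNReal

section

variable {A : Type*} [NonUnitalCStarAlgebra A] [PartialOrder A] [StarOrderedRing A]

/-- A closed two-sided ideal of a C⋆-algebra which is closed under adjoints, regarded as a
non-unital star subalgebra. -/
def TwoSidedIdeal.toNonUnitalStarSubalgebra (J : TwoSidedIdeal A)
    (hJclosed : IsClosed (J : Set A)) (hJstar : ∀ x : A, x ∈ J → star x ∈ J) :
    NonUnitalStarSubalgebra ℂ A where
  carrier := J
  add_mem' := J.add_mem
  zero_mem' := J.zero_mem
  mul_mem' := fun {_ y} hx _ ↦ J.mul_mem_right _ y hx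
  smul_mem' c x hx := by
    have hu := CStarAlgebra.increasingApproximateUnit A
    have := hu.neBot
    have h : Filter.Tendsto (fun e ↦ (c • e) * x) (CStarAlgebra.approximateUnit A)
        (nhds (c • x)) := by
      simpa only [smul_mul_assoc] using (hu.tendsto_mul_right x).const_smul c
    exact hJclosed.mem_of_tendsto h (.of_forall fun e ↦ J.mul_mem_left _ _ hx)
  star_mem' := hJstar _

namespace NonUnitalStarSubalgebra

lemma sqrt_mem (S : NonUnitalStarSubalgebra ℂ A) [IsClosed (S : Set A)] {a : A} (ha : a ∈ S)
    (ha0 : 0 ≤ a) : CFC.sqrt a ∈ S := by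
  rw [CFC.sqrt_eq_real_sqrt a ha0]
  exact cfcₙ_mem (𝕜 := ℝ) (𝕜' := ℂ) (s := S) _ ha

/-- The nonnegative elements of norm less than one in a star subalgebra. -/
def nonnegBall (S : NonUnitalStarSubalgebra ℂ A) : Set A := {e | e ∈ S ∧ 0 ≤ e ∧ ‖e‖ < 1}

lemma starOrderedRing (S : NonUnitalStarSubalgebra ℂ A) [IsClosed (S : Set A)] :
    StarOrderedRing S := by
  refine .of_nonneg_iff' (fun {x y} h z ↦ add_le_add_right (α := A) h z) fun x ↦ ⟨fun hx ↦ ?_, ?_⟩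
  · have hx' : 0 ≤ (x : A) := hx
    refine ⟨⟨CFC.sqrt x, S.sqrt_mem x.2 hx'⟩, Subtype.ext ?_⟩
    simp [(CFC.sqrt_nonneg (x : A)).isSelfAdjoint.star_eq, CFC.sqrt_mul_sqrt_self (x : A) hx']
  · rintro ⟨y, rfl⟩
    exact star_mul_self_nonneg (y : A)

lemma directedOn_nonnegBall (S : NonUnitalStarSubalgebra ℂ A) [IsClosed (S : Set A)] :
    DirectedOn (· ≤ ·) S.nonnegBall := by
  have := S.starOrderedRing
  rintro a ⟨ha, ha0, ha1⟩ b ⟨hb, hb0, hb1⟩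
  obtain ⟨c, ⟨hc0, hc1⟩, hac, hbc⟩ := CStarAlgebra.directedOn_nonneg_ball (A := S)
    ⟨a, ha⟩ ⟨ha0, by simpa using ha1⟩ ⟨b, hb⟩ ⟨hb0, by simpa using hb1⟩
  exact ⟨c, ⟨c.2, hc0, by simpa using hc1⟩, hac, hbc⟩

lemma mem_closure_mul_nonnegBall (S : NonUnitalStarSubalgebra ℂ A) [IsClosed (S : Set A)]
    {y : A} (hy : y ∈ S) : y ∈ closure ((y * ·) '' S.nonnegBall) := by
  have := S.starOrderedRing
  rw [mem_closure_iff_nhds]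
  intro t ht
  have h : Filter.Tendsto (fun e : S ↦ y * (e : A)) (CStarAlgebra.approximateUnit S) (nhds y) :=
    (continuous_subtype_val.tendsto _).comp
      ((CStarAlgebra.increasingApproximateUnit S).tendsto_mul_left ⟨y, hy⟩)
  obtain ⟨e, ⟨he0, he1⟩, he⟩ := (CStarAlgebra.hasBasis_approximateUnit S).mem_iff.mp (h ht)
  exact ⟨_, he ⟨le_refl e, by simpa using he1.le⟩, e, ⟨e.2, he0, he1⟩, rfl⟩

end NonUnitalStarSubalgebra

end

/-- Let `A` be a separable C*-algebra and `J ⊆ A` a closed two-sided ideal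
closed under adjoints. Every densely defined lower semicontinuous trace on `J` (modelled as a
function `τ : A → ℝ≥0∞` whose trace properties are only required on the positive cone of `J`)
extends to a (not necessarily densely defined) lower semicontinuous trace on `A`. -/
theorem lsc_trace_extension {A : Type*} [NonUnitalCStarAlgebra A]
    [PartialOrder A] [StarOrderedRing A] [TopologicalSpace.SeparableSpace A]
    (J : TwoSidedIdeal A) (hJclosed : IsClosed (J : Set A))
    (hJstar : ∀ x : A, x ∈ J → star x ∈ J)
    (τ : A → ℝ≥0∞)
    (hadd : ∀ a b : A, a ∈ J → b ∈ J → 0 ≤ a → 0 ≤ b → τ (a + b) = τ a + τ b)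
    (hhom : ∀ (t : ℝ) (a : A), 0 < t → a ∈ J → 0 ≤ a →
      τ (t • a) = ENNReal.ofReal t * τ a)
    (hzero : τ 0 = 0)
    (hlsc : LowerSemicontinuousOn τ {a : A | a ∈ J ∧ 0 ≤ a})
    (htr : ∀ x : A, x ∈ J → τ (star x * x) = τ (x * star x))
    (hdense : {a : A | a ∈ J ∧ 0 ≤ a} ⊆
      closure {a : A | a ∈ J ∧ 0 ≤ a ∧ τ a < ∞}) :
    ∃ τ' : A → ℝ≥0∞,
      (∀ a b : A, 0 ≤ a → 0 ≤ b → τ' (a + b) = τ' a + τ' b) ∧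
      (∀ (t : ℝ) (a : A), 0 < t → 0 ≤ a → τ' (t • a) = ENNReal.ofReal t * τ' a) ∧
      τ' 0 = 0 ∧
      LowerSemicontinuousOn τ' {a : A | 0 ≤ a} ∧
      (∀ x : A, τ' (star x * x) = τ' (x * star x)) ∧
      (∀ a : A, a ∈ J → 0 ≤ a → τ' a = τ a) := by
  let S := J.toNonUnitalStarSubalgebra hJclosed hJstar
  have hS : IsClosed (S : Set A) := hJclosed
  have sqrt_star (e : A) : star (CFC.sqrt e) = CFC.sqrt e :=
    (CFC.sqrt_nonneg e).isSelfAdjoint.star_eq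
  have conj_nonneg {a : A} (e : A) (ha : 0 ≤ a) : 0 ≤ CFC.sqrt e * a * CFC.sqrt e :=
    conjugate_nonneg_of_nonneg ha (CFC.sqrt_nonneg e)
  have conj_mem {e : A} (he : e ∈ S.nonnegBall) (a : A) : CFC.sqrt e * a * CFC.sqrt e ∈ J :=
    J.mul_mem_left _ _ (S.sqrt_mem he.1 he.2.1)
  have mid_mem {e : A} (he : e ∈ S.nonnegBall) (x : A) : x * e * star x ∈ J :=
    J.mul_mem_right _ _ (J.mul_mem_left _ _ he.1)
  have mono {a b : A} (ha : a ∈ J) (hb : b ∈ J) (ha0 : 0 ≤ a) (hab : a ≤ b) : τ a ≤ τ b := by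
    have h := hadd a (b - a) ha (J.sub_mem hb ha) ha0 (sub_nonneg.mpr hab)
    rw [add_sub_cancel] at h
    exact h ▸ le_self_add
  have conj_eq {e : A} (he : e ∈ S.nonnegBall) (x : A) :
      τ (CFC.sqrt e * (star x * x) * CFC.sqrt e) = τ (x * e * star x) := by
    have h := htr (x * CFC.sqrt e) (J.mul_mem_left _ _ (S.sqrt_mem he.1 he.2.1))
    rw [star_mul, sqrt_star] at h
    rw [show x * e * star x = x * CFC.sqrt e * (CFC.sqrt e * star x) by
      rw [← mul_assoc, mul_assoc x (CFC.sqrt e), CFC.sqrt_mul_sqrt_self e he.2.1], ← h]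
    simp only [mul_assoc]
  have mid_le {e : A} (he : e ∈ S.nonnegBall) (x : A) : x * e * star x ≤ x * star x := by
    refine (CStarAlgebra.star_right_conjugate_le_norm_smul he.2.1.isSelfAdjoint).trans ?_
    exact smul_le_of_le_one_left (mul_star_self_nonneg x) he.2.2.le
  let τ' : A → ℝ≥0∞ := fun a ↦ ⨆ e : S.nonnegBall, τ (CFC.sqrt (e : A) * a * CFC.sqrt (e : A))
  have ext_eq (a : A) (ha : a ∈ J) (ha0 : 0 ≤ a) : τ' a = τ a := by
    set y := CFC.sqrt a
    have hy : star y = y := sqrt_star a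
    have hyy : y * y = a := CFC.sqrt_mul_sqrt_self a ha0
    have heq (e : S.nonnegBall) :
        τ (CFC.sqrt (e : A) * a * CFC.sqrt (e : A)) = τ (y * e * y) := by
      simpa only [hy, hyy] using conj_eq e.2 y
    have hyS : y ∈ S := S.sqrt_mem ha ha0
    apply le_antisymm
    · refine iSup_le fun e ↦ (heq e).trans_le (mono ?_ ha ?_ ?_)
      · simpa only [hy] using mid_mem e.2 y
      · exact conjugate_nonneg_of_nonneg e.2.2.1 (CFC.sqrt_nonneg a)
      · simpa only [hy, hyy] using mid_le e.2 y
    · refine le_of_forall_lt fun c hc ↦ ?_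
      have hcl : a ∈ closure ((fun e ↦ y * e * y) '' S.nonnegBall) := by
        have h := map_mem_closure (f := (· * y)) (by fun_prop) (S.mem_closure_mul_nonnegBall hyS)
          (t := (fun e ↦ y * e * y) '' S.nonnegBall) (by rintro _ ⟨e, he, rfl⟩; exact ⟨e, he, rfl⟩)
        simpa only [hyy] using h
      have hev := hlsc a ⟨ha, ha0⟩ c hc
      rw [eventually_nhdsWithin_iff] at hev
      obtain ⟨_, hlt, e, he, rfl⟩ := mem_closure_iff_nhds.mp hcl _ hev
      refine (hlt ⟨?_, ?_⟩).trans_le ?_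
      · exact J.mul_mem_left _ _ hyS
      · exact conjugate_nonneg_of_nonneg he.2.1 (CFC.sqrt_nonneg a)
      · exact (heq ⟨e, he⟩).symm.trans_le
          (le_iSup (fun e : S.nonnegBall ↦ τ (CFC.sqrt (e : A) * a * CFC.sqrt (e : A))) ⟨e, he⟩)
  have tr_le (x : A) : τ' (star x * x) ≤ τ' (x * star x) := by
    refine iSup_le fun e ↦ ?_
    have h0 : 0 ≤ x * e * star x := star_right_conjugate_nonneg e.2.2.1 x
    rw [conj_eq e.2, ← ext_eq _ (mid_mem e.2 x) h0]
    refine iSup_mono fun f ↦ mono (conj_mem f.2 _) (conj_mem f.2 _) (conj_nonneg _ h0) ?_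
    exact conjugate_le_conjugate_of_nonneg (mid_le e.2 x) (CFC.sqrt_nonneg _)
  refine ⟨τ', fun a b ha hb ↦ ?_, fun t a ht ha ↦ ?_, by simp [τ', hzero], ?_, fun x ↦ ?_, ext_eq⟩
  · have mono_e {a : A} (ha : 0 ≤ a) {e f : A} (he : e ∈ S.nonnegBall)
        (hf : f ∈ S.nonnegBall) (hef : e ≤ f) :
        τ (CFC.sqrt e * a * CFC.sqrt e) ≤ τ (CFC.sqrt f * a * CFC.sqrt f) := by
      obtain ⟨x, rfl⟩ := CStarAlgebra.nonneg_iff_eq_star_mul_self.mp ha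
      rw [conj_eq he, conj_eq hf]
      exact mono (mid_mem he x) (mid_mem hf x) (star_right_conjugate_nonneg he.2.1 x)
        (star_right_conjugate_le_conjugate hef x)
    simp only [τ']
    rw [ENNReal.iSup_add_iSup]
    · refine iSup_congr fun e ↦ ?_
      rw [mul_add, add_mul, hadd _ _ (conj_mem e.2 a) (conj_mem e.2 b) (conj_nonneg _ ha)
        (conj_nonneg _ hb)]
    · intro e f
      obtain ⟨g, hg, heg, hfg⟩ := S.directedOn_nonnegBall e e.2 f f.2
      exact ⟨⟨g, hg⟩, add_le_add (mono_e ha e.2 hg heg) (mono_e hb f.2 hg hfg)⟩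
  · simp only [τ', ENNReal.mul_iSup]
    refine iSup_congr fun e ↦ ?_
    rw [mul_smul_comm, smul_mul_assoc, hhom t _ ht (conj_mem e.2 a) (conj_nonneg _ ha)]
  · refine lowerSemicontinuousOn_iSup fun e ↦ ?_
    exact hlsc.comp (g := fun a ↦ CFC.sqrt (e : A) * a * CFC.sqrt (e : A))
      (Continuous.continuousOn (by fun_prop)) fun a ha ↦ ⟨conj_mem e.2 a, conj_nonneg _ ha⟩
  · exact le_antisymm (tr_le x) (by simpa using tr_le (star x))
end
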